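/- arXiv:1803.05800 — 3 statements merged into one kernel-verified Lean document; each statement's English description precedes it below -/
import Mathlib

section
/- Let m > 1 be an integer. There is a constant c > 0 such that for all sufficiently large X, the number of isomorphism classes of real quadratic fields k with |Disc(k)| < X and rank_m Cl(k) ≥ 1 is at least c·X^(1/(2m−1))/log X. -/
open NumberField

theorem ClassGroup.orderOf_mk0_eq {R : Type*} [CommRing R] [IsDedekindDomain R]
    {m : ℕ} (hm : 0 < m) {α : R} (I : nonZeroDivisors (Ideal R))
    (hI : Ideal.span {α} = (I : Ideal R) ^ m)
    (hα : ∀ p : ℕ, p.Prime → p ∣ m → ∀ (v : Rˣ) (β : R), α ≠ v * β ^ p) :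
    orderOf (ClassGroup.mk0 I) = m := by
  refine orderOf_eq_of_pow_and_pow_div_prime hm ?_ ?_
  · rw [← map_pow, ClassGroup.mk0_eq_one_iff]
    exact ⟨α, by simpa using hI.symm⟩
  · intro p hp hpm h
    rw [← map_pow, ClassGroup.mk0_eq_one_iff] at h
    obtain ⟨β, hβ⟩ := h
    have hβ' : (I : Ideal R) ^ (m / p) = Ideal.span {β} := by simpa using hβ
    have : Ideal.span {β ^ p} = Ideal.span {α} := by
      rw [hI, ← Ideal.span_singleton_pow, ← hβ', ← pow_mul, Nat.div_mul_cancel hpm]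
    obtain ⟨v, hv⟩ := Ideal.span_singleton_eq_span_singleton.1 this
    exact hα p hp hpm v β (by rw [← hv, mul_comm])

theorem ClassGroup.exists_injective_zmod {R : Type*} [CommRing R]
    [IsDedekindDomain R] {m : ℕ} (hm : 0 < m) {α α' z : R} (hz : z ≠ 0) (hmul : α * α' = z ^ m)
    (hcop : IsCoprime α α')
    (hα : ∀ p : ℕ, p.Prime → p ∣ m → ∀ (v : Rˣ) (β : R), α ≠ v * β ^ p) :
    ∃ f : ZMod m →+ Additive (ClassGroup R), Function.Injective f := by
  have hcop' : IsCoprime (Ideal.span {α}) (Ideal.span {α'}) := by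
    rwa [Ideal.isCoprime_span_singleton_iff]
  obtain ⟨I, hI⟩ := exists_eq_pow_of_mul_eq_pow_of_coprime hcop'
    (c := Ideal.span {z}) (n := m)
    (by rw [Ideal.span_singleton_mul_span_singleton, hmul, Ideal.span_singleton_pow])
  have hI0 : I ≠ 0 := by
    rintro rfl
    rw [zero_pow hm.ne', Ideal.zero_eq_bot, Ideal.span_singleton_eq_bot] at hI
    rw [hI, zero_mul] at hmul
    exact pow_ne_zero m hz hmul.symm
  set c : Additive (ClassGroup R) :=
    Additive.ofMul (ClassGroup.mk0 ⟨I, mem_nonZeroDivisors_of_ne_zero hI0⟩) with hc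
  have ho : addOrderOf c = m := by
    rw [hc, addOrderOf_ofMul_eq_orderOf]
    exact ClassGroup.orderOf_mk0_eq hm _ hI hα
  refine ⟨ZMod.lift m ⟨(zmultiplesHom _) c, ?_⟩, ?_⟩
  · rw [← ho]; simp [addOrderOf_nsmul_eq_zero]
  · refine (ZMod.lift_injective _).2 fun k hk => ?_
    rw [ZMod.intCast_zmod_eq_zero_iff_dvd]
    rw [← ho, addOrderOf_dvd_iff_zsmul_eq_zero]
    simpa using hk

theorem PadicInt.exists_root_of_modEq {l : ℕ} [Fact l.Prime] {T g : ℤ}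
    (hroot : (l : ℤ) ∣ g ^ 2 - T * g + 1) (hsimple : ¬ (l : ℤ) ∣ 2 * g - T) :
    ∃ r : ℤ_[l], r * r = -1 + T * r ∧ PadicInt.toZMod r = (g : ZMod l) := by
  have hsimple' : ‖((2 * g - T : ℤ) : ℤ_[l])‖ = 1 :=
    le_antisymm (PadicInt.norm_le_one _)
      (not_lt.1 fun h => hsimple (PadicInt.norm_int_lt_one_iff_dvd _ |>.1 h))
  have hroot' : ‖((g ^ 2 - T * g + 1 : ℤ) : ℤ_[l])‖ < 1 :=
    (PadicInt.norm_int_lt_one_iff_dvd _).2 hroot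
  let F : Polynomial ℤ := .X ^ 2 - .C T * .X + 1
  have hF : ∀ x : ℤ_[l], F.aeval x = x ^ 2 - T * x + 1 := fun x => by simp [F]
  have hF' : ∀ x : ℤ_[l], F.derivative.aeval x = 2 * x - T := fun x => by
    simp [F, map_ofNat]
  obtain ⟨r, hr, hrg, -⟩ := hensels_lemma (p := l) (F := F) (a := (g : ℤ_[l])) (by
    rw [hF, hF']; push_cast at hsimple' hroot'; rw [hsimple']; simpa using hroot')
  rw [hF'] at hrg
  push_cast at hsimple'
  rw [hsimple'] at hrg
  refine ⟨r, by rw [hF] at hr; linear_combination hr, ?_⟩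
  have : PadicInt.toZMod (r - (g : ℤ_[l])) = 0 := by
    rw [← RingHom.mem_ker, PadicInt.ker_toZMod]
    rwa [IsLocalRing.mem_maximalIdeal, PadicInt.mem_nonunits]
  simpa [sub_eq_zero] using this

theorem NumberField.RingOfIntegers.exists_lift_padicInt {K : Type*} [Field K] [NumberField K]
    {l : ℕ} [Fact l.Prime] (ι : K →+* ℚ_[l]) :
    ∃ φ : 𝓞 K →+* ℤ_[l], ∀ x : 𝓞 K, ((φ x : ℤ_[l]) : ℚ_[l]) = ι x := by
  have h : ∀ x : 𝓞 K, ι x ∈ PadicInt.subring l := fun x => by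
    have hx : IsIntegral ℤ (ι x) := (RingOfIntegers.isIntegral_coe x).map (ι.toIntAlgHom)
    have hx' : IsIntegral ℤ_[l] (ι x) := hx.tower_top
    obtain ⟨y, hy⟩ := IsIntegrallyClosed.isIntegral_iff.1 hx'
    rw [← hy]
    exact y.2
  exact ⟨(ι.comp (algebraMap (𝓞 K) K)).codRestrict (PadicInt.subring l) h, fun x => rfl⟩

theorem QuadraticAlgebra.exists_ringHom_zmod {T : ℤ} {K : Type*} [Field K]
    [NumberField K] (e : QuadraticAlgebra ℚ (-1) (T : ℚ) ≃+* K) {u : 𝓞 K}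
    (hu : (u : K) = e QuadraticAlgebra.omega)
    {l : ℕ} [Fact l.Prime] {g : ℤ}
    (hroot : (l : ℤ) ∣ g ^ 2 - T * g + 1) (hsimple : ¬ (l : ℤ) ∣ 2 * g - T) :
    ∃ φ : 𝓞 K →+* ZMod l, φ u = g := by
  obtain ⟨r, hr, hrg⟩ := PadicInt.exists_root_of_modEq hroot hsimple
  have hr' : (r : ℚ_[l]) * r = (-1 : ℚ) • (1 : ℚ_[l]) + (T : ℚ) • (r : ℚ_[l]) := by
    have := congrArg ((↑) : ℤ_[l] → ℚ_[l]) hr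
    push_cast at this
    rw [this, Algebra.smul_def, Algebra.smul_def]
    simp
  let ι : K →+* ℚ_[l] :=
    (QuadraticAlgebra.lift ⟨(r : ℚ_[l]), hr'⟩).toRingHom.comp (e.symm : K →+* _)
  obtain ⟨φ, hφ⟩ := RingOfIntegers.exists_lift_padicInt ι
  refine ⟨PadicInt.toZMod.comp φ, ?_⟩
  have : φ u = r := by
    apply PadicInt.ext
    rw [hφ, hu]
    simp [ι]
  rw [RingHom.comp_apply, this, hrg]

theorem NumberField.IsTotallyReal.exists_unit_generator (K : Type*) [Field K] [NumberField K]
    [IsTotallyReal K] (h2 : Module.finrank ℚ K = 2) :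
    ∃ ε : (𝓞 K)ˣ, ∀ v : (𝓞 K)ˣ, ∃ k : ℤ, v = ε ^ k ∨ v = -ε ^ k := by
  have hrank : Units.rank K = 1 := by
    have h := InfinitePlace.card_add_two_mul_card_eq_rank K
    have h0 := IsTotallyReal.nrComplexPlaces_eq_zero (K := K)
    have h1 := InfinitePlace.card_eq_nrRealPlaces_add_nrComplexPlaces K
    rw [Units.rank]
    omega
  let i₀ : Fin (Units.rank K) := ⟨0, by omega⟩
  have : Subsingleton (Fin (Units.rank K)) := by rw [hrank]; infer_instance
  refine ⟨Units.fundSystem K i₀, fun v => ?_⟩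
  obtain ⟨⟨ζ, k⟩, hv, -⟩ := Units.exist_unique_eq_mul_prod K v
  refine ⟨k i₀, ?_⟩
  rw [Fintype.prod_subsingleton _ i₀] at hv
  have hζ : (ζ : (𝓞 K)ˣ) = 1 ∨ (ζ : (𝓞 K)ˣ) = -1 := by
    obtain ⟨n, hn, hζn⟩ := isOfFinOrder_iff_pow_eq_one.1 ((CommGroup.mem_torsion _).1 ζ.2)
    obtain ⟨w⟩ : Nonempty (InfinitePlace K) := inferInstance
    let σ : K →+* ℝ := InfinitePlace.embedding_of_isReal (IsTotallyReal.isReal w)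
    have h1 : σ ((ζ : (𝓞 K)ˣ) : 𝓞 K) ^ n = 1 := by
      simpa using congrArg (fun x : (𝓞 K)ˣ => σ (x : 𝓞 K)) hζn
    have h2 : |σ ((ζ : (𝓞 K)ˣ) : 𝓞 K)| = 1 := by
      refine (pow_eq_one_iff_of_nonneg (abs_nonneg _) hn.ne').1 ?_
      rw [← abs_pow, h1, abs_one]
    have hinj : Function.Injective fun x : (𝓞 K)ˣ => σ (x : 𝓞 K) := fun x y hxy => by
      ext; exact σ.injective hxy
    rcases eq_or_eq_neg_of_abs_eq h2 with h | h
    · left; apply hinj; simpa using h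
    · right; apply hinj; simpa using h
  rcases hζ with h | h <;> simp only [h] at hv
  · left; simpa using hv
  · right; simpa using hv

theorem Int.dvd_of_zpow_eq_one_of_pow_prime_eq_one {G : Type*} [Group G] {p : ℕ} (hp : p.Prime)
    {e : G} (he : e ^ p = 1) (he1 : e ≠ 1) {n : ℤ} (hn : e ^ n = 1) : (p : ℤ) ∣ n := by
  have : Fact p.Prime := ⟨hp⟩
  rw [← orderOf_eq_prime he he1]
  exact orderOf_dvd_iff_zpow_eq_one.2 hn

/-- If `u` and `α` are, up to sign and `p`-th powers, powers `ε ^ b` and `ε ^ a` of the same unit,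
then their `p`-th power residue characters are powers of the same `p`-th root of unity. -/
theorem RingHom.exists_residue_eq_zpow {R : Type*} [CommRing R] {l p : ℕ} [Fact l.Prime]
    (h2p : 2 * p ∣ l - 1) (φ : R →+* ZMod l) {ε v u : Rˣ} {α β : R} {a b : ℤ}
    (hu : u = ε ^ b ∨ u = -ε ^ b) (hv : v = ε ^ a ∨ v = -ε ^ a) (hα : α = v * β ^ p)
    (hφα : φ α ≠ 0) :
    ∃ e : (ZMod l)ˣ, e ^ p = 1 ∧ ((e ^ a : (ZMod l)ˣ) : ZMod l) = φ α ^ ((l - 1) / p) ∧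
      ((e ^ b : (ZMod l)ˣ) : ZMod l) = φ u ^ ((l - 1) / p) := by
  have hp : p ∣ l - 1 := (Dvd.intro_left 2 rfl).trans h2p
  have heven : Even ((l - 1) / p) := by
    obtain ⟨c, hc⟩ := h2p
    rcases p.eq_zero_or_pos with rfl | hp0
    · simp
    · rw [hc, mul_right_comm, Nat.mul_div_cancel _ hp0]
      exact even_two_mul c
  have key : ∀ (w : Rˣ) (k : ℤ), (w = ε ^ k ∨ w = -ε ^ k) →
      (((Units.map (φ : R →* ZMod l) ε ^ ((l - 1) / p)) ^ k : (ZMod l)ˣ) : ZMod l)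
        = φ w ^ ((l - 1) / p) := by
    intro w k hw
    have h1 : φ w ^ ((l - 1) / p) = φ ((ε ^ k : Rˣ) : R) ^ ((l - 1) / p) := by
      rcases hw with rfl | rfl
      · rfl
      · rw [Units.val_neg, map_neg, heven.neg_pow]
    have h2 : φ ((ε ^ k : Rˣ) : R)
        = ((Units.map (φ : R →* ZMod l) ε ^ k : (ZMod l)ˣ) : ZMod l) := by
      rw [← map_zpow]; rfl
    rw [h1, h2, ← Units.val_pow_eq_pow_val, ← zpow_natCast, ← zpow_natCast, ← zpow_mul,
      ← zpow_mul, mul_comm]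
  refine ⟨Units.map (φ : R →* ZMod l) ε ^ ((l - 1) / p), ?_, ?_, key u b hu⟩
  · rw [← pow_mul, Nat.div_mul_cancel hp, ZMod.units_pow_card_sub_one_eq_one]
  · rw [key v a hv, hα, map_mul, mul_pow, map_pow, ← pow_mul, Nat.mul_div_cancel' hp,
      ZMod.pow_card_sub_one_eq_one, mul_one]
    intro h0
    apply hφα
    rw [hα, map_mul, map_pow, h0]
    rcases p.eq_zero_or_pos with rfl | hp0
    · have := (Fact.out : l.Prime).two_le
      simp at h2p; omega
    · rw [zero_pow hp0.ne', mul_zero]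

instance : Fact (Nat.Prime 13) := ⟨by norm_num⟩

theorem ne_unit_mul_pow_of_residues {R : Type*} [CommRing R] {ε u : Rˣ} {α : R}
    (hε : ∀ v : Rˣ, ∃ k : ℤ, v = ε ^ k ∨ v = -ε ^ k)
    {l₁ l₂ : ℕ} [Fact l₁.Prime] [Fact l₂.Prime] {p : ℕ} (hp : p.Prime)
    (hl₁ : 2 * p ∣ l₁ - 1) (hl₂ : 2 * p ∣ l₂ - 1)
    (φ₁ : R →+* ZMod l₁) (hu₁ : φ₁ u ^ ((l₁ - 1) / p) ≠ 1) (hα₁ : φ₁ α = φ₁ u)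
    (φ₂ : R →+* ZMod l₂) (hu₂ : φ₂ u ^ ((l₂ - 1) / p) ≠ 1) (hα₂ : φ₂ α * φ₂ u = -1)
    (φ₃ : R →+* ZMod 13) (hu₃ : φ₃ u = 4) (hα₃ : φ₃ α = 7) (v : Rˣ) (β : R) :
    α ≠ v * β ^ p := by
  intro hα
  obtain ⟨a, ha⟩ := hε v
  obtain ⟨b, hb⟩ := hε u
  have hφu : ∀ {l : ℕ} [Fact l.Prime] (φ : R →+* ZMod l), φ u ≠ 0 := fun φ =>
    (u.isUnit.map φ).ne_zero
  obtain ⟨e, hep, hea, heb⟩ := φ₁.exists_residue_eq_zpow hl₁ hb ha hα (hα₁ ▸ hφu φ₁)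
  have he1 : e ^ b ≠ 1 := fun h => hu₁ (by rw [← heb, h, Units.val_one])
  have hab : (p : ℤ) ∣ a - b := by
    refine Int.dvd_of_zpow_eq_one_of_pow_prime_eq_one hp hep (fun h => he1 (by simp [h])) ?_
    rw [zpow_sub, mul_inv_eq_one]
    ext
    rw [hea, heb, hα₁]
  have hpb : ¬ (p : ℤ) ∣ b := by
    rintro ⟨c, rfl⟩
    apply he1
    rw [zpow_mul, zpow_natCast, hep, one_zpow]
  rcases hp.eq_two_or_odd' with rfl | hodd
  · obtain ⟨f, hf2, hfa, hfb⟩ := φ₃.exists_residue_eq_zpow (by norm_num) hb ha hα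
      (by rw [hα₃]; decide)
    rw [hu₃] at hfb
    rw [hα₃] at hfa
    have hb1 : f ^ b = 1 := by ext; rw [hfb]; decide
    have hf1 : f ≠ 1 := by
      rintro rfl
      rw [one_zpow] at hfa
      revert hfa; decide
    exact hpb (Int.dvd_of_zpow_eq_one_of_pow_prime_eq_one hp hf2 hf1 hb1)
  · have hα₂' : φ₂ α ≠ 0 := fun h => by simp [h] at hα₂
    obtain ⟨f, hfp, hfa, hfb⟩ := φ₂.exists_residue_eq_zpow hl₂ hb ha hα hα₂'
    have hf1 : f ≠ 1 := by
      rintro rfl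
      rw [one_zpow, Units.val_one] at hfb
      exact hu₂ hfb.symm
    have hsum : (p : ℤ) ∣ a + b := by
      refine Int.dvd_of_zpow_eq_one_of_pow_prime_eq_one hp hfp hf1 ?_
      ext
      rw [zpow_add, Units.val_mul, hfa, hfb, ← mul_pow, hα₂, Units.val_one]
      obtain ⟨c, hc⟩ := hl₂
      rw [hc, mul_right_comm, Nat.mul_div_cancel _ hp.pos]
      exact (even_two_mul c).neg_one_pow
    have h2b : (p : ℤ) ∣ 2 * b := by
      have := dvd_sub hsum hab
      rwa [show a + b - (a - b) = 2 * b by ring] at this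
    rcases Int.Prime.dvd_mul' hp h2b with h | h
    · have : p ∣ 2 := by exact_mod_cast h
      rw [(Nat.prime_dvd_prime_iff_eq hp Nat.prime_two).1 this] at hodd
      exact absurd hodd (by decide)
    · exact hpb h

theorem QuadraticAlgebra.algebraTrace_omega (a b : ℚ) :
    Algebra.trace ℚ (QuadraticAlgebra ℚ a b) QuadraticAlgebra.omega = b := by
  rw [Algebra.trace_eq_matrix_trace (QuadraticAlgebra.basis a b), Matrix.trace_fin_two]
  simp [Algebra.leftMulMatrix_eq_repr_mul, QuadraticAlgebra.basis]

theorem NumberField.abs_discr_le_of_quadratic {T : ℤ} {K : Type*} [Field K] [NumberField K]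
    (h2 : Module.finrank ℚ K = 2) {u : 𝓞 K} (hu : u ^ 2 = T * u - 1)
    (htr : Algebra.trace ℚ K (u : K) = T) (hT : T ^ 2 - 4 ≠ 0) :
    |discr K| ≤ |T ^ 2 - 4| := by
  have h2' : Module.finrank ℤ (𝓞 K) = 2 := by rw [RingOfIntegers.rank, h2]
  let b : Module.Basis (Fin 2) ℤ (𝓞 K) :=
    (RingOfIntegers.basis K).reindex (Fintype.equivFinOfCardEq (by
      rw [← Module.finrank_eq_card_basis (RingOfIntegers.basis K), h2']))
  let v : Fin 2 → 𝓞 K := ![1, u]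
  have htr1 : Algebra.trace ℤ (𝓞 K) 1 = 2 := by
    have := Algebra.trace_algebraMap (R := ℤ) (S := 𝓞 K) 1
    rw [map_one, h2'] at this
    simpa using this
  have htru : Algebra.trace ℤ (𝓞 K) u = T := by
    have := Algebra.coe_trace_int u
    rw [htr] at this
    exact_mod_cast this
  have htru2 : Algebra.trace ℤ (𝓞 K) (u * u) = T ^ 2 - 2 := by
    rw [← sq, hu, map_sub, htr1, ← zsmul_eq_mul, map_zsmul, htru, smul_eq_mul]
    ring
  have hdv : Algebra.discr ℤ v = T ^ 2 - 4 := by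
    rw [Algebra.discr_def, Matrix.det_fin_two]
    simp only [Algebra.traceMatrix_apply, Algebra.traceForm_apply, v, Matrix.cons_val_zero,
      Matrix.cons_val_one, mul_one, one_mul, htr1, htru, htru2]
    ring
  have h := Algebra.discr_of_matrix_vecMul (A := ℤ) b (b.toMatrix v)
  rw [Module.Basis.toMatrix_map_vecMul, hdv, discr_eq_discr] at h
  have hdet : (b.toMatrix v).det ≠ 0 := fun h0 => hT (by rw [h, h0]; ring)
  rw [h, abs_mul, abs_pow]
  exact le_mul_of_one_le_left (abs_nonneg _) (one_le_pow₀ (Int.one_le_abs hdet))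

/-- The larger root of `X ^ 2 - T * X + 1`. -/
noncomputable def quadraticUnit (T : ℤ) : ℝ := (T + √((T : ℝ) ^ 2 - 4)) / 2

/-- The field generated over `ℚ` by the roots of `X ^ 2 - T * X + 1`. -/
noncomputable def quadraticUnitField (T : ℤ) : Subfield ℂ :=
  Subfield.closure {((quadraticUnit T : ℝ) : ℂ)}

section

variable {T T' : ℤ}

theorem three_le_cast {T : ℤ} (hT : 3 ≤ T) : (3 : ℝ) ≤ T := by exact_mod_cast hT

theorem quadraticUnit_sq (hT : 3 ≤ T) : quadraticUnit T ^ 2 = T * quadraticUnit T - 1 := by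
  have h3 := three_le_cast hT
  have h := Real.sq_sqrt (show (0 : ℝ) ≤ (T : ℝ) ^ 2 - 4 by nlinarith)
  rw [quadraticUnit]
  linear_combination h / 4

theorem one_lt_quadraticUnit (hT : 3 ≤ T) : 1 < quadraticUnit T := by
  have h3 := three_le_cast hT
  have h := Real.sqrt_nonneg ((T : ℝ) ^ 2 - 4)
  rw [quadraticUnit]
  linarith

theorem quadraticUnit_le (hT : 3 ≤ T) : quadraticUnit T ≤ T := by
  have h1 := one_lt_quadraticUnit hT
  have h2 := quadraticUnit_sq hT
  nlinarith

theorem quadraticUnit_lt_quadraticUnit (hT : 3 ≤ T) (hTT' : T < T') :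
    quadraticUnit T < quadraticUnit T' := by
  have h3 := three_le_cast hT
  have h : (T : ℝ) < T' := by exact_mod_cast hTT'
  have h' : √((T : ℝ) ^ 2 - 4) ≤ √((T' : ℝ) ^ 2 - 4) := Real.sqrt_le_sqrt (by nlinarith)
  rw [quadraticUnit, quadraticUnit]
  linarith

theorem fact_sq_ne (hT : 3 ≤ T) : Fact (∀ r : ℚ, r ^ 2 ≠ -1 + (T : ℚ) * r) := by
  refine ⟨fun r hr => ?_⟩
  have hIntegral : IsIntegral ℤ r := by
    refine ⟨.X ^ 2 + (.C (-T) * .X + .C 1), ?_, ?_⟩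
    · monicity!
    · simp only [Polynomial.eval₂_add, Polynomial.eval₂_mul, Polynomial.eval₂_pow,
        Polynomial.eval₂_X, Polynomial.eval₂_C]
      simp
      linear_combination hr
  obtain ⟨n, rfl⟩ := IsIntegrallyClosed.isIntegral_iff.1 hIntegral
  have hn : n ^ 2 = -1 + T * n := by
    have : ((n : ℚ)) ^ 2 = -1 + (T : ℚ) * n := by simpa using hr
    exact_mod_cast this
  have h1 : n * (T - n) = 1 := by linear_combination -hn
  rcases Int.eq_one_or_neg_one_of_mul_eq_one h1 with rfl | rfl <;> omega

theorem irrational_quadraticUnit (hT : 3 ≤ T) : Irrational (quadraticUnit T) := by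
  rintro ⟨r, hr⟩
  have h := quadraticUnit_sq hT
  rw [← hr] at h
  refine (fact_sq_ne hT).out r ?_
  have : (r : ℝ) ^ 2 = -1 + (T : ℝ) * r := by rw [h]; ring
  exact_mod_cast this

theorem quadraticUnit_mem (T : ℤ) : ((quadraticUnit T : ℝ) : ℂ) ∈ quadraticUnitField T :=
  Subfield.subset_closure rfl

/-- The embedding of `ℚ[X] / (X ^ 2 - T * X + 1)` into `ℂ` given by `quadraticUnit T`. -/
noncomputable def quadraticUnitEmbedding (hT : 3 ≤ T) : QuadraticAlgebra ℚ (-1) (T : ℚ) →+* ℂ :=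
  (QuadraticAlgebra.lift ⟨((quadraticUnit T : ℝ) : ℂ), by
    have h := congrArg ((↑) : ℝ → ℂ) (quadraticUnit_sq hT)
    push_cast at h
    rw [Algebra.smul_def, Algebra.smul_def]
    simp
    linear_combination h⟩ : QuadraticAlgebra ℚ (-1) (T : ℚ) →ₐ[ℚ] ℂ).toRingHom

theorem quadraticUnitEmbedding_apply (hT : 3 ≤ T) (x : QuadraticAlgebra ℚ (-1) (T : ℚ)) :
    quadraticUnitEmbedding hT x = x.re + x.im * (quadraticUnit T : ℝ) := by
  simp [quadraticUnitEmbedding, Algebra.smul_def]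

theorem mem_quadraticUnitField_iff (hT : 3 ≤ T) {x : ℂ} :
    x ∈ quadraticUnitField T ↔ ∃ y, quadraticUnitEmbedding hT y = x := by
  have := fact_sq_ne hT
  constructor
  · have h : quadraticUnitField T ≤ (quadraticUnitEmbedding hT).fieldRange := by
      rw [quadraticUnitField, Subfield.closure_le, Set.singleton_subset_iff]
      exact ⟨QuadraticAlgebra.omega, by simp [quadraticUnitEmbedding_apply]⟩
    exact fun hx => h hx
  · rintro ⟨y, rfl⟩
    rw [quadraticUnitEmbedding_apply]
    exact add_mem (SubfieldClass.ratCast_mem _ _)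
      (mul_mem (SubfieldClass.ratCast_mem _ _) (quadraticUnit_mem T))

/-- `quadraticUnitField T` is isomorphic to `ℚ[X] / (X ^ 2 - T * X + 1)`. -/
noncomputable def quadraticUnitFieldEquiv (hT : 3 ≤ T) :
    QuadraticAlgebra ℚ (-1) (T : ℚ) ≃+* quadraticUnitField T :=
  RingEquiv.ofBijective ((quadraticUnitEmbedding hT).codRestrict (quadraticUnitField T)
      fun y => (mem_quadraticUnitField_iff hT).2 ⟨y, rfl⟩) (by
    have := fact_sq_ne hT
    refine ⟨RingHom.injective _, fun ⟨x, hx⟩ => ?_⟩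
    obtain ⟨y, rfl⟩ := (mem_quadraticUnitField_iff hT).1 hx
    exact ⟨y, rfl⟩)

theorem coe_quadraticUnitFieldEquiv (hT : 3 ≤ T) (x : QuadraticAlgebra ℚ (-1) (T : ℚ)) :
    (quadraticUnitFieldEquiv hT x : ℂ) = x.re + x.im * (quadraticUnit T : ℝ) :=
  quadraticUnitEmbedding_apply hT x

theorem exists_eq_add_mul_of_mem (hT : 3 ≤ T) {x : ℂ} (hx : x ∈ quadraticUnitField T) :
    ∃ a b : ℚ, x = a + b * (quadraticUnit T : ℝ) := by
  obtain ⟨y, rfl⟩ := (mem_quadraticUnitField_iff hT).1 hx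
  exact ⟨_, _, quadraticUnitEmbedding_apply hT y⟩

/-- `quadraticUnitFieldEquiv` as an isomorphism of `ℚ`-algebras. -/
noncomputable def quadraticUnitFieldAlgEquiv (hT : 3 ≤ T) :
    QuadraticAlgebra ℚ (-1) (T : ℚ) ≃ₐ[ℚ] quadraticUnitField T :=
  AlgEquiv.ofRingEquiv (f := quadraticUnitFieldEquiv hT) fun r => by
    have h : algebraMap ℚ (quadraticUnitField T) r = (r : quadraticUnitField T) := eq_ratCast _ r
    apply Subtype.ext
    rw [h, coe_quadraticUnitFieldEquiv, QuadraticAlgebra.algebraMap_eq]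
    simp

theorem finrank_quadraticUnitField (hT : 3 ≤ T) :
    Module.finrank ℚ (quadraticUnitField T) = 2 := by
  rw [← (quadraticUnitFieldAlgEquiv hT).toLinearEquiv.finrank_eq,
    QuadraticAlgebra.finrank_eq_two]

theorem numberField_quadraticUnitField (hT : 3 ≤ T) : NumberField (quadraticUnitField T) where
  to_charZero := inferInstance
  to_finiteDimensional := Module.finite_of_finrank_pos (by
    rw [finrank_quadraticUnitField hT]; norm_num)

theorem im_ringHom_quadraticUnitField (hT : 3 ≤ T) (φ : quadraticUnitField T →+* ℂ)
    (x : quadraticUnitField T) : (φ x).im = 0 := by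
  obtain ⟨a, b, hab⟩ := exists_eq_add_mul_of_mem hT x.2
  let u : quadraticUnitField T := ⟨_, quadraticUnit_mem T⟩
  have hx : x = a + b * u := Subtype.ext (by push_cast; exact hab)
  have h3 := three_le_cast hT
  have hu2 : ((quadraticUnit T : ℝ) : ℂ) ^ 2 = T * (quadraticUnit T : ℝ) - 1 := by
    exact_mod_cast quadraticUnit_sq hT
  have hu : u ^ 2 = T * u - 1 := Subtype.ext (by push_cast; exact hu2)
  have him : (φ u).im = 0 := by
    have h := congrArg φ hu
    simp only [map_pow, map_sub, map_mul, map_intCast, map_one] at h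
    have hre := congrArg Complex.re h
    have him := congrArg Complex.im h
    simp [sq] at hre him
    by_contra h0
    have h2 : 2 * (φ u).re = T := mul_right_cancel₀ h0 (by linear_combination him)
    nlinarith [sq_nonneg (φ u).im, mul_self_pos.2 h0]
  rw [hx]
  simp [him]

theorem quadraticUnitField_le_of_ringHom (hT : 3 ≤ T)
    (σ : quadraticUnitField T →+* quadraticUnitField T') :
    quadraticUnitField T ≤ quadraticUnitField T' := by
  conv_lhs => rw [quadraticUnitField]
  rw [Subfield.closure_le, Set.singleton_subset_iff, SetLike.mem_coe]
  let u : quadraticUnitField T := ⟨_, quadraticUnit_mem T⟩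
  have hu2 : ((quadraticUnit T : ℝ) : ℂ) ^ 2 = T * (quadraticUnit T : ℝ) - 1 := by
    exact_mod_cast quadraticUnit_sq hT
  have hu : u ^ 2 = T * u - 1 := Subtype.ext (by push_cast; exact hu2)
  have h := congrArg (fun y => ((σ y : quadraticUnitField T') : ℂ)) hu
  simp only [map_pow, map_sub, map_mul, map_intCast, map_one] at h
  push_cast at h
  have h' : ((quadraticUnit T : ℝ) - (σ u : ℂ)) * ((quadraticUnit T : ℝ) - (T - (σ u : ℂ))) = 0 := by
    linear_combination hu2 - h
  rcases mul_eq_zero.1 h' with h0 | h0 <;> rw [sub_eq_zero.1 h0]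
  · exact (σ u).2
  · exact sub_mem (intCast_mem _ _) (σ u).2

theorem quadraticUnitField_eq_of_ringEquiv (hT : 3 ≤ T) (hT' : 3 ≤ T')
    (h : Nonempty (quadraticUnitField T ≃+* quadraticUnitField T')) :
    quadraticUnitField T = quadraticUnitField T' := by
  obtain ⟨σ⟩ := h
  exact le_antisymm (quadraticUnitField_le_of_ringHom hT (σ : _ →+* _))
    (quadraticUnitField_le_of_ringHom hT' (σ.symm : _ →+* _))

theorem isIntegral_quadraticUnit (hT : 3 ≤ T) : IsIntegral ℤ (quadraticUnit T) := by
  refine ⟨.X ^ 2 + (.C (-T) * .X + .C 1), ?_, ?_⟩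
  · monicity!
  · simp only [Polynomial.eval₂_add, Polynomial.eval₂_mul, Polynomial.eval₂_pow,
      Polynomial.eval₂_X, Polynomial.eval₂_C]
    simp
    linear_combination quadraticUnit_sq hT

/-- Units of norm one of the same real quadratic field are far apart. -/
theorem two_mul_quadraticUnit_lt (hT : 3 ≤ T) (hTT' : T < T')
    (h : quadraticUnitField T = quadraticUnitField T') :
    2 * quadraticUnit T < quadraticUnit T' := by
  have hT' : 3 ≤ T' := hT.trans hTT'.le
  obtain ⟨x, y, hxy⟩ := exists_eq_add_mul_of_mem hT (h ▸ quadraticUnit_mem T')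
  have hxy : quadraticUnit T' = x + y * quadraticUnit T := by exact_mod_cast hxy
  have hirr := irrational_quadraticUnit hT
  have hirr' := irrational_quadraticUnit hT'
  have hlt := quadraticUnit_lt_quadraticUnit hT hTT'
  have h1 := one_lt_quadraticUnit hT
  have hI := isIntegral_quadraticUnit hT
  have hI' := isIntegral_quadraticUnit hT'
  have hsq := quadraticUnit_sq hT
  have hsq' := quadraticUnit_sq hT'
  set u := quadraticUnit T
  set v := quadraticUnit T'
  have hy : y ≠ 0 := by
    rintro rfl
    exact hirr' ⟨x, by rw [hxy]; simp⟩
  have htrace : 2 * x + y * T = T' := by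
    by_contra hne
    have hne' : y * (2 * x + y * T - T') ≠ 0 := mul_ne_zero hy (sub_ne_zero.2 hne)
    refine hirr ⟨(-(x ^ 2 - y ^ 2 - T' * x + 1)) / (y * (2 * x + y * T - T')), ?_⟩
    have hne'' : (y : ℝ) * (2 * x + y * T - T') ≠ 0 := by exact_mod_cast hne'
    push_cast
    rw [div_eq_iff hne'']
    rw [hxy] at hsq'
    linear_combination -hsq' + y ^ 2 * hsq
  have htrace' : 2 * (x : ℝ) + y * T = T' := by exact_mod_cast htrace
  have hq : v * (T - u) + (T' - v) * u = ((x * T + 2 * y : ℚ) : ℝ) := by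
    push_cast
    rw [← htrace', hxy]
    linear_combination (-2 * (y : ℝ)) * hsq
  have hIntegral : IsIntegral ℤ (x * T + 2 * y : ℚ) := by
    rw [← isIntegral_algebraMap_iff (algebraMap ℚ ℝ).injective, eq_ratCast, ← hq]
    have hc : ∀ n : ℤ, IsIntegral ℤ (n : ℝ) := fun n => isIntegral_algebraMap (A := ℝ) (x := n)
    exact (hI'.mul ((hc T).sub hI)).add (((hc T').sub hI').mul hI)
  obtain ⟨n, hn⟩ := IsIntegrallyClosed.isIntegral_iff.1 hIntegral
  rw [← hn] at hq
  have hq : v * (T - u) + (T' - v) * u = n := by simpa using hq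
  have hu0 : 0 < u := by linarith
  have hn' : u ^ 2 + v ^ 2 = n * (u * v) := by
    rw [← hq]
    linear_combination v ^ 2 * hsq + u ^ 2 * hsq'
  have h3 : (3 : ℝ) ≤ n := by
    have h2 : (2 : ℝ) < n := by
      by_contra! hle
      nlinarith [mul_pos hu0 (hu0.trans hlt), sq_pos_of_pos (sub_pos.2 hlt)]
    have : (2 : ℤ) < n := by exact_mod_cast h2
    exact_mod_cast this
  by_contra! hle
  nlinarith [mul_pos hu0 (hu0.trans hlt), mul_nonneg (sub_nonneg.2 hle) (sub_nonneg.2 hlt.le)]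

end

theorem isTotallyReal_quadraticUnitField {T : ℤ} (hT : 3 ≤ T)
    [NumberField (quadraticUnitField T)] : IsTotallyReal (quadraticUnitField T) where
  isReal v := by
    refine InfinitePlace.isReal_iff.2 (RingHom.ext fun x => ?_)
    exact Complex.conj_eq_iff_im.2 (im_ringHom_quadraticUnitField hT _ x)

theorem exists_ringOfIntegers_eq_omega {T : ℤ} (hT : 3 ≤ T)
    [NumberField (quadraticUnitField T)] :
    ∃ u : 𝓞 (quadraticUnitField T),
      (u : quadraticUnitField T) = quadraticUnitFieldAlgEquiv hT QuadraticAlgebra.omega ∧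
        u ^ 2 = T * u - 1 := by
  have h : (QuadraticAlgebra.omega : QuadraticAlgebra ℚ (-1) (T : ℚ)) ^ 2 =
      (T : QuadraticAlgebra ℚ (-1) (T : ℚ)) * QuadraticAlgebra.omega - 1 := by
    ext <;> simp [sq, QuadraticAlgebra.re_one, QuadraticAlgebra.im_one,
      QuadraticAlgebra.re_intCast, QuadraticAlgebra.im_intCast]
  have h' := congrArg (quadraticUnitFieldAlgEquiv hT) h
  simp only [map_pow, map_sub, map_mul, map_one, map_intCast] at h'
  have hIntegral : IsIntegral ℤ (quadraticUnitFieldAlgEquiv hT QuadraticAlgebra.omega) := by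
    refine ⟨.X ^ 2 + (.C (-T) * .X + .C 1), ?_, ?_⟩
    · monicity!
    · simp only [Polynomial.eval₂_add, Polynomial.eval₂_mul, Polynomial.eval₂_pow,
        Polynomial.eval₂_X, Polynomial.eval₂_C]
      simp
      linear_combination h'
  refine ⟨⟨_, hIntegral⟩, rfl, ?_⟩
  apply RingOfIntegers.ext
  simp only [map_sub, map_one]
  exact h'

theorem abs_discr_quadraticUnitField_le {T : ℤ} (hT : 3 ≤ T)
    [NumberField (quadraticUnitField T)] : |discr (quadraticUnitField T)| ≤ T ^ 2 - 4 := by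
  obtain ⟨u, hu, hu2⟩ := exists_ringOfIntegers_eq_omega hT
  have h4 : 0 < T ^ 2 - 4 := by nlinarith
  refine (abs_discr_le_of_quadratic (finrank_quadraticUnitField hT) hu2 ?_ h4.ne').trans
    (abs_of_pos h4).le
  rw [hu, Algebra.trace_eq_of_algEquiv, QuadraticAlgebra.algebraTrace_omega]

/-- Local conditions which force the class group of `quadraticUnitField T` to contain an element
of order `m`. -/
theorem exists_injective_zmod_classGroup {m : ℕ} (hm : 0 < m) {T t z : ℤ} (hT : 3 ≤ T) (hz : z ≠ 0)
    (hTz : t * T + t ^ 2 + 1 = z ^ m) (hcop : IsCoprime z (T + 2 * t))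
    {l₁ l₂ : ℕ} [Fact l₁.Prime] [Fact l₂.Prime]
    (hl₁ : 2 * m ∣ l₁ - 1) (hl₂ : 2 * m ∣ l₂ - 1) {g₁ g₂ : ℤ}
    (hroot₁ : (l₁ : ℤ) ∣ g₁ ^ 2 - T * g₁ + 1) (hsimple₁ : ¬(l₁ : ℤ) ∣ 2 * g₁ - T)
    (hg₁ : ∀ p, p.Prime → p ∣ m → (g₁ : ZMod l₁) ^ ((l₁ - 1) / p) ≠ 1)
    (ht₁ : (l₁ : ℤ) ∣ t)
    (hroot₂ : (l₂ : ℤ) ∣ g₂ ^ 2 - T * g₂ + 1) (hsimple₂ : ¬(l₂ : ℤ) ∣ 2 * g₂ - T)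
    (hg₂ : ∀ p, p.Prime → p ∣ m → (g₂ : ZMod l₂) ^ ((l₂ - 1) / p) ≠ 1)
    (ht₂ : (l₂ : ℤ) ∣ (t + g₂) * g₂ + 1)
    (hT₃ : (13 : ℤ) ∣ T - 1) (ht₃ : (13 : ℤ) ∣ t - 3) [NumberField (quadraticUnitField T)] :
    ∃ f : ZMod m →+ Additive (ClassGroup (𝓞 (quadraticUnitField T))), Function.Injective f := by
  have := isTotallyReal_quadraticUnitField hT
  obtain ⟨u, hu, hu2⟩ := exists_ringOfIntegers_eq_omega hT
  obtain ⟨ε, hε⟩ := IsTotallyReal.exists_unit_generator (quadraticUnitField T)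
    (finrank_quadraticUnitField hT)
  obtain ⟨φ₁, hφ₁⟩ := QuadraticAlgebra.exists_ringHom_zmod
    (quadraticUnitFieldAlgEquiv hT).toRingEquiv hu hroot₁ hsimple₁
  obtain ⟨φ₂, hφ₂⟩ := QuadraticAlgebra.exists_ringHom_zmod
    (quadraticUnitFieldAlgEquiv hT).toRingEquiv hu hroot₂ hsimple₂
  obtain ⟨φ₃, hφ₃⟩ := QuadraticAlgebra.exists_ringHom_zmod (l := 13) (g := 4)
    (quadraticUnitFieldAlgEquiv hT).toRingEquiv hu (by push_cast; omega) (by push_cast; omega)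
  let U : (𝓞 (quadraticUnitField T))ˣ :=
    ⟨u, T - u, by linear_combination -hu2, by linear_combination -hu2⟩
  have hmul : (u + t) * ((T - u) + t) = (z : 𝓞 (quadraticUnitField T)) ^ m := by
    have h := congrArg (Int.cast : ℤ → 𝓞 (quadraticUnitField T)) hTz
    push_cast at h
    linear_combination h - hu2
  have hcop' : IsCoprime (u + t) ((T - u) + t) := by
    obtain ⟨a, b, hab⟩ := hcop.pow_left (m := m)
    have h := congrArg (Int.cast : ℤ → 𝓞 (quadraticUnitField T)) hab
    push_cast at h
    exact ⟨a * ((T - u) + t) + b, b, by linear_combination h + a * hmul⟩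
  have hcast : ∀ {l : ℕ} {n : ℤ}, (l : ℤ) ∣ n → (n : ZMod l) = 0 :=
    fun h => (ZMod.intCast_zmod_eq_zero_iff_dvd _ _).2 h
  refine ClassGroup.exists_injective_zmod hm (z := (z : 𝓞 (quadraticUnitField T)))
    (by exact_mod_cast hz) hmul hcop' fun p hp hpm v β => ?_
  refine ne_unit_mul_pow_of_residues (u := U) hε hp ((Nat.mul_dvd_mul_left 2 hpm).trans hl₁)
    ((Nat.mul_dvd_mul_left 2 hpm).trans hl₂) φ₁ ?_ ?_ φ₂ ?_ ?_ φ₃ ?_ ?_ v β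
  · change φ₁ u ^ _ ≠ 1
    rw [hφ₁]
    exact hg₁ p hp hpm
  · change φ₁ (u + t) = φ₁ u
    rw [map_add, map_intCast, hcast ht₁, add_zero]
  · change φ₂ u ^ _ ≠ 1
    rw [hφ₂]
    exact hg₂ p hp hpm
  · change φ₂ (u + t) * φ₂ u = -1
    have h := hcast ht₂
    push_cast at h
    rw [map_add, map_intCast, hφ₂]
    linear_combination h
  · change φ₃ u = 4
    rw [hφ₃]
    rfl
  · have h := hcast (l := 13) ht₃
    push_cast at h
    change φ₃ (u + t) = 7
    rw [map_add, map_intCast, hφ₃]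
    push_cast
    linear_combination h

theorem Int.exists_ge_and_dvd_sub {a b : ℤ} (ha : 0 < a) (hb : 0 < b) (hab : IsCoprime a b)
    (r s B : ℤ) : ∃ x, B ≤ x ∧ a ∣ x - r ∧ b ∣ x - s := by
  obtain ⟨c, d, hcd⟩ := hab
  have hx : ∀ k, a ∣ r * (d * b) + s * (c * a) + a * b * k - r := fun k =>
    ⟨(s - r) * c + b * k, by linear_combination r * hcd⟩
  have hy : ∀ k, b ∣ r * (d * b) + s * (c * a) + a * b * k - s := fun k =>
    ⟨(r - s) * d + a * k, by linear_combination s * hcd⟩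
  refine ⟨_, ?_, hx (|B| + |r * (d * b) + s * (c * a)|), hy _⟩
  have h1 : 0 < a * b := mul_pos ha hb
  have h2 := le_abs_self B
  have h3 := neg_abs_le (r * (d * b) + s * (c * a))
  nlinarith [abs_nonneg B, abs_nonneg (r * (d * b) + s * (c * a))]

theorem ZMod.exists_primitive_root {l : ℕ} [Fact l.Prime] (hl : 3 < l) :
    ∃ g h : ℤ, (l : ℤ) ∣ g * h - 1 ∧ ¬(l : ℤ) ∣ g ^ 2 - 1 ∧
      ∀ p, p.Prime → p ∣ l - 1 → (g : ZMod l) ^ ((l - 1) / p) ≠ 1 := by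
  obtain ⟨x, hx⟩ := IsCyclic.exists_generator (α := (ZMod l)ˣ)
  have hord : orderOf x = l - 1 := by
    rw [orderOf_eq_card_of_forall_mem_zpowers hx, Nat.card_eq_fintype_card, ZMod.card_units]
  have hpow : ∀ n, 0 < n → n < l - 1 → (x : ZMod l) ^ n ≠ 1 := fun n hn hnl h =>
    pow_ne_one_of_lt_orderOf hn.ne' (hord ▸ hnl) (Units.ext (by simpa using h))
  refine ⟨(x : ZMod l).val, ((x⁻¹ : (ZMod l)ˣ) : ZMod l).val, ?_, ?_, fun p hp hpl => ?_⟩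
  · rw [← ZMod.intCast_zmod_eq_zero_iff_dvd]
    simp only [Int.cast_sub, Int.cast_mul, Int.cast_natCast, ZMod.natCast_zmod_val, Int.cast_one,
      Units.mul_inv, sub_self]
  · rw [← ZMod.intCast_zmod_eq_zero_iff_dvd]
    simpa [sub_eq_zero] using hpow 2 two_pos (by omega)
  · have h := hpow ((l - 1) / p) (Nat.div_pos (Nat.le_of_dvd (by omega) hpl) hp.pos)
      (Nat.div_lt_self (by omega) hp.one_lt)
    simpa using h

/-- The trace of the distinguished unit in the family of real quadratic fields under
consideration. -/
def familyTrace (m : ℕ) (w t : ℤ) : ℤ := w * ∑ i ∈ Finset.range m, (1 + w * t) ^ i - t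

theorem mul_familyTrace (m : ℕ) (w t : ℤ) :
    t * familyTrace m w t + t ^ 2 + 1 = (1 + w * t) ^ m := by
  have h := mul_geom_sum (1 + w * t) m
  rw [familyTrace]
  linear_combination h

theorem dvd_familyTrace_sub {m : ℕ} {l w t : ℤ} (h : l ∣ t) : l ∣ familyTrace m w t - m * w := by
  have hz : l ∣ ∑ i ∈ Finset.range m, (1 + w * t) ^ i - m := by
    have : ∑ i ∈ Finset.range m, (1 + w * t) ^ i - m =
        ∑ i ∈ Finset.range m, ((1 + w * t) ^ i - 1 ^ i) := by simp
    rw [this]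
    refine Finset.dvd_sum fun i _ => dvd_trans ?_ (sub_dvd_pow_sub_pow _ _ i)
    simpa using h.mul_left w
  have : familyTrace m w t - m * w =
      w * (∑ i ∈ Finset.range m, (1 + w * t) ^ i - m) - t := by rw [familyTrace]; ring
  rw [this]
  exact dvd_sub (hz.mul_left w) h

theorem dvd_familyTrace_add {m : ℕ} {l w t : ℤ} (h : l ∣ w) : l ∣ familyTrace m w t + t := by
  rw [familyTrace, sub_add_cancel]
  exact h.mul_right _

theorem dvd_familyTrace_sub_of_dvd_one_add {m : ℕ} (hm : 0 < m) {l w t : ℤ}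
    (h : l ∣ 1 + w * t) : l ∣ familyTrace m w t - (w - t) := by
  obtain ⟨n, rfl⟩ := Nat.exists_eq_add_of_lt hm
  have : familyTrace (0 + n + 1) w t - (w - t) =
      w * ∑ i ∈ Finset.range n, (1 + w * t) ^ (i + 1) := by
    rw [familyTrace, zero_add, Finset.sum_range_succ']
    ring
  rw [this]
  exact (Finset.dvd_sum fun i _ => h.trans (dvd_pow_self _ i.succ_ne_zero)).mul_left w

theorem isCoprime_familyTrace {m : ℕ} (hm : 0 < m) {w t : ℤ} (h : w ^ 2 - 1 ∣ t) :
    IsCoprime (1 + w * t) (familyTrace m w t + 2 * t) := by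
  obtain ⟨k, hk⟩ := dvd_familyTrace_sub_of_dvd_one_add hm (dvd_refl (1 + w * t))
  obtain ⟨s, hs⟩ := h
  refine IsCoprime.of_mul_right_right (y := w) ⟨1 + s * w * (w * k + 1), -(s * w), ?_⟩
  linear_combination (-(s * w ^ 2)) * hk + w * hs

theorem three_le_familyTrace {m : ℕ} (hm : 1 < m) {w t : ℤ} (hw : 2 ≤ w) (ht : 1 ≤ t) :
    3 ≤ familyTrace m w t := by
  have hz : 0 ≤ 1 + w * t := by positivity
  have h : ∑ i ∈ Finset.range 2, (1 + w * t) ^ i ≤ ∑ i ∈ Finset.range m, (1 + w * t) ^ i :=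
    Finset.sum_le_sum_of_subset_of_nonneg (Finset.range_mono hm) fun i _ _ => pow_nonneg hz i
  simp only [Finset.sum_range_succ, Finset.sum_range_zero, pow_zero, pow_one, zero_add] at h
  have h' := mul_le_mul_of_nonneg_left h (by omega : 0 ≤ w)
  rw [familyTrace]
  nlinarith

/-- A progression of parameters for which the class group of the corresponding quadratic field
has an element of order `m`. -/
theorem exists_progression {m : ℕ} (hm : 1 < m) :
    ∃ w t₀ M : ℤ, 2 ≤ w ∧ 1 ≤ t₀ ∧ 1 ≤ M ∧ ∀ t, 1 ≤ t → M ∣ t - t₀ →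
      ∀ [NumberField (quadraticUnitField (familyTrace m w t))],
        ∃ f : ZMod m →+ Additive (ClassGroup (𝓞 (quadraticUnitField (familyTrace m w t)))),
          Function.Injective f := by
  have hm0 : 4 * m ≠ 0 := by omega
  have hdvd : ∀ {l : ℕ}, 13 < l → l ≡ 1 [MOD 4 * m] → 2 * m ∣ l - 1 := fun hl h =>
    dvd_trans ⟨2, by ring⟩ ((Nat.modEq_iff_dvd' (by omega)).1 h.symm)
  obtain ⟨l₁, hp₁, hl₁, hmod₁⟩ := Nat.exists_prime_gt_modEq_one 13 hm0
  obtain ⟨l₂, hp₂, hl₂, hmod₂⟩ := Nat.exists_prime_gt_modEq_one l₁ hm0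
  have hm₁ := hdvd hl₁ hmod₁
  have hm₂ := hdvd (hl₁.trans hl₂) hmod₂
  have : Fact l₁.Prime := ⟨hp₁⟩
  have : Fact l₂.Prime := ⟨hp₂⟩
  obtain ⟨g₁, h₁, hgh₁, hsq₁, hg₁⟩ := ZMod.exists_primitive_root (l := l₁) (by omega)
  obtain ⟨g₂, h₂, hgh₂, hsq₂, hg₂⟩ := ZMod.exists_primitive_root (l := l₂) (by omega)
  have hl₁₂ : IsCoprime (l₁ : ℤ) l₂ := Nat.isCoprime_iff_coprime.2
    ((Nat.coprime_primes hp₁ hp₂).2 hl₂.ne)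
  have h13₁ : IsCoprime (13 : ℤ) l₁ := Nat.isCoprime_iff_coprime.2
    ((Nat.coprime_primes Fact.out hp₁).2 hl₁.ne)
  have h13₂ : IsCoprime (13 : ℤ) l₂ := Nat.isCoprime_iff_coprime.2
    ((Nat.coprime_primes Fact.out hp₂).2 (hl₁.trans hl₂).ne)
  have hl₁0 : (0 : ℤ) < l₁ := by exact_mod_cast hp₁.pos
  have hl₂0 : (0 : ℤ) < l₂ := by exact_mod_cast hp₂.pos
  obtain ⟨n, hn⟩ : ∃ n : ℤ, (l₁ : ℤ) ∣ m * n - 1 := by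
    obtain ⟨k, hk⟩ := hm₁
    refine ⟨-(2 * k), -1, ?_⟩
    have : (l₁ : ℤ) = 2 * m * k + 1 := by
      have : l₁ = 2 * m * k + 1 := by omega
      exact_mod_cast this
    rw [this]
    ring
  obtain ⟨w', -, hw'₁, hw'₂⟩ := Int.exists_ge_and_dvd_sub (by norm_num) hl₁0 h13₁ 4
    (n * (g₁ + h₁)) 0
  obtain ⟨w, hw2, hww', hw₂⟩ := Int.exists_ge_and_dvd_sub (by positivity) hl₂0
    (h13₂.mul_left hl₁₂) w' 0 2
  have hw13 : (13 : ℤ) ∣ w - 4 := by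
    simpa using dvd_add (dvd_of_mul_right_dvd hww') hw'₁
  have hw₁ : (l₁ : ℤ) ∣ w - n * (g₁ + h₁) := by
    simpa using dvd_add (dvd_of_mul_left_dvd hww') hw'₂
  rw [sub_zero] at hw₂
  have hw0 : 0 < w ^ 2 - 1 := by nlinarith
  obtain ⟨t', -, ht'₁, ht'₂⟩ := Int.exists_ge_and_dvd_sub (by norm_num) hl₂0 h13₂ 3
    (-(g₂ + h₂)) 0
  have hc : IsCoprime (13 * l₂ : ℤ) (l₁ * (w ^ 2 - 1)) := by
    refine (h13₁.mul_left hl₁₂.symm).mul_right (IsCoprime.mul_left ?_ ?_)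
    · obtain ⟨k, hk⟩ := hw13
      refine ⟨-8 - 7 * (13 * k ^ 2 + 8 * k), 7, ?_⟩
      rw [sub_eq_iff_eq_add.1 hk]
      ring
    · obtain ⟨k, hk⟩ := hw₂
      exact ⟨k * w, -1, by rw [hk]; ring⟩
  obtain ⟨t₀, ht₀, ht₀', ht₀₁⟩ := Int.exists_ge_and_dvd_sub (by positivity)
    (mul_pos hl₁0 hw0) hc t' 0 1
  refine ⟨w, t₀, 13 * l₂ * (l₁ * (w ^ 2 - 1)), hw2, ht₀,
    Int.add_one_le_of_lt (mul_pos (by positivity) (mul_pos hl₁0 hw0)),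
    fun t ht htM _ => ?_⟩
  have htt' : 13 * (l₂ : ℤ) ∣ t - t' := by
    simpa using dvd_add (dvd_of_mul_right_dvd htM) ht₀'
  have ht13 : (13 : ℤ) ∣ t - 3 := by
    simpa using dvd_add (dvd_of_mul_right_dvd htt') ht'₁
  have ht₂ : (l₂ : ℤ) ∣ t + (g₂ + h₂) := by
    have : t + (g₂ + h₂) = t - t' + (t' - -(g₂ + h₂)) := by ring
    rw [this]
    exact dvd_add (dvd_of_mul_left_dvd htt') ht'₂
  have ht₁w : (l₁ : ℤ) * (w ^ 2 - 1) ∣ t := by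
    simpa using dvd_add (dvd_of_mul_left_dvd htM) ht₀₁
  have ht₁ : (l₁ : ℤ) ∣ t := dvd_of_mul_right_dvd ht₁w
  have hT₁ : (l₁ : ℤ) ∣ familyTrace m w t - (g₁ + h₁) := by
    have : familyTrace m w t - (g₁ + h₁) = (familyTrace m w t - m * w) +
        m * (w - n * (g₁ + h₁)) + (m * n - 1) * (g₁ + h₁) := by ring
    rw [this]
    exact dvd_add (dvd_add (dvd_familyTrace_sub ht₁) (hw₁.mul_left _)) (hn.mul_right _)
  have hT₂ : (l₂ : ℤ) ∣ familyTrace m w t - (g₂ + h₂) := by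
    have : familyTrace m w t - (g₂ + h₂) = familyTrace m w t + t - (t + (g₂ + h₂)) := by ring
    rw [this]
    exact dvd_sub (dvd_familyTrace_add hw₂) ht₂
  have hT13 : (13 : ℤ) ∣ familyTrace m w t - 1 := by
    have h : (13 : ℤ) ∣ 1 + w * t := by
      obtain ⟨a, ha⟩ := hw13
      obtain ⟨b, hb⟩ := ht13
      exact ⟨1 + 3 * a + 4 * b + 13 * a * b,
        by rw [sub_eq_iff_eq_add.1 ha, sub_eq_iff_eq_add.1 hb]; ring⟩
    have h' := dvd_familyTrace_sub_of_dvd_one_add (by omega : 0 < m) h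
    omega
  have hroot : ∀ {l g h T : ℤ}, l ∣ g * h - 1 → l ∣ T - (g + h) → l ∣ g ^ 2 - T * g + 1 := by
    rintro l g h T ⟨a, ha⟩ ⟨b, hb⟩
    exact ⟨-b * g - a, by linear_combination (-g) * hb - ha⟩
  have hsimple : ∀ {l g h T : ℤ}, l ∣ g * h - 1 → ¬l ∣ g ^ 2 - 1 → l ∣ T - (g + h) →
      ¬l ∣ 2 * g - T := by
    rintro l g h T ⟨a, ha⟩ h0 ⟨b, hb⟩ ⟨c, hc⟩
    exact h0 ⟨a + g * b + g * c, by linear_combination ha + g * hb + g * hc⟩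
  refine exists_injective_zmod_classGroup (by omega) (three_le_familyTrace hm hw2 ht)
    (z := 1 + w * t) (by positivity) (mul_familyTrace m w t)
    (isCoprime_familyTrace (by omega) (dvd_of_mul_left_dvd ht₁w)) hm₁ hm₂
    (hroot hgh₁ hT₁) (hsimple hgh₁ hsq₁ hT₁)
    (fun p hp hpm => hg₁ p hp (hpm.trans (dvd_of_mul_left_dvd hm₁))) ht₁
    (hroot hgh₂ hT₂) (hsimple hgh₂ hsq₂ hT₂)
    (fun p hp hpm => hg₂ p hp (hpm.trans (dvd_of_mul_left_dvd hm₂))) ?_ hT13 ht13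
  have : (t + g₂) * g₂ + 1 = (t + (g₂ + h₂)) * g₂ - (g₂ * h₂ - 1) := by ring
  rw [this]
  exact dvd_sub (ht₂.mul_right _) hgh₂

theorem familyTrace_strictMonoOn {m : ℕ} (hm : 1 < m) {w : ℤ} (hw : 2 ≤ w) :
    StrictMonoOn (familyTrace m w) (Set.Ici 0) := by
  intro t ht t' ht' htt'
  rw [Set.mem_Ici] at ht ht'
  have hz : 0 ≤ 1 + w * t := by positivity
  have hzz' : 1 + w * t ≤ 1 + w * t' := by nlinarith
  have h : ∑ i ∈ Finset.range 2, ((1 + w * t') ^ i - (1 + w * t) ^ i) ≤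
      ∑ i ∈ Finset.range m, ((1 + w * t') ^ i - (1 + w * t) ^ i) :=
    Finset.sum_le_sum_of_subset_of_nonneg (Finset.range_mono hm) fun i _ _ =>
      sub_nonneg.2 (pow_le_pow_left₀ hz hzz' i)
  rw [Finset.sum_sub_distrib (s := Finset.range m)] at h
  simp only [Finset.sum_range_succ, Finset.sum_range_zero, pow_zero, pow_one, zero_add,
    sub_self] at h
  have h' := mul_le_mul_of_nonneg_left h (by omega : 0 ≤ w)
  rw [familyTrace, familyTrace]
  nlinarith

theorem familyTrace_le {m : ℕ} {w t : ℤ} (hw : 0 ≤ w) (ht : 0 ≤ t) :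
    familyTrace m w t ≤ w * (m * (1 + w * t) ^ (m - 1)) := by
  have hz : 1 ≤ 1 + w * t := by nlinarith [mul_nonneg hw ht]
  have h : ∑ i ∈ Finset.range m, (1 + w * t) ^ i ≤ m * (1 + w * t) ^ (m - 1) := by
    simpa using Finset.sum_le_card_nsmul (Finset.range m) (fun i => (1 + w * t) ^ i) _
      fun i hi => pow_le_pow_right₀ hz (Nat.le_sub_one_of_lt (Finset.mem_range.1 hi))
  have h' := mul_le_mul_of_nonneg_left h hw
  rw [familyTrace]
  linarith

theorem exists_familyTrace_le (m : ℕ) {w t₀ M : ℤ} (hw : 0 ≤ w) (ht₀ : 0 ≤ t₀) (hM : 0 ≤ M) :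
    ∃ A : ℝ, 1 ≤ A ∧ ∀ N j : ℕ, j < N →
      (familyTrace m w (t₀ + M * j) : ℝ) ≤ A * (N : ℝ) ^ (m - 1) := by
  refine ⟨w * (m * (1 + w * (t₀ + M)) ^ (m - 1)) + 1, ?_, fun N j hj => ?_⟩
  · have : (0 : ℝ) ≤ w := by exact_mod_cast hw
    have : (0 : ℝ) ≤ t₀ := by exact_mod_cast ht₀
    have : (0 : ℝ) ≤ M := by exact_mod_cast hM
    simp only [le_add_iff_nonneg_left]
    positivity
  · have hj' : (j : ℤ) + 1 ≤ N := by exact_mod_cast hj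
    have hj0 : (0 : ℤ) ≤ j := by positivity
    have h1 : 1 + w * (t₀ + M * j) ≤ (1 + w * (t₀ + M)) * N := by
      have h2 : t₀ + M * j ≤ (t₀ + M) * N := by nlinarith
      nlinarith
    have h0 : 0 ≤ 1 + w * (t₀ + M * j) := by positivity
    have h : familyTrace m w (t₀ + M * j) ≤
        (w * (m * (1 + w * (t₀ + M)) ^ (m - 1)) + 1) * (N : ℤ) ^ (m - 1) := calc
      _ ≤ w * (m * (1 + w * (t₀ + M * j)) ^ (m - 1)) := familyTrace_le hw (by positivity)
      _ ≤ w * (m * ((1 + w * (t₀ + M)) * N) ^ (m - 1)) := by gcongr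
      _ = w * (m * (1 + w * (t₀ + M)) ^ (m - 1)) * (N : ℤ) ^ (m - 1) := by rw [mul_pow]; ring
      _ ≤ _ := by
        have : (0 : ℤ) ≤ (N : ℤ) ^ (m - 1) := by positivity
        linarith
    exact_mod_cast h

open Classical in
theorem le_mul_card_image_quadraticUnitField {T : ℕ → ℤ} (hT : StrictMono T) (hT3 : ∀ j, 3 ≤ T j)
    {N : ℕ} {X : ℝ} (hX : ∀ j < N, (T j : ℝ) ≤ X) :
    N ≤ (⌊Real.logb 2 X⌋₊ + 1) *
      ((Finset.range N).image fun j => quadraticUnitField (T j)).card := by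
  have hlog : ∀ j, 0 ≤ Real.logb 2 (quadraticUnit (T j)) := fun j =>
    Real.logb_nonneg one_lt_two (one_lt_quadraticUnit (hT3 j)).le
  have hne : ∀ i j, i < j → quadraticUnitField (T i) = quadraticUnitField (T j) →
      ⌊Real.logb 2 (quadraticUnit (T i))⌋₊ ≠ ⌊Real.logb 2 (quadraticUnit (T j))⌋₊ := by
    intro i j hij h heq
    have h1 := one_lt_quadraticUnit (hT3 i)
    have h2 := Real.logb_lt_logb one_lt_two (by linarith)
      (two_mul_quadraticUnit_lt (hT3 i) (hT hij) h)
    rw [Real.logb_mul two_ne_zero (by linarith), Real.logb_self_eq_one one_lt_two] at h2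
    have h3 := Nat.floor_le (hlog i)
    have h4 := Nat.lt_floor_add_one (Real.logb 2 (quadraticUnit (T j)))
    rw [← heq] at h4
    linarith
  nth_rewrite 1 [← Finset.card_range N]
  refine Finset.card_le_mul_card_image _ _ fun K _ => ?_
  rw [← Finset.card_range (⌊Real.logb 2 X⌋₊ + 1)]
  refine Finset.card_le_card_of_injOn (fun j => ⌊Real.logb 2 (quadraticUnit (T j))⌋₊)
    (fun j hj => ?_) fun i hi j hj hij => ?_
  · have hj' := Finset.mem_range.1 (Finset.mem_filter.1 hj).1
    have h1 := one_lt_quadraticUnit (hT3 j)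
    exact Finset.mem_coe.2 (Finset.mem_range_succ_iff.2 (Nat.floor_mono
      (Real.logb_le_logb_of_le one_lt_two (by linarith)
        ((quadraticUnit_le (hT3 j)).trans (hX j hj')))))
  · have h := (Finset.mem_filter.1 hi).2.trans (Finset.mem_filter.1 hj).2.symm
    rcases lt_trichotomy i j with hlt | rfl | hlt
    · exact absurd hij (hne i j hlt h)
    · rfl
    · exact absurd hij.symm (hne j i hlt h.symm)

theorem floor_logb_two_add_one_le {X : ℝ} (hX : 3 ≤ X) :
    (⌊Real.logb 2 X⌋₊ : ℝ) + 1 ≤ 3 * Real.log X := by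
  have h1 : 1 ≤ Real.log X := by
    rw [Real.le_log_iff_exp_le (by linarith)]
    linarith [Real.exp_one_lt_d9]
  have h2 := Nat.floor_le (Real.logb_nonneg one_lt_two (by linarith : 1 ≤ X))
  have h3 : Real.logb 2 X ≤ 2 * Real.log X := by
    rw [Real.logb, div_le_iff₀ (Real.log_pos one_lt_two)]
    nlinarith [Real.log_two_gt_d9]
  linarith

/-- Let `m > 1`. There are `≫ X^(1/(2m−1))/log X` real quadratic fields `k` with `|Disc(k)| < X` and `rank_m Cl(k) ≥ 1`. -/
theorem yamamoto_real_quantitative (m : ℕ) (hm : 1 < m) :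
    ∃ c : ℝ, 0 < c ∧ ∃ X₀ : ℝ, ∀ X : ℝ, X₀ ≤ X →
      ∃ S : Finset (Subfield ℂ),
        -- the fields in `S` are pairwise non-isomorphic
        (∀ K ∈ S, ∀ L ∈ S, Nonempty (↥K ≃+* ↥L) → K = L) ∧
        (∀ K ∈ S,
          -- `K` is a quadratic field of the prescribed signature
          Module.finrank ℚ ↥K = 2 ∧
          (∀ φ : ↥K →+* ℂ, ∀ a : ↥K, (φ a).im = 0) ∧
          NumberField ↥K ∧
          (∀ [NumberField ↥K],
            -- `|Disc K| < X`
            |(NumberField.discr ↥K : ℝ)| < X ∧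
            -- the `m`-rank condition on the class group
            ∃ f : (ZMod m) →+ Additive (ClassGroup (𝓞 ↥K)), Function.Injective f)) ∧
        c * X ^ (1 / (2 * (m : ℝ) - 1)) / Real.log X ≤ S.card := by
  classical
  obtain ⟨w, t₀, M, hw, ht₀, hM, hrank⟩ := exists_progression hm
  obtain ⟨A, hA, hTA⟩ := exists_familyTrace_le m (by omega : 0 ≤ w) (by omega : 0 ≤ t₀)
    (by omega : 0 ≤ M)
  have ht : ∀ j : ℕ, 1 ≤ t₀ + M * j := fun j =>
    le_add_of_le_of_nonneg ht₀ (by positivity)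
  have hT3 : ∀ j : ℕ, 3 ≤ familyTrace m w (t₀ + M * j) := fun j =>
    three_le_familyTrace hm hw (ht j)
  have hmono : StrictMono fun j : ℕ => familyTrace m w (t₀ + M * j) := fun i j hij =>
    familyTrace_strictMonoOn hm hw (zero_le_one.trans (ht i)) (zero_le_one.trans (ht j)) (by
      have : (i : ℤ) < j := by exact_mod_cast hij
      nlinarith)
  refine ⟨1 / 6, by norm_num, 3 + (A ^ 2 + 2) ^ (2 * m - 1), fun X hX => ?_⟩
  have hX3 : 3 ≤ X := le_trans (le_add_of_nonneg_right (by positivity)) hX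
  have hk : (2 * (m : ℝ) - 1) = ((2 * m - 1 : ℕ) : ℝ) := by
    rw [Nat.cast_sub (by omega)]
    push_cast
    rfl
  rw [hk, one_div ((2 * m - 1 : ℕ) : ℝ)]
  set Y := X ^ (((2 * m - 1 : ℕ) : ℝ)⁻¹)
  have hYX : Y ^ (2 * m - 1) = X := Real.rpow_inv_natCast_pow (by linarith) (by omega)
  have hY0 : 0 ≤ Y := Real.rpow_nonneg (by linarith) _
  have hYA : A ^ 2 + 2 ≤ Y := by
    by_contra! h
    have := pow_le_pow_left₀ hY0 h.le (2 * m - 1)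
    linarith
  have hN := Nat.floor_le hY0
  have hN' := Nat.lt_floor_add_one Y
  set N := ⌊Y⌋₊
  have hsq : ∀ j < N, (familyTrace m w (t₀ + M * j) : ℝ) ^ 2 < X := by
    intro j hj
    have hN0 : (0 : ℝ) < N := by exact_mod_cast (Nat.zero_le j).trans_lt hj
    have h3 := three_le_cast (hT3 j)
    calc (familyTrace m w (t₀ + M * j) : ℝ) ^ 2 ≤ (A * (N : ℝ) ^ (m - 1)) ^ 2 :=
          pow_le_pow_left₀ (by linarith) (hTA N j hj) 2
      _ = A ^ 2 * (N : ℝ) ^ (2 * m - 2) := by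
          rw [mul_pow, ← pow_mul, show (m - 1) * 2 = 2 * m - 2 by omega]
      _ < N * (N : ℝ) ^ (2 * m - 2) := by
          gcongr
          linarith
      _ = (N : ℝ) ^ (2 * m - 1) := by
          rw [← pow_succ', show 2 * m - 2 + 1 = 2 * m - 1 by omega]
      _ ≤ Y ^ (2 * m - 1) := by gcongr
      _ = X := hYX
  refine ⟨(Finset.range N).image fun j : ℕ => quadraticUnitField (familyTrace m w (t₀ + M * j)),
    ?_, ?_, ?_⟩
  · simp only [Finset.mem_image]
    rintro _ ⟨i, -, rfl⟩ _ ⟨j, -, rfl⟩ h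
    exact quadraticUnitField_eq_of_ringEquiv (hT3 i) (hT3 j) h
  · simp only [Finset.mem_image, Finset.mem_range]
    rintro _ ⟨j, hj, rfl⟩
    refine ⟨finrank_quadraticUnitField (hT3 j), im_ringHom_quadraticUnitField (hT3 j),
      numberField_quadraticUnitField (hT3 j), fun {_} => ⟨?_, hrank _ (ht j) ⟨j, by ring⟩⟩⟩
    have h : ((|discr (quadraticUnitField (familyTrace m w (t₀ + M * j)))| : ℤ) : ℝ) ≤
        ((familyTrace m w (t₀ + M * j) ^ 2 - 4 : ℤ) : ℝ) :=
      Int.cast_le.2 (abs_discr_quadraticUnitField_le (hT3 j))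
    push_cast at h
    linarith [hsq j hj]
  · have h := le_mul_card_image_quadraticUnitField hmono hT3 (N := N) (X := X) fun j hj => by
      have h3 := three_le_cast (hT3 j)
      nlinarith [hsq j hj]
    set n := ((Finset.range N).image
      fun j : ℕ => quadraticUnitField (familyTrace m w (t₀ + M * j))).card
    have h' : (N : ℝ) ≤ (⌊Real.logb 2 X⌋₊ + 1) * n := by exact_mod_cast h
    have hlog := mul_le_mul_of_nonneg_right (floor_logb_two_add_one_le hX3) (n.cast_nonneg (α := ℝ))
    rw [div_le_iff₀ (Real.log_pos (by linarith))]
    nlinarith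
end

section
/- There is a constant c > 0 such that for all sufficiently large X, the number of isomorphism classes of imaginary quadratic fields k with |Disc(k)| < X and rank_3 Cl(k) ≥ 4 is at least c·X^(1/141)/log X. -/
open NumberField

theorem ofReal_sqrt_natCast_sq (m : ℕ) : ((√(m : ℝ) : ℝ) : ℂ) ^ 2 = m := by
  rw [← Complex.ofReal_pow, Real.sq_sqrt (Nat.cast_nonneg m)]; simp

/-- The imaginary quadratic field `ℚ(√-m)` inside `ℂ`. -/
def imagQuadField (m : ℕ) : Subfield ℂ where
  carrier := {z | ∃ a b : ℚ, z = a + b * (Complex.I * (√(m : ℝ) : ℝ))}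
  zero_mem' := ⟨0, 0, by simp⟩
  one_mem' := ⟨1, 0, by simp⟩
  add_mem' := by
    rintro _ _ ⟨a, b, rfl⟩ ⟨a', b', rfl⟩
    exact ⟨a + a', b + b', by push_cast; ring⟩
  neg_mem' := by
    rintro _ ⟨a, b, rfl⟩
    exact ⟨-a, -b, by push_cast; ring⟩
  mul_mem' := by
    rintro _ _ ⟨a, b, rfl⟩ ⟨a', b', rfl⟩
    refine ⟨a * a' - b * b' * m, a * b' + b * a', ?_⟩
    push_cast
    linear_combination (-(b : ℂ) * b') * ofReal_sqrt_natCast_sq m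
      + (b : ℂ) * b' * ((√(m : ℝ) : ℝ) : ℂ) ^ 2 * Complex.I_sq
  inv_mem' := by
    rintro _ ⟨a, b, rfl⟩
    refine ⟨a / (a ^ 2 + b ^ 2 * m), -b / (a ^ 2 + b ^ 2 * m), ?_⟩
    have hn : Complex.normSq (a + b * (Complex.I * (√(m : ℝ) : ℝ))) = a ^ 2 + b ^ 2 * m := by
      have h := Real.sq_sqrt (Nat.cast_nonneg (α := ℝ) m)
      simp only [Complex.normSq_apply, Complex.add_re, Complex.add_im, Complex.mul_re,
        Complex.mul_im, Complex.I_re, Complex.I_im, Complex.ofReal_re, Complex.ofReal_im,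
        Complex.ratCast_re, Complex.ratCast_im]
      linear_combination (b : ℝ) ^ 2 * h
    rw [Complex.inv_def, hn]
    simp only [map_add, map_mul, Complex.conj_I, Complex.conj_ofReal, map_ratCast]
    push_cast
    ring

namespace imagQuadField

variable {m : ℕ}

/-- The generator `√-m`. -/
noncomputable def root (m : ℕ) : imagQuadField m :=
  ⟨Complex.I * (√(m : ℝ) : ℝ), 0, 1, by simp⟩

theorem coe_root (m : ℕ) : (root m : ℂ) = Complex.I * (√(m : ℝ) : ℝ) := rfl

theorem root_sq (m : ℕ) : root m ^ 2 = -(m : imagQuadField m) := by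
  ext
  push_cast
  rw [coe_root]
  linear_combination ((√(m : ℝ) : ℝ) : ℂ) ^ 2 * Complex.I_sq - ofReal_sqrt_natCast_sq m

theorem exists_eq_add_mul_root (z : imagQuadField m) : ∃ a b : ℚ, z = a + b * root m := by
  obtain ⟨a, b, h⟩ := z.2
  exact ⟨a, b, Subtype.ext (by push_cast; exact h)⟩

theorem re_add_mul_root (a b : ℚ) : ((a + b * root m : imagQuadField m) : ℂ).re = a := by
  push_cast
  simp [coe_root]

theorem im_add_mul_root (a b : ℚ) :
    ((a + b * root m : imagQuadField m) : ℂ).im = b * √(m : ℝ) := by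
  push_cast
  simp [coe_root]

theorem add_mul_root_inj (hm : 0 < m) {a b a' b' : ℚ}
    (h : (a + b * root m : imagQuadField m) = a' + b' * root m) : a = a' ∧ b = b' := by
  have hs : √(m : ℝ) ≠ 0 := (Real.sqrt_pos.mpr (by exact_mod_cast hm)).ne'
  have h1 := congrArg (fun z : imagQuadField m ↦ (z : ℂ).re) h
  have h2 := congrArg (fun z : imagQuadField m ↦ (z : ℂ).im) h
  simp only [re_add_mul_root, im_add_mul_root] at h1 h2
  exact ⟨by exact_mod_cast h1, by exact_mod_cast mul_right_cancel₀ hs h2⟩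

/-- Coordinates with respect to `1, √-m`. -/
noncomputable def linearEquiv (hm : 0 < m) : (Fin 2 → ℚ) ≃ₗ[ℚ] imagQuadField m :=
  LinearEquiv.ofBijective
    { toFun := fun v ↦ v 0 + v 1 * root m
      map_add' := fun v w ↦ by simp only [Pi.add_apply]; push_cast; ring
      map_smul' := fun r v ↦ by
        simp only [Pi.smul_apply, smul_eq_mul, Algebra.smul_def, eq_ratCast]
        push_cast
        ring }
    ⟨fun v w h ↦ by
      obtain ⟨h0, h1⟩ := add_mul_root_inj hm h
      ext i
      fin_cases i <;> assumption,
    fun z ↦ by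
      obtain ⟨a, b, h⟩ := exists_eq_add_mul_root z
      exact ⟨![a, b], h.symm⟩⟩

/-- The basis `1, √-m`. -/
noncomputable def basis (hm : 0 < m) : Module.Basis (Fin 2) ℚ (imagQuadField m) :=
  .ofEquivFun (linearEquiv hm).symm

theorem linearEquiv_apply (hm : 0 < m) (v : Fin 2 → ℚ) :
    linearEquiv hm v = v 0 + v 1 * root m := rfl

theorem basis_repr_add_mul_root (hm : 0 < m) (a b : ℚ) :
    ⇑((basis hm).repr (a + b * root m)) = ![a, b] := by
  have : (a + b * root m : imagQuadField m) = linearEquiv hm ![a, b] := rfl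
  rw [← Module.Basis.equivFun_apply, basis, Module.Basis.equivFun_ofEquivFun, this,
    LinearEquiv.symm_apply_apply]

theorem basis_zero (hm : 0 < m) : basis hm 0 = 1 := by
  rw [basis, Module.Basis.coe_ofEquivFun]
  simp [linearEquiv_apply]

theorem basis_one (hm : 0 < m) : basis hm 1 = root m := by
  rw [basis, Module.Basis.coe_ofEquivFun]
  simp [linearEquiv_apply]

theorem finrank_eq_two (hm : 0 < m) : Module.finrank ℚ (imagQuadField m) = 2 := by
  simp [Module.finrank_eq_card_basis (basis hm)]

theorem numberField (hm : 0 < m) : NumberField (imagQuadField m) where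
  to_charZero := inferInstance
  to_finiteDimensional := .of_finrank_pos (by simp [finrank_eq_two hm])

theorem exists_im_ne_zero (hm : 0 < m) (φ : imagQuadField m →+* ℂ) :
    ∃ a, (φ a).im ≠ 0 := by
  refine ⟨root m, fun h ↦ ?_⟩
  have h2 : φ (root m) ^ 2 = -(m : ℂ) := by rw [← map_pow, root_sq]; simp
  have h3 := congrArg Complex.re h2
  have h4 : (0 : ℝ) < m := by exact_mod_cast hm
  simp [sq, h] at h3
  nlinarith [mul_self_nonneg (φ (root m)).re]

theorem trace_add_mul_root (hm : 0 < m) (a b : ℚ) :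
    Algebra.trace ℚ (imagQuadField m) (a + b * root m) = 2 * a := by
  have h0 : (a + b * root m : imagQuadField m) * basis hm 0 = a + b * root m := by
    rw [basis_zero, mul_one]
  have h1 : (a + b * root m : imagQuadField m) * basis hm 1
      = ((-b * m : ℚ) : imagQuadField m) + (a : ℚ) * root m := by
    rw [basis_one]
    push_cast
    linear_combination (b : imagQuadField m) * root_sq m
  rw [Algebra.trace_eq_matrix_trace (basis hm), Matrix.trace_fin_two,
    Algebra.leftMulMatrix_eq_repr_mul, Algebra.leftMulMatrix_eq_repr_mul, h0, h1,
    basis_repr_add_mul_root, basis_repr_add_mul_root]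
  simp
  ring

theorem isIntegral_root (m : ℕ) : IsIntegral ℤ (root m) := by
  refine ⟨.X ^ 2 + .C (m : ℤ), by monicity!, ?_⟩
  simp [root_sq]

theorem abs_discr_le (hm : 0 < m) [NumberField (imagQuadField m)] :
    |discr (imagQuadField m)| ≤ 4 * m := by
  have hcard : Fintype.card (Module.Free.ChooseBasisIndex ℤ (𝓞 (imagQuadField m))) = 2 := by
    rw [← Module.finrank_eq_card_chooseBasisIndex, RingOfIntegers.rank, finrank_eq_two hm]
  let b := (RingOfIntegers.basis (imagQuadField m)).reindex (Fintype.equivFinOfCardEq hcard)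
  let θ : 𝓞 (imagQuadField m) := ⟨root m, isIntegral_root m⟩
  have hθ : (θ : imagQuadField m) = root m := rfl
  have h2 := root_sq m
  have tr (x : 𝓞 (imagQuadField m)) (c d : ℤ)
      (hx : (x : imagQuadField m) = (c : ℚ) + (d : ℚ) * root m) :
      Algebra.trace ℤ (𝓞 (imagQuadField m)) x = 2 * c := by
    have := Algebra.coe_trace_int x
    rw [hx, trace_add_mul_root hm] at this
    exact_mod_cast this
  have hd : Algebra.discr ℤ ![1, θ] = -(4 * m) := by
    rw [Algebra.discr_def, Matrix.det_fin_two]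
    simp only [Algebra.traceMatrix_apply, Algebra.traceForm_apply, Matrix.cons_val_zero,
      Matrix.cons_val_one]
    rw [tr (1 * 1) 1 0 (by simp), tr (θ * θ) (-m) 0 (by simp [hθ, ← sq, h2]),
      tr (1 * θ) 0 1 (by simp [hθ]), tr (θ * 1) 0 1 (by simp [hθ])]
    ring
  have hdvd : discr (imagQuadField m) ∣ 4 * m := by
    rw [← dvd_neg, ← hd, ← discr_eq_discr _ b]
    have := Algebra.discr_of_matrix_vecMul b (b.toMatrix ![1, θ])
    rw [show Matrix.vecMul b ((b.toMatrix ![1, θ]).map (algebraMap ℤ _)) = ![1, θ] from ?_] at this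
    · exact ⟨_, this.trans (mul_comm _ _)⟩
    · ext1 j
      rw [← b.sum_repr (![1, θ] j)]
      simp [Matrix.vecMul, dotProduct, Module.Basis.toMatrix_apply, mul_comm]
  exact Int.le_of_dvd (by positivity) ((abs_dvd _ _).mpr hdvd)

end imagQuadField

namespace imagQuadField

variable {m : ℕ}

theorem norm_add_mul_root (hm : 0 < m) (a b : ℚ) :
    Algebra.norm ℚ (a + b * root m : imagQuadField m) = a ^ 2 + m * b ^ 2 := by
  have h0 : (a + b * root m : imagQuadField m) * basis hm 0 = a + b * root m := by
    rw [basis_zero, mul_one]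
  have h1 : (a + b * root m : imagQuadField m) * basis hm 1
      = ((-b * m : ℚ) : imagQuadField m) + (a : ℚ) * root m := by
    rw [basis_one]
    push_cast
    linear_combination (b : imagQuadField m) * root_sq m
  rw [Algebra.norm_eq_matrix_det (basis hm), Matrix.det_fin_two]
  simp only [Algebra.leftMulMatrix_eq_repr_mul, h0, h1, basis_repr_add_mul_root]
  simp
  ring

/-- Up to the factor `2m`, integers of `ℚ(√-m)` have integral coordinates. -/
theorem exists_int_coords (hm : 0 < m) {a b : ℚ}
    (h : IsIntegral ℤ (a + b * root m : imagQuadField m)) :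
    ∃ s t : ℤ, 2 * a = s ∧ 2 * m * b = t := by
  have := numberField hm
  have hmul : (a + b * root m : imagQuadField m) * root m
      = ((-b * m : ℚ) : imagQuadField m) + (a : ℚ) * root m := by
    push_cast
    linear_combination (b : imagQuadField m) * root_sq m
  have h1 := (IsIntegrallyClosed.isIntegral_iff (R := ℤ)).mp
    (Algebra.isIntegral_trace (L := ℚ) h)
  have h2 := (IsIntegrallyClosed.isIntegral_iff (R := ℤ)).mp
    (Algebra.isIntegral_trace (L := ℚ) (h.mul (isIntegral_root m)))
  rw [trace_add_mul_root hm] at h1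
  rw [hmul, trace_add_mul_root hm] at h2
  obtain ⟨s, hs⟩ := h1
  obtain ⟨t, ht⟩ := h2
  refine ⟨s, -t, by simpa using hs.symm, ?_⟩
  simp only [eq_intCast] at ht
  push_cast
  linarith

/-- A prime exactly dividing `m` divides every integer in the square class of `m`. -/
theorem dvd_of_eq_mul_sq {l k : ℕ} (hl : l.Prime) (hm : l ∣ m) (hm2 : ¬ l ^ 2 ∣ m) (hk : k ≠ 0)
    {b : ℚ} (h : (k : ℚ) = m * b ^ 2) : l ∣ k := by
  have := Fact.mk hl
  have hm0 : m ≠ 0 := by rintro rfl; simp at hm2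
  have hb : b ≠ 0 := by
    rintro rfl
    simp at h
    exact hk h
  have h1 : 1 ≤ padicValNat l m := one_le_padicValNat_of_dvd hm0 hm
  have h2 : ¬ 2 ≤ padicValNat l m := fun h2 ↦ hm2 ((padicValNat_dvd_iff_le hm0).mpr h2)
  have h3 := congrArg (padicValRat l) h
  rw [padicValRat.mul (by exact_mod_cast hm0) (pow_ne_zero 2 hb), padicValRat.pow,
    padicValRat.of_nat, padicValRat.of_nat] at h3
  by_contra hlk
  rw [padicValNat.eq_zero_of_not_dvd hlk] at h3
  generalize padicValNat l m = v at *
  generalize padicValRat l b = w at *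
  push_cast at h3
  omega

theorem unit_eq_one_or_neg_one {l : ℕ} (hl : l.Prime) (hl3 : 3 < l) (hm : l ∣ m)
    (hm2 : ¬ l ^ 2 ∣ m) [NumberField (imagQuadField m)] (u : (𝓞 (imagQuadField m))ˣ) :
    (u : imagQuadField m) = 1 ∨ (u : imagQuadField m) = -1 := by
  have hm0 : 0 < m := Nat.pos_of_ne_zero (by rintro rfl; simp at hm2)
  obtain ⟨a, b, hab⟩ := exists_eq_add_mul_root (u : imagQuadField m)
  have hint : IsIntegral ℤ (a + b * root m : imagQuadField m) :=
    hab ▸ (u : 𝓞 (imagQuadField m)).isIntegral_coe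
  obtain ⟨s, t, hs, ht⟩ := exists_int_coords hm0 hint
  have hn : a ^ 2 + m * b ^ 2 = 1 := by
    have := (NumberField.isUnit_iff_norm (K := imagQuadField m)).mp u.isUnit
    rw [RingOfIntegers.coe_norm, show ((u : 𝓞 (imagQuadField m)) : imagQuadField m) = _ from hab,
      norm_add_mul_root hm0, abs_of_nonneg (by positivity)] at this
    exact this
  have hs4 : (s : ℚ) ^ 2 ≤ 4 := by
    have : 0 ≤ m * b ^ 2 := by positivity
    rw [← hs]; nlinarith
  have hs4' : s ^ 2 ≤ 4 := by exact_mod_cast hs4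
  have hle : s ≤ 2 := by nlinarith
  have hge : -2 ≤ s := by nlinarith
  have hmq : (m : ℚ) ≠ 0 := by positivity
  have hcase : s = 0 ∨ s ^ 2 = 1 ∨ s = 2 ∨ s = -2 := by
    interval_cases s <;> simp
  rcases hcase with h | h | h | h
  · have ha : a = 0 := by rw [h] at hs; simpa using hs
    have := dvd_of_eq_mul_sq hl hm hm2 one_ne_zero (b := b) (by rw [ha] at hn; push_cast; linarith)
    have := Nat.le_of_dvd one_pos this
    omega
  · have hq : (s : ℚ) ^ 2 = 1 := by exact_mod_cast h
    have := dvd_of_eq_mul_sq hl hm hm2 three_ne_zero (b := 2 * b)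
      (by rw [← hs] at hq; push_cast; linarith)
    have := Nat.le_of_dvd three_pos this
    omega
  all_goals
    rw [h] at hs
    push_cast at hs
    have hb : b = 0 := by
      have : a = 1 ∨ a = -1 := by first | (left; linarith) | (right; linarith)
      have ha2 : a ^ 2 = 1 := by rcases this with h | h <;> rw [h] <;> norm_num
      have : (m : ℚ) * b ^ 2 = 0 := by linarith
      simpa [hmq] using this
    rw [hab, hb]
  · left
    have : a = 1 := by linarith
    simp [this]
  · right
    have : a = -1 := by linarith
    simp [this]

theorem le_of_ringEquiv {m n : ℕ} (f : imagQuadField m ≃+* imagQuadField n) :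
    imagQuadField m ≤ imagQuadField n := by
  have h1 : (f (root m) : ℂ) ^ 2 = (root m : ℂ) ^ 2 := by
    have h2 := congrArg (fun z : imagQuadField n ↦ (z : ℂ)) (congrArg f (root_sq m))
    have h3 := congrArg (fun z : imagQuadField m ↦ (z : ℂ)) (root_sq m)
    simp only [map_pow, map_neg, map_natCast] at h2
    push_cast at h2 h3
    rw [h2, h3]
  have h2 : (root m : ℂ) ∈ imagQuadField n := by
    rcases sq_eq_sq_iff_eq_or_eq_neg.mp h1 with h | h
    · exact h ▸ (f (root m)).2
    · have := neg_mem (f (root m)).2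
      rwa [h, neg_neg] at this
  rintro _ ⟨a, b, rfl⟩
  exact add_mem (SubfieldClass.ratCast_mem _ a) (mul_mem (SubfieldClass.ratCast_mem _ b) h2)

theorem eq_of_ringEquiv {m n : ℕ} (f : imagQuadField m ≃+* imagQuadField n) :
    imagQuadField m = imagQuadField n :=
  le_antisymm (le_of_ringEquiv f) (le_of_ringEquiv f.symm)

/-- A prime exactly dividing `m` ramifies in `ℚ(√-m)`, hence divides any `n` giving the same
field. -/
theorem dvd_of_eq {l m n : ℕ} (hl : l.Prime) (hm : l ∣ m) (hm2 : ¬ l ^ 2 ∣ m) (hn : 0 < n)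
    (h : imagQuadField m = imagQuadField n) : l ∣ n := by
  have hm0 : 0 < m := Nat.pos_of_ne_zero (by rintro rfl; simp at hm2)
  have hr : (root n : ℂ) ∈ imagQuadField m := by
    rw [h]
    exact (root n).2
  obtain ⟨a, b, hab⟩ := exists_eq_add_mul_root (⟨root n, hr⟩ : imagQuadField m)
  have hsq : (a + b * root m : imagQuadField m) ^ 2 = -(n : imagQuadField m) := by
    rw [← hab]
    ext
    have := congrArg (fun z : imagQuadField n ↦ (z : ℂ)) (root_sq n)
    push_cast at this ⊢
    exact this
  have h2 : (((a ^ 2 - m * b ^ 2 : ℚ) : imagQuadField m) + (2 * a * b : ℚ) * root m)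
      = ((-n : ℚ) : imagQuadField m) + (0 : ℚ) * root m := by
    push_cast
    linear_combination hsq - (b : imagQuadField m) ^ 2 * root_sq m
  obtain ⟨h3, h4⟩ := add_mul_root_inj hm0 h2
  have hnq : (0 : ℚ) < n := by exact_mod_cast hn
  have ha : a = 0 := by
    by_contra ha
    have hb : b = 0 := by simpa [ha] using h4
    rw [hb] at h3
    nlinarith [sq_nonneg a]
  exact dvd_of_eq_mul_sq hl hm hm2 hn.ne' (b := b) (by rw [ha] at h3; linarith)

end imagQuadField

namespace imagQuadField

variable {m : ℕ}

theorem root_mul_self (m : ℕ) : root m * root m = ((-m : ℤ) : imagQuadField m) := by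
  rw [← sq, root_sq]; simp

/-- Multiplicative relations in `ℚ(√-m)` up to cubes reduce to relations up to cubes modulo primes
where `-m` is a square. -/
theorem exists_prod_eq_cube_zmod (hm : 0 < m) {ι : Type*} [Fintype ι] {y z : ι → ℤ} {k : ι → ℕ}
    {β : imagQuadField m} (hβ : IsIntegral ℤ β)
    (h : ∏ i, ((y i : imagQuadField m) + z i * root m) ^ k i = β ^ 3)
    {p : ℕ} [Fact p.Prime] {δ : ZMod p} (hδ : δ ^ 2 = -m) (h2m : (2 * m : ZMod p) ≠ 0) :
    ∃ c : ZMod p, ∏ i, ((y i : ZMod p) + z i * δ) ^ k i = c ^ 3 := by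
  obtain ⟨a, b, rfl⟩ := exists_eq_add_mul_root β
  obtain ⟨s, t, hs, ht⟩ := exists_int_coords hm hβ
  let φ : ℤ√(-m) →+* imagQuadField m := Zsqrtd.lift ⟨root m, root_mul_self m⟩
  have hφ : Function.Injective φ := by
    refine Zsqrtd.lift_injective _ fun n hn ↦ ?_
    have : (0 : ℤ) < m := by exact_mod_cast hm
    nlinarith [mul_self_nonneg n]
  let ψ : ℤ√(-m) →+* ZMod p := Zsqrtd.lift ⟨δ, by rw [← sq, hδ]; simp⟩
  let B : ℤ√(-m) := ⟨m * s, t⟩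
  have hB : φ B = 2 * m * (a + b * root m) := by
    have hs' : (s : imagQuadField m) = ((s : ℚ) : imagQuadField m) := by simp
    have ht' : (t : imagQuadField m) = ((t : ℚ) : imagQuadField m) := by simp
    simp only [φ, B, Zsqrtd.lift_apply_apply, Int.cast_mul, Int.cast_natCast]
    rw [hs', ht', ← hs, ← ht]
    push_cast
    ring
  have hA : (∏ i, (⟨y i, z i⟩ : ℤ√(-m)) ^ k i) * (2 * m) ^ 3 = B ^ 3 := by
    apply hφ
    have hφ2 : φ (2 * m) = 2 * m := by rw [map_mul, map_ofNat, map_natCast]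
    have hφyz (i : ι) : φ ⟨y i, z i⟩ = y i + z i * root m := rfl
    simp only [map_mul φ _ (_ ^ 3), map_prod, map_pow, hB, mul_pow _ (_ + _), ← h, hφ2, hφyz]
    ring
  refine ⟨ψ B / (2 * m), ?_⟩
  have hψA := congrArg ψ hA
  have hψ2 : ψ (2 * m) = 2 * m := by rw [map_mul, map_ofNat, map_natCast]
  have hψyz (i : ι) : ψ ⟨y i, z i⟩ = y i + z i * δ := rfl
  simp only [map_mul ψ _ (_ ^ 3), map_prod, map_pow, hψ2, hψyz] at hψA
  rw [div_pow, eq_div_iff (pow_ne_zero 3 h2m), ← hψA]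

/-- The generator `√-m` as an algebraic integer. -/
noncomputable def intRoot (m : ℕ) : 𝓞 (imagQuadField m) := ⟨root m, isIntegral_root m⟩

theorem coe_intRoot (m : ℕ) : (intRoot m : imagQuadField m) = root m := rfl

theorem intRoot_sq (m : ℕ) : intRoot m ^ 2 = -(m : 𝓞 (imagQuadField m)) := by
  apply RingOfIntegers.ext
  simp [coe_intRoot, root_sq]

/-- A coprime representation of a cube by the norm form gives a cube of an ideal. -/
theorem exists_span_eq_cube [NumberField (imagQuadField m)] {x y z : ℤ}
    (h : y ^ 2 + m * z ^ 2 = x ^ 3) (hcop : IsCoprime x (2 * y)) :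
    ∃ I : Ideal (𝓞 (imagQuadField m)), I ≠ 0 ∧
      Ideal.span {(y + z * intRoot m : 𝓞 (imagQuadField m))} = I ^ 3 := by
  set α : 𝓞 (imagQuadField m) := y + z * intRoot m with hα
  set α' : 𝓞 (imagQuadField m) := y - z * intRoot m with hα'
  have hh : ((y ^ 2 + m * z ^ 2 : ℤ) : 𝓞 (imagQuadField m)) = ((x ^ 3 : ℤ) : _) := by rw [h]
  have hmul : α * α' = (x : 𝓞 (imagQuadField m)) ^ 3 := by
    push_cast at hh
    rw [← hh, hα, hα']
    linear_combination (-(z : 𝓞 (imagQuadField m)) ^ 2) * intRoot_sq m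
  have hx : x ≠ 0 := by
    rintro rfl
    rw [isCoprime_zero_left, Int.isUnit_iff] at hcop
    omega
  have hα0 : α ≠ 0 := by
    intro h0
    rw [h0, zero_mul] at hmul
    exact hx (by exact_mod_cast (pow_eq_zero_iff three_ne_zero).mp hmul.symm)
  have hαα' : IsCoprime α α' := by
    obtain ⟨u, v, huv⟩ := hcop.pow_left (m := 3)
    have huv' : ((u * x ^ 3 + v * (2 * y) : ℤ) : 𝓞 (imagQuadField m)) = ((1 : ℤ) : _) := by
      rw [huv]
    push_cast at huv'
    refine ⟨u * α' + v, v, ?_⟩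
    rw [← huv', ← hmul, hα, hα']
    ring
  obtain ⟨I, hI⟩ := exists_eq_pow_of_mul_eq_pow_of_coprime
    (a := Ideal.span {α}) (b := Ideal.span {α'}) (c := Ideal.span {(x : 𝓞 (imagQuadField m))})
    (n := 3) ((Ideal.isCoprime_span_singleton_iff _ _).mpr hαα')
    (by rw [Ideal.span_singleton_mul_span_singleton, Ideal.span_singleton_pow, hmul])
  refine ⟨I, ?_, hI⟩
  rintro rfl
  rw [zero_pow three_ne_zero] at hI
  exact hα0 (Ideal.span_singleton_eq_bot.mp hI)

end imagQuadField

/-- Elements of order dividing `n` in an additive commutative group span the image of a power of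
`ZMod n`. -/
theorem exists_zmod_pi_addMonoidHom {A ι : Type*} [AddCommGroup A] [Fintype ι] (n : ℕ) [NeZero n]
    (c : ι → A) (hc : ∀ i, n • c i = 0) :
    ∃ f : (ι → ZMod n) →+ A, ∀ e, f e = ∑ i, (e i).val • c i := by
  refine ⟨∑ i, (ZMod.lift n ⟨zmultiplesHom A (c i), by simpa using hc i⟩).comp
    (Pi.evalAddMonoidHom _ i), fun e ↦ ?_⟩
  rw [AddMonoidHom.finsetSum_apply]
  refine Finset.sum_congr rfl fun i _ ↦ ?_
  rw [AddMonoidHom.comp_apply, Pi.evalAddMonoidHom_apply]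
  have : e i = (((e i).val : ℤ) : ZMod n) := by simp
  conv_lhs => rw [this]
  rw [ZMod.lift_coe]
  exact natCast_zsmul _ _

namespace imagQuadField

variable {m : ℕ}

/-- Coprime representations of cubes by the form `Y² + mZ²` yield independent ideal classes of
order three as soon as they are separated by cubic residue conditions. -/
theorem exists_injective_zmod_three {l : ℕ} (hl : l.Prime) (hl3 : 3 < l) (hlm : l ∣ m)
    (hlm2 : ¬ l ^ 2 ∣ m) [NumberField (imagQuadField m)] {ι : Type*} [Fintype ι] {x y z : ι → ℤ}
    (hxyz : ∀ i, y i ^ 2 + m * z i ^ 2 = x i ^ 3) (hcop : ∀ i, IsCoprime (x i) (2 * y i))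
    (hres : ∀ j, ∃ (p : ℕ) (_ : Fact p.Prime) (δ : ZMod p), δ ^ 2 = -m ∧ (2 * m : ZMod p) ≠ 0 ∧
      (∀ i ≠ j, ∃ r : ZMod p, r ≠ 0 ∧ y i + z i * δ = r ^ 3) ∧
      ∀ r : ZMod p, y j + z j * δ ≠ r ^ 3) :
    ∃ f : (ι → ZMod 3) →+ Additive (ClassGroup (𝓞 (imagQuadField m))),
      Function.Injective f := by
  classical
  have hm : 0 < m := Nat.pos_of_ne_zero (by rintro rfl; simp at hlm2)
  choose I hI0 hI using fun i ↦ exists_span_eq_cube (hxyz i) (hcop i)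
  let J (i : ι) : nonZeroDivisors (Ideal (𝓞 (imagQuadField m))) :=
    ⟨I i, mem_nonZeroDivisors_iff_ne_zero.mpr (hI0 i)⟩
  have hJ (i : ι) : ClassGroup.mk0 (J i) ^ 3 = 1 := by
    rw [← map_pow]
    have : (J i) ^ 3 = ⟨I i ^ 3, mem_nonZeroDivisors_iff_ne_zero.mpr (pow_ne_zero 3 (hI0 i))⟩ :=
      Subtype.ext rfl
    rw [this, ClassGroup.mk0_eq_one_iff, ← hI i]
    exact ⟨⟨_, rfl⟩⟩
  obtain ⟨f, hf⟩ := exists_zmod_pi_addMonoidHom 3 (fun i ↦ Additive.ofMul (ClassGroup.mk0 (J i)))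
    (fun i ↦ by rw [← ofMul_pow, hJ, ofMul_one])
  refine ⟨f, (injective_iff_map_eq_zero f).mpr fun e he ↦ ?_⟩
  rw [hf] at he
  have hprod : ClassGroup.mk0 (∏ i, J i ^ (e i).val) = 1 := by
    rw [map_prod]
    simpa [← ofMul_pow, ← ofMul_prod] using he
  have hprin : (∏ i, I i ^ (e i).val).IsPrincipal := by
    have : ∏ i, J i ^ (e i).val = ⟨∏ i, I i ^ (e i).val, mem_nonZeroDivisors_iff_ne_zero.mpr
        (Finset.prod_ne_zero_iff.mpr fun i _ ↦ pow_ne_zero _ (hI0 i))⟩ :=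
      Subtype.ext (by simp [J])
    rwa [this, ClassGroup.mk0_eq_one_iff] at hprod
  obtain ⟨β, hβ⟩ := hprin.principal
  have hspan : Ideal.span {∏ i, (y i + z i * intRoot m : 𝓞 (imagQuadField m)) ^ (e i).val}
      = Ideal.span {β ^ 3} := by
    have hβ' : ∏ i, I i ^ (e i).val = Ideal.span {β} := hβ
    rw [← Ideal.span_singleton_pow, ← hβ', ← Finset.prod_pow,
      ← Ideal.prod_span_singleton]
    refine Finset.prod_congr rfl fun i _ ↦ ?_
    rw [← Ideal.span_singleton_pow, hI, ← pow_mul, ← pow_mul, mul_comm]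
  obtain ⟨u, hu⟩ := Ideal.span_singleton_eq_span_singleton.mp hspan.symm
  have hu' : ∏ i, ((y i : imagQuadField m) + z i * root m) ^ (e i).val
      = ((β : imagQuadField m) ^ 3) * u := by
    have := congrArg (fun w : 𝓞 (imagQuadField m) ↦ (w : imagQuadField m)) hu
    simpa [coe_intRoot] using this.symm
  obtain ⟨γ, hγ, hγ3⟩ : ∃ γ : imagQuadField m, IsIntegral ℤ γ ∧
      ∏ i, ((y i : imagQuadField m) + z i * root m) ^ (e i).val = γ ^ 3 := by
    rcases unit_eq_one_or_neg_one hl hl3 hlm hlm2 u with h | h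
    · exact ⟨β, β.isIntegral_coe, by rw [hu', h, mul_one]⟩
    · exact ⟨-β, β.isIntegral_coe.neg, by rw [hu', h]; ring⟩
  funext j
  obtain ⟨p, hp, δ, hδ, h2m, hcube, hnot⟩ := hres j
  obtain ⟨c, hc⟩ := exists_prod_eq_cube_zmod hm hγ hγ3 hδ h2m
  choose! r hr0 hr using hcube
  rw [← Finset.mul_prod_erase _ _ (Finset.mem_univ j)] at hc
  have hrest : ∏ i ∈ Finset.univ.erase j, ((y i : ZMod p) + z i * δ) ^ (e i).val
      = (∏ i ∈ Finset.univ.erase j, r i ^ (e i).val) ^ 3 := by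
    rw [← Finset.prod_pow]
    refine Finset.prod_congr rfl fun i hi ↦ ?_
    rw [hr i (Finset.ne_of_mem_erase hi), ← pow_mul, ← pow_mul, mul_comm]
  have hR : ∏ i ∈ Finset.univ.erase j, r i ^ (e i).val ≠ 0 :=
    Finset.prod_ne_zero_iff.mpr fun i hi ↦ pow_ne_zero _ (hr0 i (Finset.ne_of_mem_erase hi))
  set R := ∏ i ∈ Finset.univ.erase j, r i ^ (e i).val with hRdef
  set w : ZMod p := (y j : ZMod p) + z j * δ with hw
  have hw0 : w ≠ 0 := fun h ↦ hnot 0 (by simpa using h)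
  rw [hrest] at hc
  have hd : w ^ (e j).val = (c / R) ^ 3 := by
    rw [div_pow, eq_div_iff (pow_ne_zero 3 hR), hc]
  have hlt := ZMod.val_lt (e j)
  rw [Pi.zero_apply, ← ZMod.val_eq_zero]
  interval_cases hv : (e j).val
  · rfl
  · exact absurd (by simpa using hd) (hnot (c / R))
  · refine absurd ?_ (hnot ((c / R) ^ 2 / w))
    rw [div_pow, eq_div_iff (pow_ne_zero 3 hw0), ← pow_mul, mul_comm 2, pow_mul, ← hd]
    ring

end imagQuadField

/-- The value at `n` of the polynomial with the given coefficients, constant term first. -/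
def horner (cs : List ℤ) (n : ℤ) : ℤ :=
  cs.foldr (fun c v ↦ c + n * v) 0

theorem horner_nil (n : ℤ) : horner [] n = 0 := rfl

theorem horner_cons (c : ℤ) (cs : List ℤ) (n : ℤ) : horner (c :: cs) n = c + n * horner cs n := rfl

theorem horner_modEq (cs : List ℤ) {a b k : ℤ} (h : a ≡ b [ZMOD k]) :
    horner cs a ≡ horner cs b [ZMOD k] := by
  induction cs with
  | nil => rfl
  | cons c cs ih => exact (h.mul ih).add_left c

theorem abs_horner_le (cs : List ℤ) {n : ℤ} (hn : 1 ≤ n) :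
    |horner cs n| ≤ (cs.map abs).sum * n ^ cs.length := by
  induction cs with
  | nil => simp [horner_nil]
  | cons c cs ih =>
    have h1 : 1 ≤ n ^ (cs.length + 1) := one_le_pow₀ hn
    have h2 : |n * horner cs n| ≤ n * ((cs.map abs).sum * n ^ cs.length) := by
      rw [abs_mul, abs_of_pos (by lia : 0 < n)]
      gcongr
    calc |horner (c :: cs) n| ≤ |c| + |n * horner cs n| := abs_add_le _ _
      _ ≤ |c| * n ^ (cs.length + 1) + n * ((cs.map abs).sum * n ^ cs.length) :=
        add_le_add (le_mul_of_one_le_right (abs_nonneg c) h1) h2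
      _ = ((c :: cs).map abs).sum * n ^ (c :: cs).length := by
        rw [List.map_cons, List.sum_cons, List.length_cons]
        ring

theorem horner_append_neg (cs : List ℤ) {a n : ℤ} (ha : a < 0) (hn : 0 ≤ n)
    (hcs : ∀ c ∈ cs, c < n) : horner (cs ++ [a]) n < 0 := by
  induction cs with
  | nil => simpa [horner_cons, horner_nil] using ha
  | cons c cs ih =>
    have h1 := ih fun c hc ↦ hcs c (List.mem_cons_of_mem _ hc)
    have h2 := hcs c List.mem_cons_self
    rw [List.cons_append, horner_cons]
    nlinarith

namespace RankFourFamily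

/-- Coefficients of the polynomials `7 X i`. -/
def xCoeff : Fin 4 → List ℤ :=
  ![
    [14765025303, 5933538765, 291367449, 26895888, 1602160],
    [14765025303, 1711240020, 101328084, 15018048, 76160],
    [14765025303, 673335747, 143390655, 4054860, 561596],
    [14765025303, -45995155668, 5625795060, -458758080, 19773376]]

/-- Coefficients of the polynomials `14 Y i`. -/
def yCoeff : Fin 4 → List ℤ :=
  ![
    [-1356226634181762, -1066631755756707, -104242585274415, -6546205207440, -825543598680,
      -38579270976, -1532241536],
    [-1356226634181762, -257645472958692, -30421978665120, -1332258814080, -135763361280,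
      -9710896896, -7110656],
    [-1356226634181762, -93114577428705, -21003399157041, -994619466432, -129683440044,
      -3445340184, -318134096],
    [-1356226634181762, -9605323932186780, 3577798255397184, -494900579365632, 42140343099456,
      -2313210576384, 66465301504]]

/-- Coefficients of `1372 D / n`, where `D` is the common discriminant. -/
def discCoeff : List ℤ :=
    [6488009464775981964484139064, 4037024533748396185195047099, 222678010519466155907598954,
      -12878692456639676608482849, -1289085586945817878959084, -103472802601521877629396,
      -7973032528397126930112, -288376417768093066368, 33446689033469718528, 7194465251488263168,
      -1228227527245824, -22079488786432]

/-- Coefficients of the cofactor of `7 X i` in a Bézout identity. -/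
def bezoutX : Fin 4 → List ℤ :=
  ![
    [16939136019570412098726856766566647, 2016892894349884938399199787870088,
      103733964714912107236962291005832, 16458852947237742935612131341696,
      765846780107086498914429325056, 33626144183785396898953371136],
    [1369505463365723284287884486142, -1262194313383551153630540674592,
      -19249096675891268789196776928, 437392737993246788158439616, -480818591887385673951260544,
      -355971984311463302938624],
    [-4367449607073765489094431138432579, 86348289102640742946408952964652,
      -20780098312216885150716664405236, 1023356164270035579323923060344,
      51679148819823493177073384592, -9104435689118511916687222976],
    [131228799890129872001385347832162462, -56648765646336159025574879863091088,
      7981457736881329273930966605442224, -696504348635326047616527421285536,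
      39400893366231292604839418355072, -1177516403815559721970731501568]]

/-- Coefficients of the cofactor of `14 Y i` in a Bézout identity. -/
def bezoutY : Fin 4 → List ℤ :=
  ![
    [115322419852004295448771288833, 5369264610987136188470770224, 505759358840748819174871488,
      35160555238657628646628160],
    [-93508145781861879864271917, 5750640660639099112068294, -694784448272550775545792,
      -3812703965029533864640],
    [-65909308040572536150510706821, 3296862031707007143482156904, 149241164746834956695223636,
      -16071885187893220405912976],
    [-728208760792525251733001318517, 90229388924465959602576580290,
      -7657266562006339766822075496, 350310223108092816528491392]]

/-- The constant value of the Bézout identity. -/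
def bezoutConst : Fin 4 → ℤ :=
  ![93703434618336040380670765004832362268005295,
    147039020641503707010243534635754953028780,
    24902455047093078550353552293246672912652165,
    2925212667491409555353627931530701516071062940]

/-- The coefficients `Z i` in the equations `Y i ^ 2 - Z i ^ 2 * D = X i ^ 3`. -/
def zVal : Fin 4 → ℤ := ![27, 8, 1, 216]

/-- The values `X i` at `n = 1`. -/
def xOne : Fin 4 → ℤ := ![3002632795, 2370383945, 2226624023, -3720474287]

/-- The values `Y i` at `n = 1`. -/
def yOne : Fin 4 → ℤ := ![-181036631109394, -117555130427749, -105105191224876, -559911378036601]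

/-- The value of the discriminant at `n = 1`. -/
def discOne : ℤ := 7823201557892576604915209

/-- Primes whose cubic residue symbols separate the four ideal classes. -/
def charPrime : Fin 4 → ℕ := ![157, 811, 1231, 1063]

/-- Square roots of the discriminant modulo the primes `charPrime`. -/
def sqrtDisc : Fin 4 → ℤ := ![71, 335, 61, 293]

/-- Cube roots of `Y i + Z i √D` modulo `charPrime j`, for `i ≠ j`. -/
def cubeRoot : Fin 4 → Fin 4 → ℤ :=
  ![![0, 7, 15, 43], ![177, 0, 516, 87], ![650, 650, 0, 272], ![603, 258, 20, 0]]

/-- The residue of `Y j + Z j √D` modulo `charPrime j`. -/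
def nonCube : Fin 4 → ℕ := ![138, 687, 128, 764]

/-- The modulus governing the congruence conditions. -/
def modulus : ℤ := ∏ i, bezoutConst i * charPrime i

theorem bezoutConst_dvd_modulus (i : Fin 4) : bezoutConst i ∣ modulus :=
  (dvd_mul_right _ _).trans (Finset.dvd_prod_of_mem _ (Finset.mem_univ i))

theorem charPrime_dvd_modulus (i : Fin 4) : (charPrime i : ℤ) ∣ modulus :=
  (dvd_mul_left _ _).trans (Finset.dvd_prod_of_mem _ (Finset.mem_univ i))

theorem modulus_pos : 0 < modulus :=
  Finset.prod_pos (by decide)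

theorem horner_xCoeff_one : ∀ i, horner (xCoeff i) 1 = 7 * xOne i := by decide

theorem horner_yCoeff_one : ∀ i, horner (yCoeff i) 1 = 14 * yOne i := by decide

theorem discOne_eq : yOne 2 ^ 2 - xOne 2 ^ 3 = discOne := by decide

theorem horner_identity (i : Fin 4) (n : ℤ) :
    7 * horner (yCoeff i) n ^ 2 - 4 * horner (xCoeff i) n ^ 3
      = zVal i ^ 2 * (n * horner discCoeff n) := by
  fin_cases i <;> simp [xCoeff, yCoeff, zVal, discCoeff, horner_cons, horner_nil] <;> ring

theorem horner_bezout (i : Fin 4) (n : ℤ) :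
    horner (bezoutX i) n * horner (xCoeff i) n + horner (bezoutY i) n * horner (yCoeff i) n
      = bezoutConst i := by
  fin_cases i <;>
    simp [xCoeff, yCoeff, bezoutX, bezoutY, bezoutConst, horner_cons, horner_nil] <;> ring

theorem isCoprime_one (i : Fin 4) : IsCoprime (xOne i) (2 * yOne i) := by
  rw [Int.isCoprime_iff_gcd_eq_one]
  revert i
  decide

theorem charPrime_prime (i : Fin 4) : (charPrime i).Prime := by
  fin_cases i <;> norm_num [charPrime]

theorem sqrtDisc_spec : ∀ j, (charPrime j : ℤ) ∣ discOne - sqrtDisc j ^ 2 := by decide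

theorem not_dvd_two_mul_discOne : ∀ j, ¬ (charPrime j : ℤ) ∣ 2 * discOne := by decide

theorem cubeRoot_spec : ∀ j, ∀ i ≠ j, ¬ (charPrime j : ℤ) ∣ cubeRoot j i ∧
    (charPrime j : ℤ) ∣ cubeRoot j i ^ 3 - (yOne i + zVal i * sqrtDisc j) := by decide

theorem nonCube_spec : ∀ j, (charPrime j : ℤ) ∣ nonCube j - (yOne j + zVal j * sqrtDisc j) := by
  decide

theorem nonCube_not_cube : ∀ j, 3 * ((charPrime j - 1) / 3) = charPrime j - 1 ∧
    ¬ charPrime j ∣ nonCube j ∧ nonCube j ^ ((charPrime j - 1) / 3) % charPrime j ≠ 1 := by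
  set_option exponentiation.threshold 500 in decide

/-- The residue conditions at `n = 1`, modulo the primes `charPrime`. -/
theorem residue_conditions (j : Fin 4) [Fact (charPrime j).Prime] :
    ((sqrtDisc j : ZMod (charPrime j)) ^ 2 = discOne ∧ (2 * discOne : ZMod (charPrime j)) ≠ 0) ∧
    (∀ i ≠ j, ∃ r : ZMod (charPrime j), r ≠ 0 ∧ yOne i + zVal i * sqrtDisc j = r ^ 3) ∧
      ∀ r : ZMod (charPrime j), yOne j + zVal j * sqrtDisc j ≠ r ^ 3 := by
  refine ⟨⟨?_, ?_⟩, fun i hi ↦ ⟨cubeRoot j i, ?_, ?_⟩, fun r hr ↦ ?_⟩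
  · exact_mod_cast (ZMod.intCast_eq_intCast_iff_dvd_sub _ _ _).mpr (sqrtDisc_spec j)
  · have := not_dvd_two_mul_discOne j
    rw [← ZMod.intCast_zmod_eq_zero_iff_dvd] at this
    exact_mod_cast this
  · rw [Ne, ZMod.intCast_zmod_eq_zero_iff_dvd]
    exact (cubeRoot_spec j i hi).1
  · exact_mod_cast (ZMod.intCast_eq_intCast_iff_dvd_sub _ _ _).mpr (cubeRoot_spec j i hi).2
  · obtain ⟨h3, h0, h1⟩ := nonCube_not_cube j
    have hval : (nonCube j : ZMod (charPrime j)) = r ^ 3 := by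
      rw [← hr]
      exact_mod_cast ((ZMod.intCast_eq_intCast_iff_dvd_sub _ _ _).mpr (nonCube_spec j)).symm
    have hr0 : r ≠ 0 := by
      rintro rfl
      rw [zero_pow three_ne_zero, ZMod.natCast_eq_zero_iff] at hval
      exact h0 hval
    have hpow : ((nonCube j ^ ((charPrime j - 1) / 3) : ℕ) : ZMod (charPrime j)) = (1 : ℕ) := by
      rw [Nat.cast_pow, hval, ← pow_mul, h3, ZMod.pow_card_sub_one_eq_one hr0, Nat.cast_one]
    rw [ZMod.natCast_eq_natCast_iff', Nat.mod_eq_of_lt (charPrime_prime j).one_lt] at hpow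
    exact h1 hpow

/-- The members of the family: integers `X i`, `Y i` and `m` with good properties. -/
theorem exists_solution {n : ℤ} (hn : n ≡ 1 [ZMOD 14 * modulus]) :
    ∃ (x y : Fin 4 → ℤ) (d : ℤ), (∀ i, y i ^ 2 - zVal i ^ 2 * d = x i ^ 3) ∧
      1372 * d = n * horner discCoeff n ∧
      (∀ i, x i ≡ xOne i [ZMOD modulus]) ∧ (∀ i, y i ≡ yOne i [ZMOD modulus]) ∧
      d ≡ discOne [ZMOD modulus] ∧ ∀ i, IsCoprime (x i) (2 * y i) := by
  have hX (i : Fin 4) : ∃ a, horner (xCoeff i) n = 7 * a ∧ a ≡ xOne i [ZMOD modulus] := by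
    have h := (horner_modEq (xCoeff i) hn).symm.dvd
    rw [horner_xCoeff_one] at h
    obtain ⟨c, hc⟩ := h
    exact ⟨xOne i + 2 * modulus * c, by linear_combination hc,
      (Int.modEq_iff_dvd.mpr ⟨2 * c, by ring⟩ : xOne i ≡ _ [ZMOD modulus]).symm⟩
  have hY (i : Fin 4) : ∃ a, horner (yCoeff i) n = 14 * a ∧ a ≡ yOne i [ZMOD modulus] := by
    have h := (horner_modEq (yCoeff i) hn).symm.dvd
    rw [horner_yCoeff_one] at h
    obtain ⟨c, hc⟩ := h
    exact ⟨yOne i + modulus * c, by linear_combination hc,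
      (Int.modEq_iff_dvd.mpr ⟨c, by ring⟩ : yOne i ≡ _ [ZMOD modulus]).symm⟩
  choose x hx hxm using hX
  choose y hy hym using hY
  have hid (i : Fin 4) : 1372 * (y i ^ 2 - x i ^ 3) = zVal i ^ 2 * (n * horner discCoeff n) := by
    rw [← horner_identity, hx, hy]
    ring
  have hd : 1372 * (y 2 ^ 2 - x 2 ^ 3) = n * horner discCoeff n := by
    rw [hid 2]
    simp [zVal]
  refine ⟨x, y, y 2 ^ 2 - x 2 ^ 3, fun i ↦ ?_, hd, hxm, hym, ?_, fun i ↦ ?_⟩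
  · have := hid i
    rw [← hd] at this
    linarith
  · rw [← discOne_eq]
    exact ((hym 2).pow 2).sub ((hxm 2).pow 3)
  · obtain ⟨s, t, hst⟩ := isCoprime_one i
    obtain ⟨a, ha⟩ := (hxm i).symm.dvd
    obtain ⟨b, hb⟩ := (hym i).symm.dvd
    obtain ⟨c, hc⟩ := bezoutConst_dvd_modulus i
    have hbez := horner_bezout i n
    rw [hx, hy] at hbez
    refine ⟨s - (s * a + t * 2 * b) * c * (horner (bezoutX i) n * 7),
      t - (s * a + t * 2 * b) * c * (horner (bezoutY i) n * 7), ?_⟩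
    linear_combination hst + s * ha + 2 * t * hb + (s * a + t * 2 * b) * hc
      - (s * a + t * 2 * b) * c * hbez

/-- Every large prime `l` exactly divides a member of the family, of size `O(l ^ 13)`. -/
theorem exists_field_of_prime : ∃ B C : ℕ, ∀ l : ℕ, l.Prime → B < l →
    ∃ m : ℕ, 0 < m ∧ m ≤ C * l ^ 13 ∧ l ∣ m ∧ ¬ l ^ 2 ∣ m ∧
      ∀ [NumberField (imagQuadField m)],
        ∃ f : (Fin 4 → ZMod 3) →+ Additive (ClassGroup (𝓞 (imagQuadField m))),
          Function.Injective f := by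
  obtain ⟨M, hM⟩ := Int.eq_ofNat_of_zero_le modulus_pos.le
  have hM0 : 0 < M := by have := modulus_pos; lia
  obtain ⟨S, hS⟩ := Int.eq_ofNat_of_zero_le
    (List.sum_nonneg (l := discCoeff.map abs) (by simp))
  obtain ⟨g, hg0, hg⟩ : ∃ g : ℕ, 0 < g ∧ (6488009464775981964484139064 : ℤ) = g :=
    ⟨6488009464775981964484139064, by norm_num, by norm_num⟩
  refine ⟨14 * M + g + 1372, S * (14 * M) ^ 13, fun l hl hlB ↦ ?_⟩
  have hgl : g < l := by lia
  have hcop : Nat.Coprime l (14 * M) :=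
    hl.coprime_iff_not_dvd.mpr fun h ↦ absurd (Nat.le_of_dvd (by lia) h) (by lia)
  obtain ⟨u, hu, hlu⟩ := Nat.exists_mul_mod_eq_one_of_coprime hcop (by lia)
  have hu0 : 0 < u := Nat.pos_of_ne_zero (by rintro rfl; simp at hlu)
  obtain ⟨n, hn⟩ : ∃ n : ℕ, n = l * u := ⟨_, rfl⟩
  have hln : l ≤ n := hn ▸ Nat.le_mul_of_pos_right l hu0
  have hn1 : (n : ℤ) ≡ 1 [ZMOD 14 * modulus] := by
    have h : n ≡ 1 [MOD 14 * M] := by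
      rw [Nat.ModEq, hn, hlu, Nat.mod_eq_of_lt (by lia)]
    rw [hM]
    exact_mod_cast Int.natCast_modEq_iff.mpr h
  obtain ⟨x, y, d, heq, hd, hx, hy, hdm, hxy⟩ := exists_solution hn1
  have hGneg : horner discCoeff n < 0 :=
    horner_append_neg discCoeff.dropLast (a := -22079488786432) (by norm_num) (Int.natCast_nonneg n)
      fun c hc ↦ (show ∀ c ∈ discCoeff.dropLast, c ≤ 6488009464775981964484139064 by decide)
        c hc |>.trans_lt (by rw [hg]; exact_mod_cast hgl.trans_le hln)
  have hGabs : |horner discCoeff n| ≤ S * n ^ 12 := hS ▸ abs_horner_le discCoeff (by lia)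
  have hGdvd : (l : ℤ) ∣ horner discCoeff n → (l : ℤ) ∣ g := by
    rw [discCoeff, horner_cons, hn, Nat.cast_mul, mul_assoc, hg]
    exact (dvd_add_left (dvd_mul_right _ _)).mp
  generalize horner discCoeff n = G at hd hGneg hGabs hGdvd
  have hd0 : d < 0 := by
    have : (n : ℤ) * G < 0 := mul_neg_of_pos_of_neg (by lia) hGneg
    lia
  obtain ⟨m, rfl⟩ : ∃ m : ℕ, d = -m := ⟨d.natAbs, by lia⟩
  have hlZ : Prime (l : ℤ) := Nat.prime_iff_prime_int.mp hl
  have hlow (a : ℤ) (ha : 0 < a) (hal : a < l) : ¬ (l : ℤ) ∣ a :=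
    fun h ↦ absurd (Int.le_of_dvd ha h) (by lia)
  have hlm : l ∣ m := by
    have h : (l : ℤ) ∣ 1372 * -m := by
      rw [hd, hn]
      exact ⟨u * G, by push_cast; ring⟩
    have h2 := (hlZ.dvd_or_dvd h).resolve_left (hlow _ (by norm_num) (by lia))
    exact_mod_cast (dvd_neg.mp h2)
  have hlm2 : ¬ l ^ 2 ∣ m := by
    rintro ⟨k, hk⟩
    have h : (l : ℤ) * (u * G) = l * (l * (1372 * -k)) := by
      rw [hk] at hd
      push_cast at hd
      rw [← mul_assoc, ← Nat.cast_mul, ← hn, ← hd]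
      ring
    have h2 : (l : ℤ) ∣ u * G := ⟨_, mul_left_cancel₀ hlZ.ne_zero h⟩
    rcases hlZ.dvd_or_dvd h2 with h3 | h3
    · exact hlow u (by lia) (by lia) h3
    · exact hlow g (by lia) (by lia) (hGdvd h3)
  refine ⟨m, by lia, ?_, hlm, hlm2, ?_⟩
  · have h1 : (1 : ℤ) ≤ n := by lia
    have h2 : (m : ℤ) ≤ S * n ^ 13 := by
      rw [abs_of_neg hGneg] at hGabs
      calc (m : ℤ) ≤ n * -G := by lia
        _ ≤ n * (S * n ^ 12) := by gcongr
        _ = S * n ^ 13 := by ring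
    calc m ≤ S * n ^ 13 := by exact_mod_cast h2
      _ ≤ S * (l * (14 * M)) ^ 13 := by rw [hn]; gcongr
      _ = S * (14 * M) ^ 13 * l ^ 13 := by ring
  · intro _
    refine imagQuadField.exists_injective_zmod_three hl (by lia) hlm hlm2 (x := x) (y := y)
      (z := zVal) (fun i ↦ by rw [← heq]; ring) hxy fun j ↦ ?_
    have : Fact (charPrime j).Prime := ⟨charPrime_prime j⟩
    have hcast {a b : ℤ} (h : a ≡ b [ZMOD modulus]) :
        (a : ZMod (charPrime j)) = b :=
      (ZMod.intCast_eq_intCast_iff _ _ _).mpr (h.of_dvd (charPrime_dvd_modulus j))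
    have hm : -(m : ZMod (charPrime j)) = discOne := by exact_mod_cast hcast hdm
    obtain ⟨⟨hδ, h2⟩, hcube, hnot⟩ := residue_conditions j
    refine ⟨charPrime j, ‹_›, sqrtDisc j, hδ.trans hm.symm, ?_, ?_, ?_⟩
    · rw [← hm] at h2
      simpa using h2
    · simpa only [hcast (hy _)] using hcube
    · simpa only [hcast (hy _)] using hnot

end RankFourFamily

theorem card_primeFactors_le_log (n : ℕ) : n.primeFactors.card ≤ Nat.log 2 n := by
  rcases eq_or_ne n 0 with rfl | hn
  · simp
  refine Nat.le_log_of_pow_le one_lt_two ?_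
  calc 2 ^ n.primeFactors.card ≤ ∏ p ∈ n.primeFactors, p :=
        n.primeFactors.pow_card_le_prod _ _ fun p hp ↦ (Nat.prime_of_mem_primeFactors hp).two_le
    _ ≤ n := Nat.le_of_dvd (Nat.pos_of_ne_zero hn) n.prod_primeFactors_dvd

open Filter Asymptotics Real in
/-- A weak form of Chebyshev's lower bound for the number of primes. -/
theorem eventually_le_primeCounting (K B : ℝ) :
    ∀ᶠ n : ℕ in atTop, K * (n + 1 : ℝ) ^ (1 / 3 : ℝ) + B ≤ Nat.primeCounting n := by
  have h1 : (fun x : ℝ ↦ (|K| * x ^ (1 / 3 : ℝ) + (|B| + 1)) * log x) =o[atTop] fun x ↦ x := by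
    have h2 : (fun x : ℝ ↦ |K| * x ^ (1 / 3 : ℝ) + (|B| + 1)) =O[atTop]
        fun x ↦ x ^ (1 / 3 : ℝ) :=
      (isBigO_const_mul_self _ _ _).add
        ((isLittleO_const_left.mpr (Or.inr (tendsto_norm_atTop_atTop.comp
          (tendsto_rpow_atTop (by norm_num))))).isBigO)
    refine (h2.mul_isLittleO (isLittleO_log_rpow_atTop (r := 2 / 3) (by norm_num))).congr'
      EventuallyEq.rfl ?_
    filter_upwards [eventually_gt_atTop 0] with x hx
    rw [← rpow_add hx]
    norm_num
  have hlog2 : (0 : ℝ) < log 2 := log_pos one_lt_two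
  have h3 : Tendsto (fun n : ℕ ↦ (n + 1 : ℝ)) atTop atTop :=
    tendsto_atTop_add_const_right _ _ tendsto_natCast_atTop_atTop
  filter_upwards [h3.eventually (h1.bound (half_pos hlog2)), eventually_ge_atTop 2] with n hn hn2
  have hn2' : (2 : ℝ) ≤ n := by exact_mod_cast hn2
  have hlog : 0 < log n := log_pos (by linarith)
  have hle : log n ≤ log (n + 1) := log_le_log (by linarith) (by linarith)
  have hpow : 0 ≤ (n + 1 : ℝ) ^ (1 / 3 : ℝ) := by positivity
  have hKB : K * (n + 1 : ℝ) ^ (1 / 3 : ℝ) + B ≤ |K| * (n + 1 : ℝ) ^ (1 / 3 : ℝ) + |B| :=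
    add_le_add (mul_le_mul_of_nonneg_right (le_abs_self K) hpow) (le_abs_self B)
  refine hKB.trans ((le_div_iff₀ hlog).mpr ?_ |>.trans (Chebyshev.pi_ge n))
  rw [norm_of_nonneg (mul_nonneg (by positivity) (hlog.le.trans hle)),
    norm_of_nonneg (by positivity)] at hn
  have h4 : (|K| * (n + 1 : ℝ) ^ (1 / 3 : ℝ) + |B|) * log n
      ≤ (|K| * (n + 1 : ℝ) ^ (1 / 3 : ℝ) + |B|) * log (n + 1) := by gcongr
  nlinarith

/-- If primes `l` give rise to fields `ℚ(√-m l)` with `l` exactly dividing `m l = O(l ^ 13)`, then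
there are many pairwise distinct fields among them. -/
theorem exists_many_fields {B C : ℕ} {m : ℕ → ℕ} (hm0 : ∀ l, l.Prime → B < l → 0 < m l)
    (hmC : ∀ l, l.Prime → B < l → m l ≤ C * l ^ 13) (hdvd : ∀ l, l.Prime → B < l → l ∣ m l)
    (hsq : ∀ l, l.Prime → B < l → ¬ l ^ 2 ∣ m l) :
    ∃ X₀ : ℝ, ∀ X : ℝ, X₀ ≤ X → ∃ S : Finset (Subfield ℂ),
      (∀ K ∈ S, ∃ l : ℕ, l.Prime ∧ B < l ∧ (4 * m l : ℝ) < X ∧ K = imagQuadField (m l)) ∧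
      Real.log 2 * X ^ ((1 : ℝ) / 141) / Real.log X ≤ S.card := by
  classical
  set A : ℝ := 4 * C + 1 with hA
  have hA0 : 0 < A := by positivity
  have hlim : Filter.Tendsto (fun X : ℝ ↦ ⌊(X / A) ^ (1 / 13 : ℝ)⌋₊) Filter.atTop Filter.atTop :=
    tendsto_nat_floor_atTop.comp ((tendsto_rpow_atTop (by norm_num)).comp
      (Filter.tendsto_id.atTop_div_const hA0))
  obtain ⟨X₀, hX₀⟩ := Filter.eventually_atTop.mp
    (hlim.eventually (eventually_le_primeCounting (A ^ (1 / 39 : ℝ)) B))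
  refine ⟨max X₀ 2, fun X hX ↦ ?_⟩
  have hX2 : 2 ≤ X := (le_max_right _ _).trans hX
  have hX0 : 0 < X := by linarith
  have hXn := hX₀ X ((le_max_left _ _).trans hX)
  set V : ℝ := (X / A) ^ (1 / 13 : ℝ) with hV
  have hV0 : 0 ≤ V := by positivity
  set n : ℕ := ⌊V⌋₊ with hn
  have hnV : (n : ℝ) ≤ V := Nat.floor_le hV0
  have hV13 : V ^ 13 = X / A := by
    rw [hV, ← Real.rpow_natCast, ← Real.rpow_mul (by positivity)]
    norm_num
  have hCX : (4 * (C * n ^ 13) : ℝ) < X := by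
    calc (4 * (C * n ^ 13) : ℝ) ≤ 4 * (C * V ^ 13) := by gcongr
      _ = 4 * C * (X / A) := by rw [hV13]; ring
      _ < A * (X / A) := by gcongr; linarith
      _ = X := by field_simp
  let P := (Nat.primesLE n).filter (B < ·)
  have hP {l : ℕ} (hl : l ∈ P) : l.Prime ∧ B < l ∧ l ≤ n := by
    simp only [P, Finset.mem_filter, Nat.mem_primesLE] at hl
    exact ⟨hl.1.2, hl.2, hl.1.1⟩
  have hmn {l : ℕ} (hl : l ∈ P) : m l ≤ C * n ^ 13 := by
    obtain ⟨h1, h2, h3⟩ := hP hl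
    exact (hmC l h1 h2).trans (by gcongr)
  have hPcard : X ^ (1 / 141 : ℝ) ≤ P.card := by
    have h1 : Nat.primeCounting n ≤ P.card + B := by
      rw [← Nat.primesLE_card_eq_primeCounting]
      calc (Nat.primesLE n).card ≤ (P ∪ Finset.Ioc 0 B).card := by
            refine Finset.card_le_card fun l hl ↦ ?_
            have := (Nat.mem_primesLE.mp hl).2.pos
            by_cases h : B < l <;> simp [P, hl, h, this, not_lt.mp]
        _ ≤ P.card + B := by simpa using Finset.card_union_le P (Finset.Ioc 0 B)
    have h2 : (Nat.primeCounting n : ℝ) ≤ P.card + B := by exact_mod_cast h1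
    calc X ^ (1 / 141 : ℝ) ≤ X ^ (1 / 39 : ℝ) :=
          Real.rpow_le_rpow_of_exponent_le (by linarith) (by norm_num)
      _ = A ^ (1 / 39 : ℝ) * V ^ (1 / 3 : ℝ) := by
          rw [hV, ← Real.rpow_mul (by positivity), Real.div_rpow hX0.le hA0.le]
          norm_num
          field_simp
      _ ≤ A ^ (1 / 39 : ℝ) * (n + 1 : ℝ) ^ (1 / 3 : ℝ) := by
          have := (Nat.lt_floor_add_one V).le
          gcongr
      _ ≤ P.card := by linarith
  refine ⟨P.image fun l ↦ imagQuadField (m l), fun K hK ↦ ?_, ?_⟩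
  · obtain ⟨l, hl, rfl⟩ := Finset.mem_image.mp hK
    refine ⟨l, (hP hl).1, (hP hl).2.1, lt_of_le_of_lt ?_ hCX, rfl⟩
    have : (m l : ℝ) ≤ C * n ^ 13 := by exact_mod_cast hmn hl
    linarith
  · have hfib := Finset.card_le_mul_card_image (f := fun l ↦ imagQuadField (m l)) P
      (Nat.log 2 (C * n ^ 13)) (by
        intro K hK
        obtain ⟨k, hk, rfl⟩ := Finset.mem_image.mp hK
        have hk0 := hm0 k (hP hk).1 (hP hk).2.1
        calc _ ≤ (m k).primeFactors.card := by
              refine Finset.card_le_card fun l hl ↦ ?_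
              obtain ⟨hlP, hlk⟩ := Finset.mem_filter.mp hl
              obtain ⟨h1, h2, -⟩ := hP hlP
              exact Nat.mem_primeFactors.mpr ⟨h1, imagQuadField.dvd_of_eq h1 (hdvd l h1 h2)
                (hsq l h1 h2) hk0 hlk, hk0.ne'⟩
          _ ≤ Nat.log 2 (m k) := card_primeFactors_le_log _
          _ ≤ Nat.log 2 (C * n ^ 13) := Nat.log_mono_right (hmn hk))
    set s := (P.image fun l ↦ imagQuadField (m l)).card
    have hlogX : 0 < Real.log X := Real.log_pos (by linarith)
    have hT : Nat.log 2 (C * n ^ 13) * Real.log 2 ≤ Real.log X := by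
      rcases Nat.eq_zero_or_pos (C * n ^ 13) with h | h
      · simp [h, hlogX.le]
      rw [← Real.log_pow]
      refine Real.log_le_log (by positivity) ?_
      have h1 : ((2 : ℝ) ^ Nat.log 2 (C * n ^ 13)) ≤ C * n ^ 13 := by
        exact_mod_cast Nat.pow_log_le_self 2 h.ne'
      have h2 : (0 : ℝ) ≤ C * n ^ 13 := by positivity
      linarith
    rw [div_le_iff₀ hlogX]
    calc Real.log 2 * X ^ (1 / 141 : ℝ) ≤ Real.log 2 * (Nat.log 2 (C * n ^ 13) * s : ℕ) := by
          have h1 : (P.card : ℝ) ≤ (Nat.log 2 (C * n ^ 13) * s : ℕ) := by exact_mod_cast hfib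
          have h2 := Real.log_pos one_lt_two
          gcongr
          exact hPcard.trans h1
      _ = s * (Nat.log 2 (C * n ^ 13) * Real.log 2) := by push_cast; ring
      _ ≤ s * Real.log X := by gcongr

/-- There are `≫ X^(1/141)/log X` imaginary quadratic fields `k` with `|Disc(k)| < X` and `rank_3 Cl(k) ≥ 4`. -/
theorem craig_imaginary_quantitative  :
    ∃ c : ℝ, 0 < c ∧ ∃ X₀ : ℝ, ∀ X : ℝ, X₀ ≤ X →
      ∃ S : Finset (Subfield ℂ),
        -- the fields in `S` are pairwise non-isomorphic
        (∀ K ∈ S, ∀ L ∈ S, Nonempty (↥K ≃+* ↥L) → K = L) ∧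
        (∀ K ∈ S,
          -- `K` is a quadratic field of the prescribed signature
          Module.finrank ℚ ↥K = 2 ∧
          (∀ φ : ↥K →+* ℂ, ∃ a : ↥K, (φ a).im ≠ 0) ∧
          NumberField ↥K ∧
          (∀ [NumberField ↥K],
            -- `|Disc K| < X`
            |(NumberField.discr ↥K : ℝ)| < X ∧
            -- the `m`-rank condition on the class group
            ∃ f : (Fin 4 → ZMod 3) →+ Additive (ClassGroup (𝓞 ↥K)), Function.Injective f)) ∧
        c * X ^ ((1 : ℝ) / 141) / Real.log X ≤ S.card := by
  obtain ⟨B, C, h⟩ := RankFourFamily.exists_field_of_prime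
  choose! m hm0 hmC hdvd hsq hf using h
  obtain ⟨X₀, hX₀⟩ := exists_many_fields hm0 hmC hdvd hsq
  refine ⟨Real.log 2, Real.log_pos one_lt_two, X₀, fun X hX ↦ ?_⟩
  obtain ⟨S, hS, hcard⟩ := hX₀ X hX
  refine ⟨S, ?_, fun K hK ↦ ?_, hcard⟩
  · rintro K hK L hL ⟨e⟩
    obtain ⟨k, -, -, -, rfl⟩ := hS K hK
    obtain ⟨l, -, -, -, rfl⟩ := hS L hL
    exact imagQuadField.eq_of_ringEquiv e
  · obtain ⟨l, hl, hB, hlX, rfl⟩ := hS K hK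
    have hm := hm0 l hl hB
    refine ⟨imagQuadField.finrank_eq_two hm, imagQuadField.exists_im_ne_zero hm,
      imagQuadField.numberField hm, fun {_} ↦ ⟨lt_of_le_of_lt ?_ hlX, hf l hl hB⟩⟩
    exact_mod_cast imagQuadField.abs_discr_le hm
end

section
/- There is a constant c > 0 such that for all sufficiently large X, the number of isomorphism classes of real quadratic fields k with |Disc(k)| < X and rank_3 Cl(k) ≥ 3 is at least c·X^(1/141)/log X. -/
open NumberField

/-- If two elements of a Dedekind domain generate coprime ideals and multiply to an `n`-th power,
then the first one generates the `n`-th power of an ideal. -/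
theorem exists_ideal_pow_eq_span {R : Type*} [CommRing R] [IsDedekindDomain R] {a b c : R} {n : ℕ}
    (hab : IsCoprime a b) (h : a * b = c ^ n) :
    ∃ I : Ideal R, Ideal.span {a} = I ^ n := by
  classical
  refine exists_eq_pow_of_mul_eq_pow_of_coprime (R := Ideal R) (b := Ideal.span {b})
    (c := Ideal.span {c}) ?_ ?_
  · rwa [Ideal.isCoprime_span_singleton_iff]
  · rw [Ideal.span_singleton_mul_span_singleton, h, Ideal.span_singleton_pow]

/-- The Selmer-type argument: four elements generating cubes of ideals and independent modulo
cubes produce `(ℤ/3)³` in the class group as soon as the unit group modulo cubes is cyclic. -/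
theorem exists_injective_zmod_three_classGroup {R : Type*} [CommRing R] [IsDedekindDomain R]
    (hunits : ∀ u v : Rˣ, ∃ a b : ℕ, ¬(3 ∣ a ∧ 3 ∣ b) ∧ ∃ w : Rˣ, u ^ a * v ^ b = w ^ 3)
    (γ : Fin 4 → R) (hγ : ∀ i, γ i ≠ 0) (hcube : ∀ i, ∃ I : Ideal R, Ideal.span {γ i} = I ^ 3)
    (hind : ∀ (n : Fin 4 → ℕ) (g : R), ∏ i, γ i ^ n i = g ^ 3 → ∀ i, 3 ∣ n i) :
    ∃ f : (Fin 3 → ZMod 3) →+ Additive (ClassGroup R), Function.Injective f := by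
  classical
  choose I hI using hcube
  have hI0 : ∀ i, I i ∈ nonZeroDivisors (Ideal R) := by
    intro i
    rw [mem_nonZeroDivisors_iff_ne_zero]
    intro h
    have := hI i
    rw [h, zero_pow three_ne_zero, Ideal.zero_eq_bot, Ideal.span_singleton_eq_bot] at this
    exact hγ i this
  let c : Fin 4 → ClassGroup R := fun i => ClassGroup.mk0 ⟨I i, hI0 i⟩
  have hprin : ∀ n : Fin 4 → ℕ, ∏ i, c i ^ n i = 1 →
      ∃ g : R, ∃ u : Rˣ, ∏ i, γ i ^ n i = g ^ 3 * u := by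
    intro n hn
    have h1 : ∏ i, c i ^ n i =
        ClassGroup.mk0 (∏ i, (⟨I i, hI0 i⟩ : nonZeroDivisors (Ideal R)) ^ n i) := by
      simp only [c, map_prod, map_pow]
    rw [h1, ClassGroup.mk0_eq_one_iff] at hn
    obtain ⟨g, hg⟩ := hn.principal
    refine ⟨g, ?_⟩
    have h2 : Ideal.span {g ^ 3} = Ideal.span {∏ i, γ i ^ n i} := by
      rw [← Ideal.span_singleton_pow, ← Ideal.prod_span_singleton]
      simp_rw [← Ideal.span_singleton_pow, hI]
      have h3 : Ideal.span {g} = ∏ i, I i ^ n i := by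
        rw [Ideal.span, ← hg]
        simp
      rw [h3, ← Finset.prod_pow]
      exact Finset.prod_congr rfl fun i _ => pow_right_comm _ _ _
    rw [Ideal.span_singleton_eq_span_singleton] at h2
    obtain ⟨u, hu⟩ := h2
    exact ⟨u, hu.symm⟩
  have hc : ∀ i, c i ^ 3 = 1 := by
    intro i
    have h1 : c i ^ 3 = ClassGroup.mk0 ((⟨I i, hI0 i⟩ : nonZeroDivisors (Ideal R)) ^ 3) := by
      simp only [c, map_pow]
    rw [h1, ClassGroup.mk0_eq_one_iff]
    simp only [SubmonoidClass.mk_pow, ← hI]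
    exact ⟨⟨γ i, rfl⟩⟩
  have hψ : ∀ i, ∃ ψ : ZMod 3 →+ Additive (ClassGroup R),
      ∀ k : ℕ, ψ k = Additive.ofMul (c i ^ k) := by
    intro i
    refine ⟨ZMod.lift 3 ⟨zmultiplesHom _ (Additive.ofMul (c i)), ?_⟩, fun k => ?_⟩
    · rw [zmultiplesHom_apply, natCast_zsmul, ← ofMul_pow, hc i, ofMul_one]
    · rw [← Int.cast_natCast k, ZMod.lift_coe]
      simp
  choose ψ hψ using hψ
  let φ : (Fin 4 → ZMod 3) →+ Additive (ClassGroup R) :=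
    ∑ i, (ψ i).comp (Pi.evalAddMonoidHom (fun _ => ZMod 3) i)
  have hφ : ∀ e, φ e = 0 → ∏ i, c i ^ (e i).val = 1 := by
    intro e he
    have h1 : ∀ i, ψ i (e i) = Additive.ofMul (c i ^ (e i).val) := fun i => by
      rw [← hψ, ZMod.natCast_zmod_val]
    have h2 : φ e = Additive.ofMul (∏ i, c i ^ (e i).val) := by
      simp [φ, h1, ofMul_prod]
    rw [h2] at he
    exact ofMul_eq_zero.mp he
  let N : Submodule (ZMod 3) (Fin 4 → ZMod 3) := AddSubgroup.toZModSubmodule 3 φ.ker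
  have hN : Module.finrank (ZMod 3) N ≤ 1 := by
    by_contra hlt
    obtain ⟨v, hv⟩ := exists_linearIndependent_of_le_finrank (n := 2)
      (by omega : 2 ≤ Module.finrank (ZMod 3) N)
    have hker : ∀ k, ∃ g : R, ∃ u : Rˣ, ∏ i, γ i ^ ((v k : Fin 4 → ZMod 3) i).val = g ^ 3 * u :=
      fun k => hprin _ (hφ _ (v k).2)
    obtain ⟨g, u, h0⟩ := hker 0
    obtain ⟨g', u', h1⟩ := hker 1
    obtain ⟨a, b, hab, w, hw⟩ := hunits u u'
    have hcomb :
        ∏ i, γ i ^ (((v 0 : Fin 4 → ZMod 3) i).val * a + ((v 1 : Fin 4 → ZMod 3) i).val * b) =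
        (g ^ a * g' ^ b * w) ^ 3 := by
      have hw' : (u : R) ^ a * (u' : R) ^ b = (w : R) ^ 3 := by exact_mod_cast congrArg Units.val hw
      simp_rw [pow_add, pow_mul, Finset.prod_mul_distrib, Finset.prod_pow, h0, h1]
      linear_combination (g ^ a * g' ^ b) ^ 3 * hw'
    have hdvd := hind _ _ hcomb
    have hlin : (a : ZMod 3) • v 0 + (b : ZMod 3) • v 1 = 0 := by
      ext i
      have := (ZMod.natCast_eq_zero_iff _ 3).mpr (hdvd i)
      push_cast [ZMod.natCast_zmod_val] at this
      simpa [mul_comm] using this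
    rw [Fintype.linearIndependent_iff] at hv
    have := hv ![a, b] (by simpa [Fin.sum_univ_two] using hlin)
    exact hab ⟨(ZMod.natCast_eq_zero_iff _ 3).mp (by simpa using this 0),
      (ZMod.natCast_eq_zero_iff _ 3).mp (by simpa using this 1)⟩
  obtain ⟨W, hW⟩ := N.exists_isCompl
  have hrank := Submodule.finrank_add_eq_of_isCompl hW
  rw [Module.finrank_fin_fun] at hrank
  obtain ⟨b, hb⟩ := exists_linearIndependent_of_le_finrank (n := 3)
    (by omega : 3 ≤ Module.finrank (ZMod 3) W)
  refine ⟨φ.comp (W.subtype.comp (Fintype.linearCombination (ZMod 3) b)).toAddMonoidHom, ?_⟩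
  rw [injective_iff_map_eq_zero]
  intro x hx
  have hxN : ((Fintype.linearCombination (ZMod 3) b x : W) : Fin 4 → ZMod 3) ∈ N := hx
  have hx0 := (Submodule.disjoint_def.mp hW.disjoint) _ hxN (Subtype.coe_prop _)
  have hx1 : Fintype.linearCombination (ZMod 3) b x = 0 := Subtype.ext hx0
  exact (injective_iff_map_eq_zero _).mp hb.fintypeLinearCombination_injective x hx1

/-- In a number field of degree two with a real embedding, any two units are dependent modulo
cubes. -/
theorem exists_units_pow_mul_pow_eq_cube {K : Type*} [Field K] [NumberField K]
    (h2 : Module.finrank ℚ K = 2) (φ : K →+* ℝ) (u v : (𝓞 K)ˣ) :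
    ∃ a b : ℕ, ¬(3 ∣ a ∧ 3 ∣ b) ∧ ∃ w : (𝓞 K)ˣ, u ^ a * v ^ b = w ^ 3 := by
  have hsub : Subsingleton (Fin (Units.rank K)) := by
    have h1 := InfinitePlace.card_add_two_mul_card_eq_rank K
    have h3 := InfinitePlace.card_eq_nrRealPlaces_add_nrComplexPlaces K
    rw [Fin.subsingleton_iff_le_one, Units.rank]
    omega
  have htors : ∀ ζ ∈ Units.torsion K, ζ ^ 3 = ζ := by
    intro ζ hζ
    have h1 := (Units.mem_torsion K).mp hζ (InfinitePlace.mk (Complex.ofRealHom.comp φ))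
    rw [InfinitePlace.apply] at h1
    simp only [RingHom.coe_comp, Function.comp_apply, Complex.ofRealHom_eq_coe,
      Complex.norm_real, Real.norm_eq_abs] at h1
    have h4 : φ (algebraMap (𝓞 K) K ζ) ^ 2 = 1 := by rw [← sq_abs, h1, one_pow]
    have h5 : ζ ^ 2 = 1 := by
      apply Units.ext
      apply RingOfIntegers.coe_injective
      apply φ.injective
      simpa using h4
    rw [pow_succ, h5, one_mul]
  obtain ⟨⟨ζ, s⟩, hu, -⟩ := Units.exist_unique_eq_mul_prod K u
  obtain ⟨⟨ξ, t⟩, hv, -⟩ := Units.exist_unique_eq_mul_prod K v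
  have hab : ∃ a b : ℕ, ¬(3 ∣ a ∧ 3 ∣ b) ∧ ∀ i, (3 : ℤ) ∣ a * s i + b * t i := by
    rcases isEmpty_or_nonempty (Fin (Units.rank K)) with h | ⟨⟨i⟩⟩
    · exact ⟨1, 0, by decide, fun i => h.elim i⟩
    · simp_rw [fun j => Subsingleton.elim j i]
      have hs : s i % 3 = 0 ∨ s i % 3 = 1 ∨ s i % 3 = 2 := by omega
      have ht : t i % 3 = 0 ∨ t i % 3 = 1 ∨ t i % 3 = 2 := by omega
      have : 3 ∣ s i ∨ 3 ∣ t i ∨ 3 ∣ s i + t i ∨ 3 ∣ s i + 2 * t i := by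
        rcases hs with hs | hs | hs <;> rcases ht with ht | ht | ht <;> omega
      rcases this with h | h | h | h
      exacts [⟨1, 0, by decide, fun _ => by simpa using h⟩,
        ⟨0, 1, by decide, fun _ => by simpa using h⟩,
        ⟨1, 1, by decide, fun _ => by simpa using h⟩,
        ⟨1, 2, by decide, fun _ => by simpa using h⟩]
  obtain ⟨a, b, h3, h⟩ := hab
  choose k hk using h
  refine ⟨a, b, h3, (ζ : (𝓞 K)ˣ) ^ a * (ξ : (𝓞 K)ˣ) ^ b * ∏ i, Units.fundSystem K i ^ k i, ?_⟩
  have hprod : (∏ i, Units.fundSystem K i ^ s i) ^ a * (∏ i, Units.fundSystem K i ^ t i) ^ b =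
      (∏ i, Units.fundSystem K i ^ k i) ^ 3 := by
    rw [← Finset.prod_pow, ← Finset.prod_pow, ← Finset.prod_pow, ← Finset.prod_mul_distrib]
    refine Finset.prod_congr rfl fun i _ => ?_
    rw [← zpow_natCast, ← zpow_mul, ← zpow_natCast (_ ^ t i), ← zpow_mul, ← zpow_add,
      ← zpow_natCast, ← zpow_mul]
    congr 1
    linear_combination hk i
  simp only at hu hv
  calc u ^ a * v ^ b = (ζ : (𝓞 K)ˣ) ^ a * (ξ : (𝓞 K)ˣ) ^ b *
        ((∏ i, Units.fundSystem K i ^ s i) ^ a * (∏ i, Units.fundSystem K i ^ t i) ^ b) := by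
        conv_lhs => rw [hu, hv]
        rw [mul_pow, mul_pow, mul_mul_mul_comm]
    _ = _ := by
        rw [hprod, mul_pow, mul_pow, ← pow_mul, ← pow_mul, mul_comm a, mul_comm b, pow_mul,
          pow_mul, htors _ ζ.2, htors _ ξ.2]

section quadratic

variable {K : Type*} [Field K] [NumberField K] {D : ℤ} {θ : K}

/-- The `ℚ`-basis `1, √D` of a quadratic field. -/
theorem exists_basis_one_sqrt (h2 : Module.finrank ℚ K = 2) (hD : ¬IsSquare D) (hθ : θ ^ 2 = D) :
    ∃ b : Module.Basis (Fin 2) ℚ K, b 0 = 1 ∧ b 1 = θ := by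
  have hli : LinearIndependent ℚ ![(1 : K), θ] := by
    rw [LinearIndependent.pair_iff]
    intro s t hst
    have ht : t = 0 := by
      by_contra ht
      apply hD
      have h1 : (((-s / t) ^ 2 : ℚ) : K) = ((D : ℚ) : K) := by
        have ht' : (t : K) ≠ 0 := by exact_mod_cast ht
        have : θ = ((-s / t : ℚ) : K) := by
          push_cast
          rw [eq_div_iff ht']
          simp only [Rat.smul_def, mul_one] at hst
          linear_combination hst
        rw [Rat.cast_pow, ← this, hθ]
        simp
      have h3 : (-s / t) ^ 2 = (D : ℚ) := by exact_mod_cast h1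
      exact Rat.isSquare_intCast_iff.mp ⟨-s / t, by rw [← h3, sq]⟩
    subst ht
    simpa using hst
  let b := basisOfLinearIndependentOfCardEqFinrank hli (by simp [h2])
  exact ⟨b, by simp [b], by simp [b]⟩

theorem trace_sqrt (h2 : Module.finrank ℚ K = 2) (hD : ¬IsSquare D) (hθ : θ ^ 2 = D) :
    Algebra.trace ℚ K θ = 0 := by
  obtain ⟨b, h0, h1⟩ := exists_basis_one_sqrt h2 hD hθ
  rw [Algebra.trace_eq_matrix_trace b, Matrix.trace_fin_two, Algebra.leftMulMatrix_eq_repr_mul,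
    Algebra.leftMulMatrix_eq_repr_mul, h0, h1, mul_one, ← sq, hθ]
  have h3 : (D : K) = (D : ℚ) • b 0 := by simp [h0, Rat.smul_def]
  rw [h3, ← h1, map_smul, Module.Basis.repr_self, Module.Basis.repr_self]
  simp

theorem trace_one_of_finrank_two (h2 : Module.finrank ℚ K = 2) :
    Algebra.trace ℚ K 1 = 2 := by
  have := Algebra.trace_algebraMap (S := K) (1 : ℚ)
  rw [map_one, h2] at this
  simpa using this

theorem exists_rat_add_rat_mul_sqrt (h2 : Module.finrank ℚ K = 2) (hD : ¬IsSquare D)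
    (hθ : θ ^ 2 = D) (x : K) : ∃ p q : ℚ, x = p + q * θ := by
  obtain ⟨b, h0, h1⟩ := exists_basis_one_sqrt h2 hD hθ
  refine ⟨b.repr x 0, b.repr x 1, ?_⟩
  have := (b.sum_repr x).symm
  rwa [Fin.sum_univ_two, h0, h1, Rat.smul_def, Rat.smul_def, mul_one] at this

/-- `2 D` maps every algebraic integer of `ℚ(√D)` into `ℤ[√D]`. -/
theorem exists_int_add_int_mul_sqrt (h2 : Module.finrank ℚ K = 2) (hD : ¬IsSquare D)
    (hθ : θ ^ 2 = D) (x : 𝓞 K) : ∃ A B : ℤ, 2 * D * (x : K) = A + B * θ := by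
  obtain ⟨p, q, hx⟩ := exists_rat_add_rat_mul_sqrt h2 hD hθ (x : K)
  have hθint : IsIntegral ℤ θ := IsIntegral.of_pow two_pos (hθ ▸ isIntegral_algebraMap)
  let θ' : 𝓞 K := ⟨θ, hθint⟩
  have ht0 := trace_sqrt h2 hD hθ
  have ht1 := trace_one_of_finrank_two h2
  have hp := Algebra.coe_trace_int x
  have hq := Algebra.coe_trace_int (x * θ')
  have hx1 : (x : K) = p • (1 : K) + q • θ := by simp [hx, Rat.smul_def]
  have hx2 : ((x * θ' : 𝓞 K) : K) = p • θ + (q * D) • (1 : K) := by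
    have : ((x * θ' : 𝓞 K) : K) = x * θ := map_mul _ _ _
    rw [this, hx, Rat.smul_def, Rat.smul_def]
    push_cast
    linear_combination (q : K) * hθ
  rw [hx1, map_add, map_smul, map_smul, ht0, ht1] at hp
  rw [hx2, map_add, map_smul, map_smul, ht0, ht1] at hq
  refine ⟨D * Algebra.trace ℤ (𝓞 K) x, Algebra.trace ℤ (𝓞 K) (x * θ'), ?_⟩
  have hp' : ((Algebra.trace ℤ (𝓞 K) x : ℤ) : K) = 2 * p := by
    have := congrArg (Rat.cast : ℚ → K) hp
    push_cast at this
    rw [this]; simp [mul_comm]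
  have hq' : ((Algebra.trace ℤ (𝓞 K) (x * θ') : ℤ) : K) = 2 * (q * D) := by
    have := congrArg (Rat.cast : ℚ → K) hq
    push_cast at this
    rw [this]; simp [mul_comm]
  push_cast
  rw [hp', hq', hx]
  ring

/-- The discriminant of `ℚ(√D)` divides `4 D`, with a square quotient. -/
theorem exists_sq_mul_discr_eq (h2 : Module.finrank ℚ K = 2) (hD : ¬IsSquare D)
    (hθ : θ ^ 2 = D) : ∃ k : ℤ, k ^ 2 * discr K = 4 * D := by
  classical
  have hθint : IsIntegral ℤ θ := IsIntegral.of_pow two_pos (hθ ▸ isIntegral_algebraMap)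
  let θ' : 𝓞 K := ⟨θ, hθint⟩
  have hcard : Fintype.card (Module.Free.ChooseBasisIndex ℤ (𝓞 K)) = 2 := by
    rw [← Module.finrank_eq_card_chooseBasisIndex, RingOfIntegers.rank, h2]
  let e := Fintype.equivFinOfCardEq hcard
  let b := (RingOfIntegers.basis K).reindex e
  let v : Fin 2 → 𝓞 K := ![1, θ']
  have hv : Algebra.discr ℤ v = 4 * D := by
    have ht0 : Algebra.trace ℤ (𝓞 K) θ' = 0 := by
      have := Algebra.coe_trace_int θ'
      rw [show (θ' : K) = θ from rfl, trace_sqrt h2 hD hθ] at this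
      exact_mod_cast this
    have ht1 : Algebra.trace ℤ (𝓞 K) 1 = 2 := by
      have := Algebra.coe_trace_int (1 : 𝓞 K)
      rw [show ((1 : 𝓞 K) : K) = 1 from rfl, trace_one_of_finrank_two h2] at this
      exact_mod_cast this
    have hsq : θ' * θ' = D • (1 : 𝓞 K) := by
      apply RingOfIntegers.coe_injective
      rw [map_mul, map_zsmul, map_one, zsmul_one, ← hθ, sq]
      rfl
    have htD : Algebra.trace ℤ (𝓞 K) (θ' * θ') = D * 2 := by
      rw [hsq, map_zsmul, ht1, smul_eq_mul]
    rw [Algebra.discr_def, Matrix.det_fin_two]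
    simp only [Algebra.traceMatrix_apply, Algebra.traceForm_apply, v, Matrix.cons_val_zero,
      Matrix.cons_val_one, one_mul, mul_one, ht0, htD, ht1]
    ring
  have hb : Algebra.discr ℤ b = discr K := by
    rw [discr, Module.Basis.coe_reindex, Algebra.discr_reindex]
  have := Algebra.discr_of_matrix_vecMul (b : Fin 2 → 𝓞 K) (b.toMatrix v)
  rw [Module.Basis.toMatrix_map_vecMul, hv, hb] at this
  exact ⟨_, this.symm⟩

end quadratic

theorem three_dvd_of_prod_pow_eq {p e : ℕ} [Fact p.Prime] (hp : p = 3 * e + 1)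
    (h2 : (2 : ZMod p) ≠ 0) {d a : ZMod p} (hd : d ≠ 0) {j : Fin 4} {w : Fin 4 → ZMod p}
    (hw : ∀ k ≠ j, w k ^ e = 2 ^ e) (hj : w j ^ e ≠ 2 ^ e) (hj0 : w j ≠ 0) {n : Fin 4 → ℕ}
    (h : (∏ k, w k ^ n k) * (2 * d) ^ 3 = (∏ k, 2 ^ n k) * a ^ 3) : 3 ∣ n j := by
  have hfermat : ∀ x : ZMod p, x ≠ 0 → (x ^ e) ^ 3 = 1 := fun x hx => by
    have := ZMod.pow_card_sub_one_eq_one hx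
    rwa [show p - 1 = e * 3 by omega, pow_mul] at this
  have he : e ≠ 0 := by
    rintro rfl
    exact (Fact.out : p.Prime).ne_one hp
  have hw0 : ∀ k, w k ≠ 0 := fun k => by
    by_cases hk : k = j
    · exact hk ▸ hj0
    · exact (pow_ne_zero_iff he).mp (hw k hk ▸ pow_ne_zero e h2)
  have ha : a ≠ 0 := by
    rintro rfl
    rw [zero_pow three_ne_zero, mul_zero] at h
    exact mul_ne_zero (Finset.prod_ne_zero_iff.mpr fun k _ => pow_ne_zero _ (hw0 k))
      (pow_ne_zero 3 (mul_ne_zero h2 hd)) h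
  have h1 : ∏ k, (w k ^ e) ^ n k = ∏ k, (2 ^ e : ZMod p) ^ n k := by
    have hfermat' : ∀ x : ZMod p, x ≠ 0 → (x ^ 3) ^ e = 1 := fun x hx => by
      rw [pow_right_comm, hfermat x hx]
    have : _ ^ e = _ ^ e := congrArg (· ^ e) h
    rw [mul_pow, mul_pow _ _ e, hfermat' _ (mul_ne_zero h2 hd), hfermat' _ ha, mul_one, mul_one,
      ← Finset.prod_pow, ← Finset.prod_pow] at this
    simpa only [← pow_mul, mul_comm e] using this
  have h3 : ∏ k, (w k ^ e / 2 ^ e) ^ n k = 1 := by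
    simp_rw [div_pow, Finset.prod_div_distrib]
    rw [h1, div_self]
    exact Finset.prod_ne_zero_iff.mpr fun k _ => pow_ne_zero _ (pow_ne_zero _ h2)
  rw [Finset.prod_eq_single j (fun k _ hk => by
    rw [hw k hk, div_self (pow_ne_zero _ h2), one_pow]) (by simp)] at h3
  have hord : orderOf (w j ^ e / 2 ^ e) = 3 := by
    refine orderOf_eq_prime ?_ ?_
    · rw [div_pow, hfermat _ hj0, hfermat _ h2, div_one]
    · rwa [Ne, div_eq_one_iff_eq (pow_ne_zero _ h2)]
  exact hord ▸ orderOf_dvd_of_pow_eq_one h3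

/-- The data certifying that the four elements `(y j + m j √D) / 2` of `ℚ(√D)` are independent
modulo cubes: for each `j`, a residue field of degree one in which `y j + m j √D` fails to be
twice a cube, whereas this holds for the other elements. -/
structure CubicResidueData (D : ℤ) (y m : Fin 4 → ℤ) (p e : Fin 4 → ℕ) : Prop where
  prime (j) : (p j).Prime
  eq (j) : p j = 3 * e j + 1
  two_ne_zero (j) : (2 : ZMod (p j)) ≠ 0
  ne_zero (j) : (D : ZMod (p j)) ≠ 0
  exists_root (j) : ∃ r : ZMod (p j), r * r = D ∧
    (∀ k ≠ j, ((y k : ZMod (p j)) + m k * r) ^ e j = 2 ^ e j) ∧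
    ((y j : ZMod (p j)) + m j * r) ^ e j ≠ 2 ^ e j ∧ (y j : ZMod (p j)) + m j * r ≠ 0

theorem exists_injective_classGroup_of_cubicResidueData {K : Type*} [Field K] [NumberField K]
    {D : ℤ} {θ : K} (h2 : Module.finrank ℚ K = 2) (φ : K →+* ℝ) (hD : ¬IsSquare D)
    (hθ : θ ^ 2 = D) {x y m : Fin 4 → ℤ} {p e : Fin 4 → ℕ}
    (hxy : ∀ i, y i ^ 2 - 4 * x i ^ 3 = m i ^ 2 * D) (hco : ∀ i, IsCoprime (x i) (y i))
    (hres : CubicResidueData D y m p e) :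
    ∃ f : (Fin 3 → ZMod 3) →+ Additive (ClassGroup (𝓞 K)), Function.Injective f := by
  have hroot : ∀ i, ∀ ε : K, ε ^ 2 = 1 → IsIntegral ℤ ((y i + ε * (m i * θ)) / 2) := by
    intro i ε hε
    refine ⟨Polynomial.X ^ 2 - Polynomial.C (y i) * Polynomial.X + Polynomial.C (x i ^ 3),
      by monicity!, ?_⟩
    have := congrArg (Int.cast : ℤ → K) (hxy i)
    push_cast at this
    simp only [Polynomial.eval₂_add, Polynomial.eval₂_sub, Polynomial.eval₂_mul,
      Polynomial.eval₂_pow, Polynomial.eval₂_X, Polynomial.eval₂_C, algebraMap_int_eq]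
    simp only [map_pow, eq_intCast]
    linear_combination (1 / 4 : K) * ((m i : K) ^ 2 * θ ^ 2 * hε + (m i : K) ^ 2 * hθ - this)
  let γ : Fin 4 → 𝓞 K := fun i => ⟨(y i + 1 * (m i * θ)) / 2, hroot i 1 (by simp)⟩
  let γ' : Fin 4 → 𝓞 K := fun i => ⟨(y i + -1 * (m i * θ)) / 2, hroot i (-1) (by simp)⟩
  have hγ : ∀ i, algebraMap (𝓞 K) K (γ i) = (y i + 1 * (m i * θ)) / 2 := fun _ => rfl
  have hγ' : ∀ i, algebraMap (𝓞 K) K (γ' i) = (y i + -1 * (m i * θ)) / 2 := fun _ => rfl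
  have hadd : ∀ i, γ i + γ' i = (y i : 𝓞 K) := fun i => by
    apply RingOfIntegers.coe_injective
    rw [map_add, map_intCast, hγ, hγ']
    ring
  have hmul : ∀ i, γ i * γ' i = (x i : 𝓞 K) ^ 3 := fun i => by
    apply RingOfIntegers.coe_injective
    rw [map_mul, map_pow, map_intCast, hγ, hγ']
    have := congrArg (Int.cast : ℤ → K) (hxy i)
    push_cast at this
    linear_combination (1 / 4 : K) * (this - (m i : K) ^ 2 * hθ)
  have hcop : ∀ i, IsCoprime (γ i) (γ' i) := fun i => by
    obtain ⟨a, b, hab⟩ := (hco i).pow_left (m := 3)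
    have h1 := congrArg (Int.cast : ℤ → 𝓞 K) hab
    push_cast at h1
    rw [← hmul, ← hadd] at h1
    exact ⟨b + a * γ' i, b, by linear_combination h1⟩
  have hind : ∀ (n : Fin 4 → ℕ) (g : 𝓞 K), ∏ i, γ i ^ n i = g ^ 3 → ∀ i, 3 ∣ n i := by
    intro n g hg j
    obtain ⟨A, B, hAB⟩ := exists_int_add_int_mul_sqrt h2 hD hθ g
    have hdvd : (∏ k, (⟨y k, m k⟩ : ℤ√D) ^ n k) * (2 * (D : ℤ√D)) ^ 3 =
        (∏ k, (2 : ℤ√D) ^ n k) * (⟨A, B⟩ : ℤ√D) ^ 3 := by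
      apply Zsqrtd.lift_injective (⟨θ, by rw [← sq, hθ]⟩ : {r : K // r * r = ((D : ℤ) : K)})
        (fun n hn => hD ⟨n, hn⟩)
      have hγ2 : ∀ k, (y k : K) + m k * θ = 2 * γ k := fun k => by
        linear_combination -2 * hγ k
      have hg' : ∏ k, (γ k : K) ^ n k = (g : K) ^ 3 := by
        have := congrArg (algebraMap (𝓞 K) K) hg
        simpa only [map_prod, map_pow] using this
      simp only [map_mul, map_prod, map_pow, map_ofNat, map_intCast, Zsqrtd.lift_apply_apply,
        hγ2, ← hAB, mul_pow, Finset.prod_mul_distrib, hg']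
      ring
    have := Fact.mk (hres.prime j)
    obtain ⟨r, hr, hk, hj, hj0⟩ := hres.exists_root j
    have := congrArg (Zsqrtd.lift ⟨r, hr⟩) hdvd
    simp only [map_mul, map_prod, map_pow, map_ofNat, map_intCast,
      Zsqrtd.lift_apply_apply] at this
    exact three_dvd_of_prod_pow_eq (hres.eq j) (hres.two_ne_zero j) (hres.ne_zero j) hk hj hj0 this
  refine exists_injective_zmod_three_classGroup (exists_units_pow_mul_pow_eq_cube h2 φ) γ ?_
    (fun i => exists_ideal_pow_eq_span (hcop i) (hmul i)) hind
  intro i h0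
  have h := hind (fun k => if k = i then 1 else 0) 0 ?_ i
  · simp at h
  · rw [zero_pow three_ne_zero]
    exact Finset.prod_eq_zero (Finset.mem_univ i) (by simp [h0])

theorem isSquare_mul_of_sq_eq {K : Type*} [Field K] [NumberField K] {D D' : ℤ} {θ x : K}
    (h2 : Module.finrank ℚ K = 2) (hD : ¬IsSquare D) (hD' : ¬IsSquare D') (hθ : θ ^ 2 = D)
    (hx : x ^ 2 = D') : IsSquare (D * D') := by
  obtain ⟨p, q, rfl⟩ := exists_rat_add_rat_mul_sqrt h2 hD hθ x
  have h : (((2 * p * q : ℚ) : K)) * θ = ((D' - p ^ 2 - q ^ 2 * D : ℚ) : K) := by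
    push_cast
    linear_combination hx - (q : K) ^ 2 * hθ
  by_cases hpq : 2 * p * q = 0
  · rw [hpq, Rat.cast_zero, zero_mul, eq_comm, Rat.cast_eq_zero] at h
    rcases mul_eq_zero.mp hpq with hp | hq
    · have hp : p = 0 := by simpa using hp
      refine Rat.isSquare_intCast_iff.mp ⟨q * D, ?_⟩
      push_cast
      rw [hp] at h
      linear_combination (D : ℚ) * h
    · refine absurd (Rat.isSquare_intCast_iff.mp ⟨p, ?_⟩) hD'
      rw [hq] at h
      linear_combination h
  · refine absurd (Rat.isSquare_intCast_iff.mp ⟨(D' - p ^ 2 - q ^ 2 * D) / (2 * p * q), ?_⟩) hD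
    have h1 : ((((D' - p ^ 2 - q ^ 2 * D) / (2 * p * q) : ℚ) ^ 2 : ℚ) : K) = ((D : ℚ) : K) := by
      rw [Rat.cast_pow, Rat.cast_div, ← h, mul_div_cancel_left₀ _ (by exact_mod_cast hpq), hθ,
        Rat.cast_intCast]
    rw [← sq]
    exact_mod_cast h1.symm

/-- The subfield `ℚ(√D)` of `ℂ`, for `0 ≤ D`. -/
noncomputable def quadraticSubfield (D : ℤ) : Subfield ℂ :=
  (IntermediateField.adjoin ℚ {((√(D : ℝ) : ℝ) : ℂ)}).toSubfield

section quadraticSubfield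

variable {D : ℤ}

theorem ofReal_sqrt_sq (hpos : 0 < D) : ((√(D : ℝ) : ℝ) : ℂ) ^ 2 = D := by
  rw [← Complex.ofReal_pow, Real.sq_sqrt (by exact_mod_cast hpos.le), Complex.ofReal_intCast]

theorem exists_sq_eq_quadraticSubfield (hpos : 0 < D) :
    ∃ θ : quadraticSubfield D, θ ^ 2 = (D : quadraticSubfield D) := by
  refine ⟨⟨((√(D : ℝ) : ℝ) : ℂ), IntermediateField.mem_adjoin_simple_self ℚ _⟩, ?_⟩
  apply Subtype.ext
  simpa using ofReal_sqrt_sq hpos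

theorem finrank_quadraticSubfield (hpos : 0 < D) (hD : ¬IsSquare D) :
    Module.finrank ℚ (quadraticSubfield D) = 2 := by
  let e : quadraticSubfield D ≃+* IntermediateField.adjoin ℚ {((√(D : ℝ) : ℝ) : ℂ)} :=
    RingEquiv.refl _
  rw [(e.toAddEquiv.toLinearEquiv fun (c : ℚ) x => map_rat_smul e c x).finrank_eq]
  have hroot : Polynomial.aeval ((√(D : ℝ) : ℝ) : ℂ)
      (Polynomial.X ^ 2 - Polynomial.C (D : ℚ)) = 0 := by
    simp [ofReal_sqrt_sq hpos]
  have hmonic := Polynomial.monic_X_pow_sub_C (D : ℚ) two_ne_zero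
  have hirr : Irreducible (Polynomial.X ^ 2 - Polynomial.C (D : ℚ)) := by
    refine X_pow_sub_C_irreducible_of_prime Nat.prime_two fun b hb => hD ?_
    exact Rat.isSquare_intCast_iff.mp ⟨b, by rw [← hb, sq]⟩
  rw [IntermediateField.adjoin.finrank ⟨_, hmonic, hroot⟩,
    ← minpoly.eq_of_irreducible_of_monic hirr hroot hmonic, Polynomial.natDegree_X_pow_sub_C]

theorem numberField_quadraticSubfield (hpos : 0 < D) (hD : ¬IsSquare D) :
    NumberField (quadraticSubfield D) where
  to_finiteDimensional := Module.finite_of_finrank_pos (by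
    rw [finrank_quadraticSubfield hpos hD]; exact two_pos)

theorem im_eq_zero_of_quadraticSubfield (hpos : 0 < D) (hD : ¬IsSquare D)
    (φ : quadraticSubfield D →+* ℂ) (a : quadraticSubfield D) : (φ a).im = 0 := by
  have := numberField_quadraticSubfield hpos hD
  obtain ⟨θ, hθ⟩ := exists_sq_eq_quadraticSubfield hpos
  obtain ⟨p, q, rfl⟩ := exists_rat_add_rat_mul_sqrt (finrank_quadraticSubfield hpos hD) hD hθ a
  have h : (φ θ) ^ 2 = ((√(D : ℝ) : ℝ) : ℂ) ^ 2 := by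
    rw [ofReal_sqrt_sq hpos, ← map_pow, hθ, map_intCast]
  rcases sq_eq_sq_iff_eq_or_eq_neg.mp h with h | h <;> simp [h]

theorem isSquare_mul_of_ringEquiv {D' : ℤ} (hpos : 0 < D) (hD : ¬IsSquare D)
    (hpos' : 0 < D') (hD' : ¬IsSquare D')
    (h : Nonempty (quadraticSubfield D ≃+* quadraticSubfield D')) : IsSquare (D * D') := by
  have := numberField_quadraticSubfield hpos hD
  obtain ⟨θ, hθ⟩ := exists_sq_eq_quadraticSubfield hpos
  obtain ⟨θ', hθ'⟩ := exists_sq_eq_quadraticSubfield hpos'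
  obtain ⟨f⟩ := h
  refine isSquare_mul_of_sq_eq (finrank_quadraticSubfield hpos hD) hD hD' hθ (x := f.symm θ') ?_
  rw [← map_pow, hθ', map_intCast]

theorem abs_discr_quadraticSubfield_le (hpos : 0 < D) (hD : ¬IsSquare D)
    [NumberField (quadraticSubfield D)] : |discr (quadraticSubfield D)| ≤ 4 * D := by
  obtain ⟨θ, hθ⟩ := exists_sq_eq_quadraticSubfield hpos
  obtain ⟨k, hk⟩ := exists_sq_mul_discr_eq (finrank_quadraticSubfield hpos hD) hD hθ
  have hk0 : k ≠ 0 := by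
    rintro rfl
    simp at hk
    omega
  have h1 : 0 < k ^ 2 := by positivity
  have h2 : 0 ≤ discr (quadraticSubfield D) := by nlinarith
  rw [abs_of_nonneg h2]
  nlinarith

theorem exists_injective_classGroup_quadraticSubfield (hpos : 0 < D) (hD : ¬IsSquare D)
    [NumberField (quadraticSubfield D)] {x y m : Fin 4 → ℤ} {p e : Fin 4 → ℕ}
    (hxy : ∀ i, y i ^ 2 - 4 * x i ^ 3 = m i ^ 2 * D) (hco : ∀ i, IsCoprime (x i) (y i))
    (hres : CubicResidueData D y m p e) :
    ∃ f : (Fin 3 → ZMod 3) →+ Additive (ClassGroup (𝓞 (quadraticSubfield D))),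
      Function.Injective f := by
  obtain ⟨θ, hθ⟩ := exists_sq_eq_quadraticSubfield hpos
  have hreal : ComplexEmbedding.IsReal (quadraticSubfield D).subtype := by
    ext a
    exact Complex.conj_eq_iff_im.mpr (im_eq_zero_of_quadraticSubfield hpos hD _ a)
  exact exists_injective_classGroup_of_cubicResidueData (finrank_quadraticSubfield hpos hD)
    hreal.embedding hD hθ hxy hco hres

end quadraticSubfield

/-- Evaluation of the polynomial with coefficients `l`, lowest degree first. -/
def hornerEval (l : List ℤ) (z : ℤ) : ℤ := l.foldr (fun c a => c + z * a) 0

@[simp] theorem hornerEval_nil (z : ℤ) : hornerEval [] z = 0 := rfl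

@[simp] theorem hornerEval_cons (c : ℤ) (l : List ℤ) (z : ℤ) :
    hornerEval (c :: l) z = c + z * hornerEval l z := rfl

theorem hornerEval_modEq (l : List ℤ) {n z w : ℤ} (h : z ≡ w [ZMOD n]) :
    hornerEval l z ≡ hornerEval l w [ZMOD n] := by
  induction l with
  | nil => rfl
  | cons c l ih => exact (h.mul ih).add_left c

theorem exists_forall_hornerEval_append_pos (l : List ℤ) {c : ℤ} (hc : 0 < c) :
    ∃ N : ℤ, ∀ z ≥ N, 0 < hornerEval (l ++ [c]) z := by
  induction l with
  | nil => exact ⟨0, fun z _ => by simpa using hc⟩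
  | cons b l ih =>
    obtain ⟨N, hN⟩ := ih
    refine ⟨max N (|b| + 1), fun z hz => ?_⟩
    have h1 := hN z (le_of_max_le_left hz)
    have h2 := le_of_max_le_right hz
    have h3 := neg_abs_le b
    have h4 := abs_nonneg b
    rw [List.cons_append, hornerEval_cons]
    nlinarith

theorem exists_forall_hornerEval_le (l : List ℤ) :
    ∃ C : ℤ, 0 < C ∧ ∀ z ≥ 1, |hornerEval l z| ≤ C * z ^ l.length := by
  induction l with
  | nil => exact ⟨1, one_pos, fun z _ => by simp⟩
  | cons b l ih =>
    obtain ⟨C, hC, h⟩ := ih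
    refine ⟨|b| + C, by positivity, fun z hz => ?_⟩
    have h1 : 1 ≤ z ^ (l.length + 1) := one_le_pow₀ hz
    have h2 := abs_nonneg b
    calc |hornerEval (b :: l) z| ≤ |b| + |z * hornerEval l z| := abs_add_le _ _
      _ = |b| + z * |hornerEval l z| := by rw [abs_mul, abs_of_pos (a := z) (by omega)]
      _ ≤ |b| * z ^ (l.length + 1) + z * (C * z ^ l.length) := by
        gcongr
        · nlinarith
        · exact h z hz
      _ = (|b| + C) * z ^ (b :: l).length := by
        rw [List.length_cons]
        ring

/-- Coefficients of the polynomials `xᵢ` with `yᵢ ^ 2 - 4 * xᵢ ^ 3 = mᵢ ^ 2 * D`. -/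
def normCoeffs : Fin 4 → List ℤ :=
  ![
    [1099511627776, 305531088535552, -2822587746877440, -17281887712051200, -44025027624960000,
     -108034846053120000, 49969208921400000, 328315514952937500, -138780043083984375],
    [53876069761024, -210592983941120, 8837658574848000, 39884680593408000, 116251164917760000,
     243728493523200000, 40428113940000000, -408479145022968750, 709038363448828125],
    [185817465094144, -4303321007390720, 51291170537472000, 301004483985408000, 834201316392960000,
     2011958273203200000, 65339771130000000, -4687062186653437500, 3368032843925390625],
    [53876069761024, -624063043076096, -3140628397424640, 11580549051187200, 60045237387264000,
     240726165926400000, 543820043779200000, -155935994365687500, -63093373758984375]]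

/-- Coefficients of the polynomials `yᵢ` with `yᵢ ^ 2 - 4 * xᵢ ^ 3 = mᵢ ^ 2 * D`. -/
def traceCoeffs : Fin 4 → List ℤ :=
  ![
    [2305843009213693952, -1584218856021144109056, -8698154868388782931968,
     535778393382999765811200, 708427509071178262118400, -21315667543316980826112000,
     -56481075279452732129280000, 94970708011706749747200000, 287619270296952622464000000,
     -147703729221515198700000000, -352427491611457083815625000, 153354475610227789189453125,
     6878179225628683593750000],
    [-790904152160297025536, 120587375942055776747520, -3652986785875186050662400,
     46715741865189090263040000, -59579403212613589401600000, -3302490341074719788236800000,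
     -8874123291292003467264000000, 7471161118483073556480000000, 31090362702531894576000000000,
     -20865267888068119297500000000, -36380866874833169095078125000, 44398911753093672145458984375,
     -13008483997931487137695312500],
    [-5065937091242485612544, 194084365456887596974080, -4427526793449497532825600,
     40822371875112206991360000, -102754368063381543321600000, -3491687695846800044851200000,
     -9448822160771432841216000000, 6031578084412211896320000000, 28993485391784601552000000000,
     -22735682906263016602500000000, -36653548111136618095546875000, 50002809101896947301318359375,
     -17905806323744597085937500000],
    [790904152160297025536, -13749348924873768960000, -28683149398393233604608,
     705307871440361068953600, 2905829400555391706726400, -5637377356131553247232000,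
     289308346508032081920000, 269651169578241250099200000, 643606502733805313664000000,
     284099896074145286700000000, 125593261086943648715625000, -411602688294962501689453125,
     98662185033721734375000000]]

/-- The multipliers `mᵢ` in `yᵢ ^ 2 - 4 * xᵢ ^ 3 = mᵢ ^ 2 * D`. -/
def multiplier : Fin 4 → ℤ := ![1, 125, 125, 1]

/-- Coefficients of the polynomial `D / z`, where `yᵢ ^ 2 - 4 * xᵢ ^ 3 = mᵢ ^ 2 * D`. -/
def reducedDiscCoeffs : List ℤ :=
  [-11738293007948845772578063947920150888448, 1278920837176413751670152106112614657949696,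
   -61046329870329246822795204183826499104669696, 1578036855448819788723179036445302686947999744,
   -22445156706878744033679604349535007951080652800,
   117239850422885251104721511530259867892291993600,
   1047822628849446429514146432299878915969646592000,
   -15275862264882607461396686427624679253433384960000,
   -30980404313885046090753597283121006048496844800000,
   795145160087526456512220825068782189654573056000000,
   3888295636755933950561639959446048628361134080000000,
   1535157903727876643734939949161621636094361600000000,
   -21712292273534553639811567384653416122810368000000000,
   -22377658815479684905376135368327836614000640000000000,
   68392792452821145034676950886855289392332800000000000,
   64562196471863443202595034980565644754944000000000000,
   -162771740896757023754183820240549331614720000000000000,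
   -59713700916795141521694462456734127032400000000000000,
   261407515224890133095706859107102741646875000000000000,
   -85580920229638019835282498899449915576552734375000000,
   -172070880931608197908387113947371801821350097656250000,
   186631656788338015425758723722620847660160064697265625,
   -73770290112696124793182779945771957664489746093750000,
   10738868555583731966646771006554200887680053710937500]

/-- Cofactors of the `xᵢ` in a Bézout relation between `xᵢ` and `yᵢ`. -/
def bezoutNormCoeffs : Fin 4 → List ℤ :=
  ![
    [33659911282402951694287980992533911770395247559064785109704881863712914284740608,
     367070327745309532102055199273760406985309029071965493704897702678065707621548032,
     -8472587467840965600288224545000885074316086639824106285701516177877604436793098240,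
     -22458247893060493361247849095134306715836560162494994526285559790141962902201958400,
     293329362271371256343511496489019371057456617953677540620217366314670080512753664000,
     884790725936168883629804665444065190313078152643269452797257885472115656876359680000,
     -1281704400793513381217012468368168846957018552000288107141540509712810911053824000000,
     -4299246331788928473467004412864099455882504062997207539997134196663379783803264000000,
     2031819373646413255063758034598017468909377821017245032394240600154031176681710000000,
     5227822541090713169695402911000731208108344650363907044409651558361613981379446875000,
     -2244796621148460702469261216857723025166458217484305124553677049578969248176259765625,
     -100807536766578960818229163260473593894122227050750587768101214870100591792968750000],
    [337301324895738012284842451977012280015494844910472037931483547618118629064704,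
     2386756374038763851642969845310777515570778921697168065892764550557032974909440,
     -104637349602889032661225442877573232664678247136940911533160397512602325876736000,
     157252824899199026961006171723271567221485039611193486104169739777191360593920000,
     5904772908921299721476689625978835086657149051204942643042720727318081935769600000,
     14754784882087256081570127757578041583909435977417259345448043813252429001523200000,
     -13795165992264382143941226078266099702027969146764111147730575698769371056128000000,
     -51335471088677236144638911958281882465850131001815430570613780877430279350400000000,
     36518747508278288325397905463778455505587652658972942681075449190221222237250000000,
     58863711347693628374832117823776761015079167588340034369466676518903012525390625000,
     -73521792008221381369150080501882631404510762260077647621894920028806307352353515625,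
     21685161202723919946240390044193390764402432801820968712245233145002082618554687500],
    [-1381082901739259782086380979913804159236441764755429761196628823726708752384,
     -41407166471896718737375947517961829024955539881846920943328875440834336522240,
     595398626863161760666981115122398726009924430809135067706604363207248183296000,
     -18488607132758224050741363834390997127291123070321900190274212227323422310400000,
     -168890550036426943150646718519862884258312369307572395638300242718004084736000000,
     -338682611437594592108014628787213026448087450109661645243923249044699886387200000,
     335221687047155385194086792700894618360979351522414944386860372938909595648000000,
     1033698178000854404039139044228567589398903326380073598652711900213386352000000000,
     -1003656388728400270458388499668446824082979727905755027901199361060586170750000000,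
     -1244944087840990735092928828634436050023609874234609747175638735844825423984375000,
     1875126877424690650035622751038371716893598892615386746411810558375602015439453125,
     -694667624408260382143481589395531680190435829799071481074357090075627295312500000],
    [175087721034287582828997619230898732059286193961955620430078291940039981006848,
     -497168698875645954807763007766828225686902920403037786721429679928300680511488,
     -14081733719165511450237801947889318783748245768406676286494997067282009177456640,
     -43104548859604876192838824029041446221201962690322290717542361513924187547238400,
     60619517764319372618727387703792088937013710771215502364868943396720579969024000,
     -333136410804452565656035365346731759751989442702157728618809332572609401323520000,
     -5062481732110815074707506390070585692276823035518539950936522161171129382912000000,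
     -10971045619843871173228989918357350332309111808034579921846702443499255690624000000,
     -4759064207609182962068292092135600131510863324905118776705341026262298883090000000,
     -1761239729145824549666543058122875622171557704967183449986182764340103258240625000,
     6762604425569847824935293674612195935763692215772294322539622235420420698232421875,
     -1640765569674167533065149286759641010611996654508399062895553499036244890625000000]]

/-- Cofactors of the `yᵢ` in a Bézout relation between `xᵢ` and `yᵢ`. -/
def bezoutTraceCoeffs : Fin 4 → List ℤ :=
  ![
    [6699549967934312362968075205393727487978598521160694295478268311495507968,
     -32176536449508142156256713940358620246601820464185678557015201620814725120,
     -229238423102603868543605709014172491904728470123867107204540774532566220800,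
     -601712604454814242728941465804210483613289614359084493904617217319542784000,
     -1625970044428703413247135765826556514717047879225764384418035946156997760000,
     608289507610958530737927482609806039394608151508688028165528941518783600000,
     4868081694160808125525498444047093459161492783779252674102407113568766937500,
     -2033979318760400240682642019278042599459914553573813028198466337892357421875],
    [-377507499693286382109010108428162557604562480788139141368712857124864,
     15214386716604095073070779516692813471816998437273914618333461531852800,
     68988803803178796178529472617040289091015154715813214084402972511436800,
     202593034846651482552760093537911980935766025825202876373050499145728000,
     411100343038326892083587129628895503605276920504730793286973606467200000,
     46160174582403190035547675706296438772488615351248387325546859125500000,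
     -654158957044549303590960700399678163719846253545984750344737208480281250,
     1181967953586928768747624096522573725012159086457716947897386035453671875],
    [-75542688090821651270019841542940363770065668803369650022673215913984,
     -3239792763696892252353446233421751509616411706343733372679129084723200,
     -15069159278506470527914030542388977044440195825372457863625212900147200,
     -39771983850424389386570668801482173678747650732734649509582899740672000,
     -77231805388888194445393337633142730063027853168735943814591330982400000,
     13702404935205889398729323836626961784525957896505805836797918743000000,
     169655520186574591307683105748968044681132478460188532249070064217062500,
     -130665066532974779060393363381457294863357781221579031125946719601796875],
    [-11766520792808430773031984818883777162039967162797982410959364401659904,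
     -32533308169246436604561779833655635255844059599864101012792286463918080,
     269914686509253026914429838217031457906896373964511050914650940610969600,
     1292689142006936730665324922410958615424314812119105862435539403554816000,
     4432964928627972690998015090576074740306963177186098268150002253031680000,
     8903083484520182677213720685561299184191803758209637937433877219825400000,
     -2645933465321430585655226168353790959639107123687754869745275236957062500,
     -1049251395587302208989627016313851329637004133753023850658399363581640625]]

/-- Right-hand sides of the Bézout relations between `xᵢ` and `yᵢ`. -/
def bezoutConstant : Fin 4 → ℤ :=
  ![52457574303349778684775238290201981494628424895115117296434191081497525240884346499937337344,
   18471041959547674688688585508629135192742693662569496293549530889553619651091833578061824000,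
   126065181685401382444499395954253316494604856170222577992191242538985532287553923710976000,
   126848121229329067745709954537767544456527761567682402733660549850994077588003833992183808]

/-- The modulus of the residue class of the parameter. -/
def paramModulus : ℕ := 226552134870519239771701809687085576841218874335920

/-- The polynomial `D` with `yᵢ ^ 2 - 4 * xᵢ ^ 3 = mᵢ ^ 2 * D`. -/
def familyDisc (z : ℤ) : ℤ := z * hornerEval reducedDiscCoeffs z

theorem trace_sq_sub_four_mul_norm_cube (i : Fin 4) (z : ℤ) :
    hornerEval (traceCoeffs i) z ^ 2 - 4 * hornerEval (normCoeffs i) z ^ 3 =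
      multiplier i ^ 2 * familyDisc z := by
  fin_cases i <;> simp [traceCoeffs, normCoeffs, multiplier, familyDisc, reducedDiscCoeffs] <;> ring

theorem bezout_norm_trace (i : Fin 4) (z : ℤ) :
    hornerEval (bezoutNormCoeffs i) z * hornerEval (normCoeffs i) z +
      hornerEval (bezoutTraceCoeffs i) z * hornerEval (traceCoeffs i) z = bezoutConstant i := by
  fin_cases i <;>
    simp [traceCoeffs, normCoeffs, bezoutNormCoeffs, bezoutTraceCoeffs, bezoutConstant] <;> ring

theorem bezoutConstant_dvd (i : Fin 4) : bezoutConstant i ∣ (paramModulus : ℤ) ^ 89 := by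
  revert i
  decide +kernel

theorem isCoprime_norm_trace {z : ℤ} (hz : z ≡ 19 [ZMOD paramModulus]) (i : Fin 4) :
    IsCoprime (hornerEval (normCoeffs i) z) (hornerEval (traceCoeffs i) z) := by
  rw [Int.isCoprime_iff_gcd_eq_one]
  by_contra h
  obtain ⟨p, hp, hdvd⟩ := Nat.exists_prime_and_dvd h
  have hx := (Int.natCast_dvd_natCast.mpr hdvd).trans (Int.gcd_dvd_left _ _)
  have hy := (Int.natCast_dvd_natCast.mpr hdvd).trans (Int.gcd_dvd_right _ _)
  have hM : (p : ℤ) ∣ paramModulus := by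
    refine (Nat.prime_iff_prime_int.mp hp).dvd_of_dvd_pow (n := 89)
      (dvd_trans ?_ (bezoutConstant_dvd i))
    rw [← bezout_norm_trace i z]
    exact (hx.mul_left _).add (hy.mul_left _)
  have h19 := hz.of_dvd hM
  have hx' := (hornerEval_modEq _ h19).dvd_iff.mp hx
  have hy' := (hornerEval_modEq _ h19).dvd_iff.mp hy
  have hone : ∀ i, Int.gcd (hornerEval (normCoeffs i) 19) (hornerEval (traceCoeffs i) 19) = 1 := by
    decide +kernel
  exact hp.one_lt.ne' (Nat.dvd_one.mp (hone i ▸ Int.dvd_gcd hx' hy'))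

theorem familyDisc_modEq {n z w : ℤ} (h : z ≡ w [ZMOD n]) :
    familyDisc z ≡ familyDisc w [ZMOD n] :=
  h.mul (hornerEval_modEq _ h)

theorem not_isSquare_familyDisc {z : ℤ} (hz : z ≡ 19 [ZMOD paramModulus]) :
    ¬IsSquare (familyDisc z) := by
  rintro ⟨r, hr⟩
  have h8 : familyDisc z ≡ 5 [ZMOD 8] :=
    (familyDisc_modEq (hz.of_dvd (by decide +kernel))).trans (by decide +kernel)
  rw [hr, Int.ModEq, Int.mul_emod] at h8
  have : r % 8 = 0 ∨ r % 8 = 1 ∨ r % 8 = 2 ∨ r % 8 = 3 ∨ r % 8 = 4 ∨ r % 8 = 5 ∨ r % 8 = 6 ∨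
      r % 8 = 7 := by omega
  rcases this with h | h | h | h | h | h | h | h <;> simp [h] at h8

theorem CubicResidueData.of_modEq {D D' : ℤ} {y y' m : Fin 4 → ℤ} {p e : Fin 4 → ℕ}
    (h : CubicResidueData D y m p e) (hD : ∀ j, D' ≡ D [ZMOD p j])
    (hy : ∀ j k, y' k ≡ y k [ZMOD p j]) : CubicResidueData D' y' m p e where
  prime := h.prime
  eq := h.eq
  two_ne_zero := h.two_ne_zero
  ne_zero j := by simpa only [(ZMod.intCast_eq_intCast_iff _ _ _).mpr (hD j)] using h.ne_zero j
  exists_root j := by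
    simpa only [(ZMod.intCast_eq_intCast_iff _ _ _).mpr (hD j),
      fun k => (ZMod.intCast_eq_intCast_iff _ _ _).mpr (hy j k)] using h.exists_root j

theorem CubicResidueData.of_int {D : ℤ} {y m ρ : Fin 4 → ℤ} {p e : Fin 4 → ℕ}
    (hprime : ∀ j, (p j).Prime) (heq : ∀ j, p j = 3 * e j + 1) (h2 : ∀ j, ¬(p j : ℤ) ∣ 2)
    (h0 : ∀ j, ¬(p j : ℤ) ∣ D) (hρ : ∀ j, (p j : ℤ) ∣ ρ j * ρ j - D)
    (hk : ∀ j k, k ≠ j → (p j : ℤ) ∣ (y k + m k * ρ j) ^ e j - 2 ^ e j)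
    (hj : ∀ j, ¬(p j : ℤ) ∣ (y j + m j * ρ j) ^ e j - 2 ^ e j)
    (hj0 : ∀ j, ¬(p j : ℤ) ∣ y j + m j * ρ j) : CubicResidueData D y m p e where
  prime := hprime
  eq := heq
  two_ne_zero j := by simpa using mt (ZMod.intCast_zmod_eq_zero_iff_dvd 2 (p j)).mp (h2 j)
  ne_zero j := mt (ZMod.intCast_zmod_eq_zero_iff_dvd D (p j)).mp (h0 j)
  exists_root j := by
    refine ⟨ρ j, ?_, fun k hkj => ?_, fun h => hj j ?_, fun h => hj0 j ?_⟩
    · simpa [sub_eq_zero] using (ZMod.intCast_zmod_eq_zero_iff_dvd _ (p j)).mpr (hρ j)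
    · simpa [sub_eq_zero] using (ZMod.intCast_zmod_eq_zero_iff_dvd _ (p j)).mpr (hk j k hkj)
    · exact (ZMod.intCast_zmod_eq_zero_iff_dvd _ _).mp (by simpa [sub_eq_zero] using h)
    · exact (ZMod.intCast_zmod_eq_zero_iff_dvd _ _).mp (by simpa using h)

/-- Four primes with residue fields separating the four elements modulo cubes. -/
def residuePrime : Fin 4 → ℕ := ![991, 769, 463, 1627]

theorem cubicResidueData_familyDisc {z : ℤ} (hz : z ≡ 19 [ZMOD paramModulus]) :
    CubicResidueData (familyDisc z) (fun i => hornerEval (traceCoeffs i) z) multiplier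
      residuePrime ![330, 256, 154, 542] := by
  have hdvd : ∀ j, (residuePrime j : ℤ) ∣ paramModulus := by decide +kernel
  have h19 : CubicResidueData (familyDisc 19) (fun i => hornerEval (traceCoeffs i) 19) multiplier
      residuePrime ![330, 256, 154, 542] := by
    refine CubicResidueData.of_int (ρ := ![64, 204, 189, 506]) ?_ ?_ ?_ ?_ ?_ ?_ ?_ ?_
    · intro j
      fin_cases j <;> norm_num [residuePrime]
    all_goals decide +kernel
  exact h19.of_modEq (fun j => familyDisc_modEq (hz.of_dvd (hdvd j)))
    fun j k => hornerEval_modEq _ (hz.of_dvd (hdvd j))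

theorem quadraticSubfield_le_of_isSquare_mul {D D' : ℤ} (hpos : 0 < D)
    (h : IsSquare (D * D')) : quadraticSubfield D' ≤ quadraticSubfield D := by
  obtain ⟨s, hs⟩ := h
  have hDR : (0 : ℝ) < D := by exact_mod_cast hpos
  have h1 : √(D' : ℝ) = |s| / D * √(D : ℝ) := by
    have h2 : √(D : ℝ) * √(D' : ℝ) = |(s : ℝ)| := by
      rw [← Real.sqrt_mul hDR.le, ← Real.sqrt_mul_self_eq_abs]
      exact_mod_cast congrArg (fun t : ℤ => √(t : ℝ)) hs
    have h3 := Real.mul_self_sqrt hDR.le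
    rw [Int.cast_abs, ← h2, div_mul_eq_mul_div, eq_div_iff hDR.ne']
    linear_combination (-√(D' : ℝ)) * h3
  refine (IntermediateField.adjoin_simple_le_iff (F := ℚ)
    (K := IntermediateField.adjoin ℚ {((√(D : ℝ) : ℝ) : ℂ)})).mpr ?_
  rw [h1, Complex.ofReal_mul, Complex.ofReal_div, Complex.ofReal_intCast, Complex.ofReal_intCast]
  exact mul_mem (div_mem (intCast_mem _ _) (intCast_mem _ _))
    (IntermediateField.mem_adjoin_simple_self ℚ _)

theorem quadraticSubfield_eq_of_isSquare_mul {D D' : ℤ} (hpos : 0 < D) (hpos' : 0 < D')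
    (h : IsSquare (D * D')) : quadraticSubfield D = quadraticSubfield D' :=
  le_antisymm (quadraticSubfield_le_of_isSquare_mul hpos' (by rwa [mul_comm]))
    (quadraticSubfield_le_of_isSquare_mul hpos h)

theorem prime_dvd_of_isSquare_mul {q : ℕ} (hq : q.Prime) {b c : ℤ} (hb : ¬(q : ℤ) ∣ b)
    (h : IsSquare (q * b * c)) : (q : ℤ) ∣ c := by
  have hq' := Nat.prime_iff_prime_int.mp hq
  obtain ⟨s, hs⟩ := h
  obtain ⟨t, rfl⟩ : (q : ℤ) ∣ s :=
    (hq'.dvd_or_dvd (hs ▸ ⟨b * c, by ring⟩ : (q : ℤ) ∣ s * s)).elim id id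
  have h1 : b * c = q * (t * t) :=
    mul_left_cancel₀ hq'.ne_zero (by linear_combination hs)
  exact (hq'.dvd_or_dvd (h1 ▸ dvd_mul_right _ _ : (q : ℤ) ∣ b * c)).resolve_left hb

/-- For a polynomial `f` with positive leading coefficient and `f 0 ≠ 0`, each large prime `q`
exactly divides some positive value `z * f z`, polynomially bounded in `q`, with `z` in a given
residue class. -/
theorem exists_prime_exactly_dvd_mul_hornerEval {l : List ℤ} (hl : l ≠ [])
    (hlast : 0 < l.getLast hl) (hhead : l.headI ≠ 0) {M a : ℕ} (hM : 0 < M) (ha : a % M ≠ 0) :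
    ∃ (L : ℕ) (C : ℤ), 0 < C ∧ ∀ q : ℕ, q.Prime → L < q → ∃ z b : ℤ, z ≡ a [ZMOD M] ∧
      0 < z * hornerEval l z ∧ z * hornerEval l z ≤ C * q ^ (l.length + 1) ∧
      z * hornerEval l z = q * b ∧ ¬(q : ℤ) ∣ b := by
  obtain ⟨N, hN⟩ := exists_forall_hornerEval_append_pos l.dropLast hlast
  rw [List.dropLast_append_getLast] at hN
  obtain ⟨C, hC, hbound⟩ := exists_forall_hornerEval_le l
  refine ⟨max M (max N.toNat l.headI.natAbs), C * (M : ℤ) ^ (l.length + 1), by positivity,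
    fun q hq hL => ?_⟩
  simp only [max_lt_iff] at hL
  obtain ⟨hLM, hLN, hLh⟩ := hL
  have hcop : q.Coprime M :=
    (Nat.Prime.coprime_iff_not_dvd hq).mpr fun h => absurd (Nat.le_of_dvd hM h) (by omega)
  obtain ⟨m, hm, hmod⟩ := Nat.exists_mul_mod_eq_of_coprime a hcop hM.ne'
  have hm0 : 0 < m := by
    rcases Nat.eq_zero_or_pos m with rfl | h
    · rw [mul_zero, Nat.zero_mod] at hmod
      exact absurd hmod.symm ha
    · exact h
  obtain ⟨z, hz⟩ : ∃ z : ℕ, z = q * m := ⟨_, rfl⟩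
  have hz19 : (z : ℤ) ≡ a [ZMOD M] := hz ▸ Int.natCast_modEq_iff.mpr hmod
  have hz1 : q ≤ z := hz ▸ Nat.le_mul_of_pos_right q hm0
  have hzq : 1 ≤ (z : ℤ) := by have := hq.pos; omega
  have hzm : (z : ℤ) = q * m := by rw [hz, Nat.cast_mul]
  have hE : 0 < hornerEval l z := hN _ (by omega)
  refine ⟨z, m * hornerEval l z, hz19, mul_pos (by omega) hE, ?_, by rw [← mul_assoc, ← hzm],
    fun h => ?_⟩
  · have h1 := (le_abs_self _).trans (hbound _ hzq)
    calc z * hornerEval l z ≤ z * (C * (z : ℤ) ^ l.length) :=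
          mul_le_mul_of_nonneg_left h1 (by omega)
      _ = C * (m : ℤ) ^ (l.length + 1) * q ^ (l.length + 1) := by rw [hzm]; ring
      _ ≤ C * (M : ℤ) ^ (l.length + 1) * q ^ (l.length + 1) := by gcongr
  · rcases (Nat.prime_iff_prime_int.mp hq).dvd_or_dvd h with h | h
    · exact absurd (Nat.le_of_dvd hm0 (Int.natCast_dvd_natCast.mp h)) (by omega)
    · have h1 : (q : ℤ) ∣ l.headI := by
        rw [← List.cons_head_tail hl, hornerEval_cons, hzm, mul_assoc] at h
        rw [← List.cons_head_tail hl]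
        exact (Int.dvd_add_left (dvd_mul_right _ _)).mp h
      exact absurd (Nat.le_of_dvd (Int.natAbs_pos.mpr hhead) (Int.natCast_dvd.mp h1)) (by omega)

theorem card_mul_log_two_le_log {P : Finset ℕ} {d : ℕ} (hd : d ≠ 0)
    (hP : ∀ q ∈ P, q.Prime ∧ q ∣ d) : P.card * Real.log 2 ≤ Real.log d := by
  have h1 : ∏ q ∈ P, q ≤ d := Nat.le_of_dvd (Nat.pos_of_ne_zero hd)
    (Finset.prod_primes_dvd d (fun q hq => (hP q hq).1.prime) fun q hq => (hP q hq).2)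
  have h2 : 2 ^ P.card ≤ d :=
    (Finset.pow_card_le_prod _ _ _ fun q hq => (hP q hq).1.two_le).trans h1
  rw [← Real.log_pow]
  exact Real.log_le_log (by positivity) (by exact_mod_cast h2)

theorem card_mul_log_two_le_card_image_mul {α : Type*} [DecidableEq α] {P : Finset ℕ} {F : ℕ → α}
    {d : ℕ → ℕ} {Y : ℝ} (hP : ∀ q ∈ P, q.Prime ∧ d q ≠ 0 ∧ (d q : ℝ) ≤ Y)
    (hF : ∀ q ∈ P, ∀ q' ∈ P, F q = F q' → q ∣ d q') :
    P.card * Real.log 2 ≤ (P.image F).card * Real.log Y := by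
  rw [Finset.card_eq_sum_card_image F P, Nat.cast_sum, Finset.sum_mul, ← nsmul_eq_mul]
  refine Finset.sum_le_card_nsmul _ _ _ fun a ha => ?_
  obtain ⟨q', hq', rfl⟩ := Finset.mem_image.mp ha
  obtain ⟨-, h0, hY⟩ := hP q' hq'
  refine (card_mul_log_two_le_log h0 fun q hq => ?_).trans
    (Real.log_le_log (by positivity) hY)
  rw [Finset.mem_filter] at hq
  exact ⟨(hP q hq.1).1, hF q hq.1 q' hq' hq.2⟩

/-- A weak consequence of Chebyshev's lower bound. -/
theorem exists_forall_sqrt_add_le_primeCounting (L : ℕ) :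
    ∃ N : ℕ, ∀ n ≥ N, √((n : ℝ) + 1) + L ≤ Nat.primeCounting n := by
  refine ⟨(L + 20) ^ 4, fun n hn => ?_⟩
  have hn1 : (1 : ℝ) < n := by
    have : 20 ^ 4 ≤ (L + 20) ^ 4 := Nat.pow_le_pow_left (by omega) 4
    exact_mod_cast (by omega : 1 < n)
  refine le_trans ?_ (Chebyshev.pi_ge n)
  rw [le_div_iff₀ (Real.log_pos hn1)]
  set s : ℝ := ((n : ℝ) + 1) ^ (1 / 4 : ℝ) with hs
  have hs0 : 0 ≤ s := by positivity
  have hs4 : s ^ 4 = n + 1 := by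
    rw [hs, ← Real.rpow_natCast, ← Real.rpow_mul (by positivity)]
    norm_num
  have hsqrt : √((n : ℝ) + 1) = s ^ 2 := by
    rw [← hs4, show s ^ 4 = (s ^ 2) ^ 2 by ring, Real.sqrt_sq (by positivity)]
  have hsL : (L : ℝ) + 20 ≤ s := by
    refine le_of_pow_le_pow_left₀ (n := 4) (by norm_num) hs0 ?_
    rw [hs4]
    have : (((L + 20) ^ 4 : ℕ) : ℝ) ≤ n := by exact_mod_cast hn
    push_cast at this
    linarith
  have hlog1 : Real.log (n + 1) ≤ 4 * s := by
    have := Real.log_le_rpow_div (x := (n : ℝ) + 1) (ε := 1 / 4) (by positivity) (by norm_num)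
    rw [← hs] at this
    linarith
  have hlog : Real.log n ≤ 4 * s :=
    (Real.log_le_log (by linarith) (by linarith)).trans hlog1
  have hlog2 := Real.log_two_gt_d9
  have hL0 : (0 : ℝ) ≤ L := Nat.cast_nonneg L
  have hn' : (n : ℝ) = s ^ 4 - 1 := by rw [hs4]; ring
  rw [hsqrt]
  have h1 : (s ^ 2 + L) * Real.log n ≤ (s ^ 2 + L) * (4 * s) := by gcongr
  have h2 : (n : ℝ) * (1 / 2) ≤ n * Real.log 2 := by gcongr; linarith
  have h3 : (20 : ℝ) ≤ s := by linarith
  have h4 : (s ^ 2 + L) * (4 * s) ≤ (s ^ 2 + s) * (4 * s) := by gcongr; linarith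
  have h5 : 20 * s ≤ s ^ 2 := by nlinarith
  have h6 : 20 * s ^ 2 ≤ s ^ 3 := by nlinarith [sq_nonneg s]
  have h7 : 20 * s ^ 3 ≤ s ^ 4 := by nlinarith [pow_nonneg hs0 3]
  nlinarith

theorem exists_forall_prime_gt_familyDisc : ∃ (L : ℕ) (C : ℤ), 0 < C ∧ ∀ q : ℕ, q.Prime → L < q →
    ∃ z b : ℤ, z ≡ 19 [ZMOD paramModulus] ∧ 0 < familyDisc z ∧ familyDisc z ≤ C * q ^ 25 ∧
      familyDisc z = q * b ∧ ¬(q : ℤ) ∣ b :=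
  exists_prime_exactly_dvd_mul_hornerEval (l := reducedDiscCoeffs) (M := paramModulus) (a := 19)
    (by decide) (by decide +kernel) (by decide +kernel) (by decide +kernel) (by decide +kernel)

theorem eventually_sqrt_primeCounting_floor (L : ℕ) (C : ℝ) : ∀ᶠ X : ℝ in Filter.atTop,
    1 < X ∧ C * (⌊X ^ (1 / 50 : ℝ)⌋₊ : ℝ) ^ 25 < X ∧
      X ^ (1 / 141 : ℝ) + L ≤ Nat.primeCounting ⌊X ^ (1 / 50 : ℝ)⌋₊ := by
  obtain ⟨N, hN⟩ := exists_forall_sqrt_add_le_primeCounting L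
  have hT := (tendsto_nat_floor_atTop (α := ℝ)).comp
    (tendsto_rpow_atTop (by norm_num : (0 : ℝ) < 1 / 50))
  filter_upwards [hT.eventually_ge_atTop N, Filter.eventually_gt_atTop 1,
    Filter.eventually_gt_atTop (C ^ 2)] with X hXN hX1 hXC
  have hX0 : 0 ≤ X := by linarith
  refine ⟨hX1, ?_, ?_⟩
  · have h1 : (⌊X ^ (1 / 50 : ℝ)⌋₊ : ℝ) ^ 25 ≤ √X := by
      calc (⌊X ^ (1 / 50 : ℝ)⌋₊ : ℝ) ^ 25 ≤ (X ^ (1 / 50 : ℝ)) ^ 25 := by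
            gcongr
            exact Nat.floor_le (by positivity)
        _ = √X := by
            rw [Real.sqrt_eq_rpow, ← Real.rpow_natCast, ← Real.rpow_mul hX0]
            norm_num
    have h2 : |C| < √X := Real.lt_sqrt_of_sq_lt (by rwa [sq_abs])
    calc C * (⌊X ^ (1 / 50 : ℝ)⌋₊ : ℝ) ^ 25 ≤ |C| * √X := by
          gcongr
          exact le_abs_self C
      _ < √X * √X := by
          gcongr
      _ = X := Real.mul_self_sqrt hX0
  · refine le_trans ?_ (hN _ hXN)
    gcongr
    calc X ^ (1 / 141 : ℝ) ≤ X ^ (1 / 50 * (1 / 2) : ℝ) :=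
          Real.rpow_le_rpow_of_exponent_le hX1.le (by norm_num)
      _ = √(X ^ (1 / 50 : ℝ)) := by rw [Real.sqrt_eq_rpow, Real.rpow_mul hX0]
      _ ≤ _ := Real.sqrt_le_sqrt (Nat.lt_floor_add_one _).le

/-- There are `≫ X^(1/141)/log X` real quadratic fields `k` with `|Disc(k)| < X` and `rank_3 Cl(k) ≥ 3`. -/
theorem craig_real_quantitative  :
    ∃ c : ℝ, 0 < c ∧ ∃ X₀ : ℝ, ∀ X : ℝ, X₀ ≤ X →
      ∃ S : Finset (Subfield ℂ),
        -- the fields in `S` are pairwise non-isomorphic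
        (∀ K ∈ S, ∀ L ∈ S, Nonempty (↥K ≃+* ↥L) → K = L) ∧
        (∀ K ∈ S,
          -- `K` is a quadratic field of the prescribed signature
          Module.finrank ℚ ↥K = 2 ∧
          (∀ φ : ↥K →+* ℂ, ∀ a : ↥K, (φ a).im = 0) ∧
          NumberField ↥K ∧
          (∀ [NumberField ↥K],
            -- `|Disc K| < X`
            |(NumberField.discr ↥K : ℝ)| < X ∧
            -- the `m`-rank condition on the class group
            ∃ f : (Fin 3 → ZMod 3) →+ Additive (ClassGroup (𝓞 ↥K)), Function.Injective f)) ∧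
        c * X ^ ((1 : ℝ) / 141) / Real.log X ≤ S.card := by
  classical
  obtain ⟨L, C, hC, hfam⟩ := exists_forall_prime_gt_familyDisc
  obtain ⟨X₀, hX₀⟩ := Filter.eventually_atTop.mp
    (eventually_sqrt_primeCounting_floor (L + 1) (4 * C))
  refine ⟨Real.log 2, Real.log_pos one_lt_two, X₀, fun X hX => ?_⟩
  obtain ⟨hX1, hTX, hπ⟩ := hX₀ X hX
  set T := ⌊X ^ (1 / 50 : ℝ)⌋₊
  choose! z b hz hpos hle hb hndvd using hfam
  set P := (Nat.primesLE T).filter (L < ·)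
  have hP : ∀ q ∈ P, q.Prime ∧ L < q ∧ q ≤ T := fun q hq => by
    rw [Finset.mem_filter, Nat.mem_primesLE] at hq
    exact ⟨hq.1.2, hq.2, hq.1.1⟩
  have hns : ∀ q ∈ P, ¬IsSquare (familyDisc (z q)) := fun q hq =>
    not_isSquare_familyDisc (hz q (hP q hq).1 (hP q hq).2.1)
  have hpos' : ∀ q ∈ P, 0 < familyDisc (z q) := fun q hq => hpos q (hP q hq).1 (hP q hq).2.1
  have hltX : ∀ q ∈ P, 4 * (familyDisc (z q) : ℝ) < X := fun q hq => by
    obtain ⟨hq1, hqL, hqT⟩ := hP q hq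
    refine lt_of_le_of_lt ?_ hTX
    have h1 : (familyDisc (z q) : ℝ) ≤ C * (q : ℝ) ^ 25 := by exact_mod_cast hle q hq1 hqL
    have h2 : (C : ℝ) * (q : ℝ) ^ 25 ≤ C * (T : ℝ) ^ 25 := by gcongr
    linarith
  refine ⟨P.image fun q => quadraticSubfield (familyDisc (z q)), ?_, ?_, ?_⟩
  · simp only [Finset.mem_image]
    rintro _ ⟨q, hq, rfl⟩ _ ⟨q', hq', rfl⟩ h
    exact quadraticSubfield_eq_of_isSquare_mul (hpos' q hq) (hpos' q' hq')
      (isSquare_mul_of_ringEquiv (hpos' q hq) (hns q hq) (hpos' q' hq') (hns q' hq') h)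
  · simp only [Finset.mem_image]
    rintro _ ⟨q, hq, rfl⟩
    refine ⟨finrank_quadraticSubfield (hpos' q hq) (hns q hq),
      im_eq_zero_of_quadraticSubfield (hpos' q hq) (hns q hq),
      numberField_quadraticSubfield (hpos' q hq) (hns q hq), fun {_} => ⟨?_, ?_⟩⟩
    · refine lt_of_le_of_lt ?_ (hltX q hq)
      exact_mod_cast abs_discr_quadraticSubfield_le (hpos' q hq) (hns q hq)
    · have hzq := hz q (hP q hq).1 (hP q hq).2.1
      exact exists_injective_classGroup_quadraticSubfield (hpos' q hq) (hns q hq)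
        (fun i => trace_sq_sub_four_mul_norm_cube i (z q)) (isCoprime_norm_trace hzq)
        (cubicResidueData_familyDisc hzq)
  · have hcount := card_mul_log_two_le_card_image_mul (P := P) (Y := X)
      (F := fun q => quadraticSubfield (familyDisc (z q)))
      (d := fun q => (familyDisc (z q)).natAbs)
      (fun q hq => ⟨(hP q hq).1, Int.natAbs_ne_zero.mpr (hpos' q hq).ne', by
        have h0 : (0 : ℝ) < familyDisc (z q) := by exact_mod_cast hpos' q hq
        rw [Nat.cast_natAbs, abs_of_pos (hpos' q hq)]
        linarith [hltX q hq]⟩)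
      (fun q hq q' hq' h => by
        obtain ⟨hq1, hqL, -⟩ := hP q hq
        refine Int.natCast_dvd.mp (prime_dvd_of_isSquare_mul hq1 (hndvd q hq1 hqL) ?_)
        rw [← hb q hq1 hqL]
        refine isSquare_mul_of_ringEquiv (hpos' q hq) (hns q hq) (hpos' q' hq') (hns q' hq') ?_
        rw [h]
        exact ⟨RingEquiv.refl _⟩)
    have hcard : (Nat.primeCounting T : ℝ) ≤ P.card + ((L + 1 : ℕ) : ℝ) := by
      rw [← Nat.primesLE_card_eq_primeCounting, ← Finset.card_range (L + 1)]
      refine mod_cast (Finset.card_le_card fun q hq => ?_).trans (Finset.card_union_le P _)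
      rw [Finset.mem_union, Finset.mem_filter, Finset.mem_range]
      by_cases h : L < q
      · exact Or.inl ⟨hq, h⟩
      · exact Or.inr (by omega)
    rw [div_le_iff₀ (Real.log_pos hX1), mul_comm (Real.log 2)]
    refine le_trans ?_ hcount
    have := Real.log_pos one_lt_two
    gcongr
    linarith
end
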